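/- arXiv:0809.1391 — 3 statements merged into one kernel-verified Lean document; each statement's English description precedes it below -/
import Mathlib

section
/- For every integer g with 1 ≤ g ≤ 4, every γ = [[A,B],[C,D]] ∈ Γ_g(1,2) and every τ ∈ ℍ_g: Ξ^{(g)}[0](γ∘τ) = det(Cτ+D)⁸·Ξ^{(g)}[0](τ); that is, Ξ^{(g)}[0] is a modular form of weight 8 with respect to Γ_g(1,2). -/
open scoped BigOperators

noncomputable section

/-- The Siegel upper half-space: symmetric complex matrices with positive
definite imaginary part (indexed by a finite type `ι`). -/
def Siegel (ι : Type) [Fintype ι] : Set (Matrix ι ι ℂ) :=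
  {τ | τ.IsSymm ∧ ∀ v : ι → ℝ, v ≠ 0 → 0 < ∑ i, ∑ j, v i * (τ i j).im * v j}

/-- The theta function with characteristic `[ε, δ]`. -/
def theta {ι : Type} [Fintype ι] (ε δ : ι → ZMod 2) (τ : Matrix ι ι ℂ) (z : ι → ℂ) : ℂ :=
  ∑' n : ι → ℤ, Complex.exp ((Real.pi : ℂ) * Complex.I *
    ((∑ i, ∑ j, ((n i : ℂ) + ((ε i).val : ℂ) / 2) * τ i j * ((n j : ℂ) + ((ε j).val : ℂ) / 2)) +
     2 * ∑ i, ((n i : ℂ) + ((ε i).val : ℂ) / 2) * (z i + ((δ i).val : ℂ) / 2)))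

/-- A theta characteristic, an element of `𝔽₂^{2g}`. -/
abbrev Char2 (ι : Type) := (ι → ZMod 2) × (ι → ZMod 2)

/-- Theta function, with the characteristic as a pair. -/
def thetaChar {ι : Type} [Fintype ι] (m : Char2 ι) (τ : Matrix ι ι ℂ) (z : ι → ℂ) : ℂ :=
  theta m.1 m.2 τ z

/-- Theta constant. -/
def thetaConst {ι : Type} [Fintype ι] (m : Char2 ι) (τ : Matrix ι ι ℂ) : ℂ :=
  thetaChar m τ 0

/-- `W` is (the underlying finite set of) an `i`-dimensional linear subspace of `𝔽₂^{2g}`. -/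
def IsLinearSubspaceDim {ι : Type} [Fintype ι] (i : ℕ) (W : Finset (Char2 ι)) : Prop :=
  ∃ V : Submodule (ZMod 2) (Char2 ι),
    Module.finrank (ZMod 2) V = i ∧ (W : Set (Char2 ι)) = (V : Set (Char2 ι))

/-- The modular form `P_{i,s}^g(τ) = Σ_V (Π_{v∈V} θ_v(τ))^s`, the sum over all
`i`-dimensional linear subspaces `V` of `𝔽₂^{2g}`. -/
noncomputable def Pform (ι : Type) [Fintype ι] (i s : ℕ) (τ : Matrix ι ι ℂ) : ℂ :=
  letI := Classical.propDecidable
  ∑ W ∈ Finset.univ.filter (fun W : Finset (Char2 ι) => IsLinearSubspaceDim i W),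
    (∏ w ∈ W, thetaConst w τ) ^ s

/-- The standard symplectic form `J`. -/
def symplJ (g : ℕ) : Matrix (Fin g ⊕ Fin g) (Fin g ⊕ Fin g) ℤ :=
  Matrix.fromBlocks 0 1 (-1) 0

/-- The block matrix `[[A,B],[C,D]]` is in `Sp(2g,ℤ)`. -/
def IsSymplectic {g : ℕ} (A B C D : Matrix (Fin g) (Fin g) ℤ) : Prop :=
  Matrix.fromBlocks A B C D * symplJ g * (Matrix.fromBlocks A B C D).transpose = symplJ g

/-- The block matrix `[[A,B],[C,D]]` is in Igusa's subgroup `Γ_g(1,2) ⊂ Sp(2g,ℤ)`: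
symplectic, with `diag(ABᵀ) ≡ diag(CDᵀ) ≡ 0 mod 2`. -/
def InGammaOneTwo {g : ℕ} (A B C D : Matrix (Fin g) (Fin g) ℤ) : Prop :=
  IsSymplectic A B C D ∧ (∀ i, (A * B.transpose) i i % 2 = 0) ∧ (∀ i, (C * D.transpose) i i % 2 = 0)

/-- The action `γ∘τ = (Aτ+B)(Cτ+D)⁻¹` of `Sp(2g,ℤ)` on the Siegel upper half-space. -/
noncomputable def symplAction {g : ℕ} (A B C D : Matrix (Fin g) (Fin g) ℤ)
    (τ : Matrix (Fin g) (Fin g) ℂ) : Matrix (Fin g) (Fin g) ℂ :=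
  (A.map (Int.cast : ℤ → ℂ) * τ + B.map (Int.cast : ℤ → ℂ)) *
    (C.map (Int.cast : ℤ → ℂ) * τ + D.map (Int.cast : ℤ → ℂ))⁻¹

/-- The proposed chiral superstring measure
`Ξ^{(g)}[0](τ) = 2^{−g}·Σ_{i=0}^g (−1)^i·2^{i(i−1)/2}·P_{i,2^{4−i}}^g(τ)`. -/
noncomputable def XiZero (ι : Type) [Fintype ι] (τ : Matrix ι ι ℂ) : ℂ :=
  (2 : ℂ)⁻¹ ^ Fintype.card ι * ∑ i ∈ Finset.range (Fintype.card ι + 1),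
    (-1 : ℂ) ^ i * 2 ^ (i * (i - 1) / 2) * Pform ι i (2 ^ (4 - i)) τ

namespace SymplecticGenerators

open Matrix

variable {ι : Type} [DecidableEq ι]

/-- The integral symmetric matrix with `k`-th row and column `x` and all other entries zero. -/
def crossMatrix (k : ι) (x : ι → ℤ) : Matrix ι ι ℤ :=
  of fun i j => if i = k then x j else if j = k then x i else 0

theorem crossMatrix_isSymm (k : ι) (x : ι → ℤ) : (crossMatrix k x).IsSymm := by
  ext i j
  by_cases hi : i = k <;> by_cases hj : j = k <;> simp [crossMatrix, hi, hj]

theorem crossMatrix_add (k : ι) (x y : ι → ℤ) :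
    crossMatrix k (x + y) = crossMatrix k x + crossMatrix k y := by
  ext i j
  by_cases hi : i = k <;> by_cases hj : j = k <;> simp [crossMatrix, hi, hj]

variable [Fintype ι]

/-- The symplectic matrix `[[1, S], [0, 1]]` attached to a symmetric matrix `S`. -/
def translation (S : Matrix ι ι ℤ) (hS : S.IsSymm) : symplecticGroup ι ℤ :=
  ⟨fromBlocks 1 S 0 1, by
    rw [SymplecticGroup.fromBlocks_mem_iff]
    simp [hS.eq]⟩

/-- The diagonal idempotent matrix supported on `t`. -/
def coordProj (R : Type) [Zero R] [One R] (t : Finset ι) : Matrix ι ι R :=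
  diagonal fun i => if i ∈ t then 1 else 0

/-- The symplectic matrix acting as `(a, c) ↦ (-c, a)` on the coordinate planes indexed by `t`
and trivially on the others. -/
def partialInversion (t : Finset ι) : symplecticGroup ι ℤ :=
  ⟨fromBlocks (1 - coordProj ℤ t) (-coordProj ℤ t) (coordProj ℤ t) (1 - coordProj ℤ t), by
    have h : coordProj ℤ t * coordProj ℤ t = coordProj ℤ t := by
      simp [coordProj, diagonal_mul_diagonal]
    have ht : (coordProj ℤ t)ᵀ = coordProj ℤ t := by simp [coordProj]
    rw [SymplecticGroup.fromBlocks_mem_iff]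
    simp [ht, mul_sub, sub_mul, h]⟩

theorem translation_mulVec_inl (S : Matrix ι ι ℤ) (hS : S.IsSymm) (v : ι ⊕ ι → ℤ) (i : ι) :
    ((translation S hS).1 *ᵥ v) (Sum.inl i) =
      v (Sum.inl i) + (S *ᵥ fun j => v (Sum.inr j)) i := by
  simp [translation, fromBlocks_mulVec, Function.comp_def]

theorem translation_mulVec_inr (S : Matrix ι ι ℤ) (hS : S.IsSymm) (v : ι ⊕ ι → ℤ) (i : ι) :
    ((translation S hS).1 *ᵥ v) (Sum.inr i) = v (Sum.inr i) := by
  simp [translation, fromBlocks_mulVec]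

theorem partialInversion_mulVec_inl (t : Finset ι) (v : ι ⊕ ι → ℤ) (i : ι) :
    ((partialInversion t).1 *ᵥ v) (Sum.inl i) =
      if i ∈ t then -v (Sum.inr i) else v (Sum.inl i) := by
  simp only [partialInversion, fromBlocks_mulVec, coordProj, sub_mulVec, neg_mulVec, Sum.elim_inl,
    Pi.add_apply, Pi.sub_apply, Pi.neg_apply, one_mulVec, mulVec_diagonal, Function.comp_apply]
  split_ifs <;> simp

theorem partialInversion_mulVec_inr (t : Finset ι) (v : ι ⊕ ι → ℤ) (i : ι) :
    ((partialInversion t).1 *ᵥ v) (Sum.inr i) =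
      if i ∈ t then v (Sum.inl i) else v (Sum.inr i) := by
  simp only [partialInversion, fromBlocks_mulVec, coordProj, sub_mulVec, Sum.elim_inr,
    Pi.add_apply, Pi.sub_apply, one_mulVec, mulVec_diagonal, Function.comp_apply]
  split_ifs <;> simp

theorem translation_mul (S T : Matrix ι ι ℤ) (hS : S.IsSymm) (hT : T.IsSymm) :
    translation S hS * translation T hT = translation (S + T) (hS.add hT) := by
  apply Subtype.ext
  simp [translation, fromBlocks_multiply, add_comm]

theorem translation_zero : translation (0 : Matrix ι ι ℤ) isSymm_zero = 1 := by
  apply Subtype.ext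
  simp [translation]

theorem translation_inv (S : Matrix ι ι ℤ) (hS : S.IsSymm) :
    (translation S hS)⁻¹ = translation (-S) hS.neg := by
  rw [inv_eq_iff_mul_eq_one, translation_mul, ← translation_zero]
  congr 1
  simp

theorem eq_of_mulVec_eq {γ δ : symplecticGroup ι ℤ}
    (h : ∀ v : ι ⊕ ι → ℤ, γ.1 *ᵥ v = δ.1 *ᵥ v) : γ = δ :=
  Subtype.ext (Matrix.mulVec_injective (funext h))

theorem partialInversion_empty : partialInversion (∅ : Finset ι) = 1 := by
  apply eq_of_mulVec_eq
  intro v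
  ext (i | i) <;> simp [partialInversion_mulVec_inl, partialInversion_mulVec_inr]

theorem partialInversion_insert {i : ι} {t : Finset ι} (hi : i ∉ t) :
    partialInversion (insert i t) = partialInversion {i} * partialInversion t := by
  apply eq_of_mulVec_eq
  intro v
  rw [Submonoid.coe_mul, ← mulVec_mulVec]
  ext (j | j) <;>
  · by_cases hj : j = i
    · subst hj
      simp [partialInversion_mulVec_inl, partialInversion_mulVec_inr, hi]
    · simp [partialInversion_mulVec_inl, partialInversion_mulVec_inr, hj]

theorem partialInversion_pow_four (t : Finset ι) : partialInversion t ^ 4 = 1 := by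
  apply eq_of_mulVec_eq
  intro v
  simp only [pow_succ, pow_zero, one_mul, Submonoid.coe_mul, ← mulVec_mulVec, Submonoid.coe_one,
    one_mulVec]
  ext (j | j) <;>
  · by_cases hj : j ∈ t <;>
      simp only [partialInversion_mulVec_inl, partialInversion_mulVec_inr, hj, if_true, if_false,
        neg_neg]

theorem crossMatrix_mulVec_self (k : ι) (x c : ι → ℤ) :
    (crossMatrix k x *ᵥ c) k = ∑ j, x j * c j := by
  simp [crossMatrix, mulVec, dotProduct]

theorem crossMatrix_mulVec_ne {k i : ι} (h : i ≠ k) (x c : ι → ℤ) :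
    (crossMatrix k x *ᵥ c) i = x i * c k := by
  simp [crossMatrix, mulVec, dotProduct, h]

/-- The subgroup `K` contains all elementary translations and all inversions in one coordinate
plane. -/
structure ContainsGenerators (K : Subgroup (symplecticGroup ι ℤ)) : Prop where
  translation_mem : ∀ k j : ι,
    translation (crossMatrix k (Pi.single j 1)) (crossMatrix_isSymm _ _) ∈ K
  inversion_mem : ∀ k : ι, partialInversion {k} ∈ K

variable {K : Subgroup (symplecticGroup ι ℤ)}

theorem ContainsGenerators.partialInversion_mem (hK : ContainsGenerators K) (t : Finset ι) :
    partialInversion t ∈ K := by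
  induction t using Finset.induction_on with
  | empty => rw [partialInversion_empty]; exact K.one_mem
  | insert i t hi ih =>
    rw [partialInversion_insert hi]
    exact K.mul_mem (hK.inversion_mem i) ih

theorem ContainsGenerators.crossMatrix_mem (hK : ContainsGenerators K) (k : ι) (x : ι → ℤ) :
    translation (crossMatrix k x) (crossMatrix_isSymm _ _) ∈ K := by
  let H : AddSubgroup (ι → ℤ) :=
    { carrier := {x | translation (crossMatrix k x) (crossMatrix_isSymm _ _) ∈ K}
      add_mem' := by
        intro x y hx hy
        have := K.mul_mem hx hy
        rw [translation_mul] at this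
        simpa only [Set.mem_ofPred_eq, crossMatrix_add] using this
      zero_mem' := by
        have h0 : crossMatrix k (0 : ι → ℤ) = 0 := by ext; simp [crossMatrix]
        simp only [Set.mem_ofPred_eq, h0, translation_zero, K.one_mem]
      neg_mem' := by
        intro x hx
        have := K.inv_mem hx
        rw [translation_inv] at this
        have h0 : crossMatrix k (-x) = -crossMatrix k x := by
          ext i j
          by_cases hi : i = k <;> by_cases hj : j = k <;> simp [crossMatrix, hi, hj]
        simpa only [Set.mem_ofPred_eq, h0] using this }
  have hx : x = ∑ j, x j • (Pi.single j 1 : ι → ℤ) := by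
    ext i
    simp [Finset.sum_apply, Pi.single_apply]
  change x ∈ H
  rw [hx]
  exact H.sum_mem fun j _ => H.zsmul_mem (hK.translation_mem k j) _

/-- The subgroup of symplectic matrices acting trivially on the coordinate planes outside `s`. -/
def fixOutside (s : Finset ι) : Subgroup (symplecticGroup ι ℤ) where
  carrier := {γ | ∀ j ∉ s, γ.1 *ᵥ Pi.single (Sum.inl j) 1 = Pi.single (Sum.inl j) 1 ∧
    γ.1 *ᵥ Pi.single (Sum.inr j) 1 = Pi.single (Sum.inr j) 1}
  one_mem' := fun j _ => ⟨one_mulVec _, one_mulVec _⟩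
  mul_mem' := by
    intro γ δ hγ hδ j hj
    simp only [Submonoid.coe_mul, ← mulVec_mulVec]
    simp only [(hδ j hj).1, (hδ j hj).2, (hγ j hj).1, (hγ j hj).2, and_self]
  inv_mem' := by
    intro γ hγ j hj
    have key : ∀ v : ι ⊕ ι → ℤ, γ.1 *ᵥ v = v → (γ⁻¹).1 *ᵥ v = v := by
      intro v hv
      conv_lhs => rw [← hv]
      rw [mulVec_mulVec, ← Submonoid.coe_mul, inv_mul_cancel]
      simp
    exact ⟨key _ (hγ j hj).1, key _ (hγ j hj).2⟩

theorem translation_crossMatrix_mem_fixOutside {s : Finset ι} {k : ι} (hk : k ∈ s) {x : ι → ℤ}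
    (hx : ∀ j ∉ s, x j = 0) :
    translation (crossMatrix k x) (crossMatrix_isSymm _ _) ∈ fixOutside s := by
  intro j hj
  have hjk : j ≠ k := fun h => hj (h ▸ hk)
  constructor
  · ext (i | i)
    · rw [translation_mulVec_inl]
      simp [mulVec, dotProduct]
    · rw [translation_mulVec_inr]
  · ext (i | i)
    · rw [translation_mulVec_inl]
      by_cases hi : i = k
      · subst hi
        rw [crossMatrix_mulVec_self]
        simp [Pi.single_apply, hx j hj]
      · rw [crossMatrix_mulVec_ne hi]
        simp [hjk.symm]
    · rw [translation_mulVec_inr]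

theorem partialInversion_mem_fixOutside {s t : Finset ι} (h : t ⊆ s) :
    partialInversion t ∈ fixOutside s := by
  intro j hj
  have hjt : j ∉ t := fun hj' => hj (h hj')
  constructor <;> ext (i | i)
  all_goals
    simp only [partialInversion_mulVec_inl, partialInversion_mulVec_inr, Pi.single_apply]
    split_ifs <;> simp_all

/-- The standard symplectic pairing. -/
def pairing (x y : ι ⊕ ι → ℤ) : ℤ := x ⬝ᵥ (J ι ℤ *ᵥ y)

theorem pairing_mulVec (γ : symplecticGroup ι ℤ) (x y : ι ⊕ ι → ℤ) :
    pairing (γ.1 *ᵥ x) (γ.1 *ᵥ y) = pairing x y := by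
  have h := SymplecticGroup.mem_iff'.1 γ.2
  unfold pairing
  conv_rhs => rw [← h]
  rw [← mulVec_mulVec, ← mulVec_mulVec, dotProduct_mulVec x, vecMul_transpose]

theorem pairing_eq_sum (x y : ι ⊕ ι → ℤ) :
    pairing x y = ∑ i, (x (Sum.inr i) * y (Sum.inl i) - x (Sum.inl i) * y (Sum.inr i)) := by
  simp only [pairing, J, fromBlocks_mulVec, dotProduct, Fintype.sum_sum_type]
  simp [neg_mulVec, Finset.sum_sub_distrib]
  ring

theorem pairing_single_inl (x : ι ⊕ ι → ℤ) (j : ι) :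
    pairing x (Pi.single (Sum.inl j) 1) = x (Sum.inr j) := by
  rw [pairing_eq_sum]
  simp [Pi.single_apply]

theorem pairing_single_inr (x : ι ⊕ ι → ℤ) (j : ι) :
    pairing x (Pi.single (Sum.inr j) 1) = -x (Sum.inl j) := by
  rw [pairing_eq_sum]
  simp [Pi.single_apply]

theorem mulVec_apply_eq_zero {s : Finset ι} {γ : symplecticGroup ι ℤ} (hγ : γ ∈ fixOutside s)
    {v : ι ⊕ ι → ℤ} (hv : ∀ j ∉ s, v (Sum.inl j) = 0 ∧ v (Sum.inr j) = 0) :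
    ∀ j ∉ s, (γ.1 *ᵥ v) (Sum.inl j) = 0 ∧ (γ.1 *ᵥ v) (Sum.inr j) = 0 := by
  intro j hj
  have h1 := pairing_mulVec γ v (Pi.single (Sum.inl j) 1)
  have h2 := pairing_mulVec γ v (Pi.single (Sum.inr j) 1)
  rw [(hγ j hj).1, pairing_single_inl, pairing_single_inl, (hv j hj).2] at h1
  rw [(hγ j hj).2, pairing_single_inr, pairing_single_inr, (hv j hj).1, neg_inj] at h2
  exact ⟨h2, h1⟩

/-- The sum of the absolute values of the coordinates. -/
def height (v : ι ⊕ ι → ℤ) : ℕ := ∑ i, ((v (Sum.inl i)).natAbs + (v (Sum.inr i)).natAbs)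

theorem le_of_sum_le_sum_of_eq_off {f g : ι → ℕ} {i j : ι} (hij : i ≠ j)
    (h : ∀ l, l ≠ i → l ≠ j → f l = g l) (hs : ∑ l, f l ≤ ∑ l, g l) : f i + f j ≤ g i + g j := by
  have hj : j ∈ Finset.univ.erase i := Finset.mem_erase.2 ⟨hij.symm, Finset.mem_univ j⟩
  rw [← Finset.add_sum_erase _ f (Finset.mem_univ i), ← Finset.add_sum_erase _ f hj,
    ← Finset.add_sum_erase _ g (Finset.mem_univ i), ← Finset.add_sum_erase _ g hj] at hs
  have : ∑ x ∈ (Finset.univ.erase i).erase j, f x = ∑ x ∈ (Finset.univ.erase i).erase j, g x :=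
    Finset.sum_congr rfl fun l hl => by
      simp only [Finset.mem_erase] at hl
      exact h l hl.2.1 hl.1
  omega

theorem le_of_sum_le_sum_of_eq_off_one {f g : ι → ℕ} {i : ι}
    (h : ∀ l, l ≠ i → f l = g l) (hs : ∑ l, f l ≤ ∑ l, g l) : f i ≤ g i := by
  rw [← Finset.add_sum_erase _ f (Finset.mem_univ i),
    ← Finset.add_sum_erase _ g (Finset.mem_univ i)] at hs
  have : ∑ x ∈ Finset.univ.erase i, f x = ∑ x ∈ Finset.univ.erase i, g x :=
    Finset.sum_congr rfl fun l hl => h l (Finset.ne_of_mem_erase hl)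
  omega

theorem height_partialInversion (t : Finset ι) (v : ι ⊕ ι → ℤ) :
    height ((partialInversion t).1 *ᵥ v) = height v := by
  unfold height
  refine Finset.sum_congr rfl fun i _ => ?_
  rw [partialInversion_mulVec_inl, partialInversion_mulVec_inr]
  split_ifs <;> omega

/-- `w` has minimal height in its orbit under the elements of `K` supported on `s`. -/
def IsReduced (K : Subgroup (symplecticGroup ι ℤ)) (s : Finset ι) (w : ι ⊕ ι → ℤ) : Prop :=
  ∀ γ ∈ K ⊓ fixOutside s, height w ≤ height (γ.1 *ᵥ w)

theorem IsReduced.invert (hK : ContainsGenerators K) {s t : Finset ι} (ht : t ⊆ s)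
    {w : ι ⊕ ι → ℤ} (hw : IsReduced K s w) :
    IsReduced K s ((partialInversion t).1 *ᵥ w) := by
  intro γ hγ
  rw [height_partialInversion, mulVec_mulVec, ← Submonoid.coe_mul]
  exact hw _ (mul_mem hγ ⟨hK.partialInversion_mem t, partialInversion_mem_fixOutside ht⟩)

theorem IsReduced.natAbs_le (hK : ContainsGenerators K) {s : Finset ι} {w : ι ⊕ ι → ℤ}
    (hw : IsReduced K s w) {i : ι} (hi : i ∈ s) (σ : ℤ) :
    (w (Sum.inl i)).natAbs ≤ (w (Sum.inl i) + σ * w (Sum.inr i)).natAbs := by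
  have h := hw _ ⟨hK.crossMatrix_mem i (Pi.single i σ), translation_crossMatrix_mem_fixOutside hi
    fun j hj => by simp [(ne_of_mem_of_not_mem hi hj).symm]⟩
  have := le_of_sum_le_sum_of_eq_off_one (i := i) ?_ h
  · simp only [translation_mulVec_inl, translation_mulVec_inr, crossMatrix_mulVec_self] at this
    simpa [Pi.single_apply] using this
  · intro l hl
    simp [translation_mulVec_inl, translation_mulVec_inr, crossMatrix_mulVec_ne hl, hl]

theorem IsReduced.natAbs_add_le (hK : ContainsGenerators K) {s : Finset ι} {w : ι ⊕ ι → ℤ}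
    (hw : IsReduced K s w) {i j : ι} (hi : i ∈ s) (hj : j ∈ s) (hij : i ≠ j) (σ : ℤ) :
    (w (Sum.inl i)).natAbs + (w (Sum.inl j)).natAbs ≤
      (w (Sum.inl i) + σ * w (Sum.inr j)).natAbs + (w (Sum.inl j) + σ * w (Sum.inr i)).natAbs := by
  have h := hw _ ⟨hK.crossMatrix_mem i (Pi.single j σ), translation_crossMatrix_mem_fixOutside hi
    fun l hl => by simp [(ne_of_mem_of_not_mem hj hl).symm]⟩
  have := le_of_sum_le_sum_of_eq_off hij ?_ h
  · simp only [translation_mulVec_inl, translation_mulVec_inr, crossMatrix_mulVec_self,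
      crossMatrix_mulVec_ne hij.symm] at this
    simp only [Pi.single_apply, ite_mul, zero_mul, Finset.sum_ite_eq', Finset.mem_univ,
      if_true] at this
    omega
  · intro l hl hl'
    simp [translation_mulVec_inl, translation_mulVec_inr, crossMatrix_mulVec_ne hl, hl']

theorem IsReduced.eq_zero_or (hK : ContainsGenerators K) {s : Finset ι} {w : ι ⊕ ι → ℤ}
    (hw : IsReduced K s w) {i : ι} (hi : i ∈ s) : w (Sum.inl i) = 0 ∨ w (Sum.inr i) = 0 := by
  have h1 := hw.natAbs_le hK hi 1
  have h2 := hw.natAbs_le hK hi (-1)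
  have hw' := hw.invert hK (t := {i}) (by simpa using hi)
  have h3 := hw'.natAbs_le hK hi 1
  have h4 := hw'.natAbs_le hK hi (-1)
  simp only [partialInversion_mulVec_inl, partialInversion_mulVec_inr, Finset.mem_singleton,
    if_true] at h3 h4
  omega

theorem IsReduced.pair_eq_zero_or (hK : ContainsGenerators K) {s : Finset ι} {w : ι ⊕ ι → ℤ}
    (hw : IsReduced K s w) {i j : ι} (hi : i ∈ s) (hj : j ∈ s) (hij : i ≠ j) :
    (w (Sum.inl i) = 0 ∧ w (Sum.inr i) = 0) ∨ (w (Sum.inl j) = 0 ∧ w (Sum.inr j) = 0) := by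
  have key : ∀ t ⊆ ({i, j} : Finset ι), ∀ σ : ℤ, _ := fun t ht σ =>
    (hw.invert hK (t := t) (ht.trans (by simp [Finset.insert_subset_iff, hi, hj]))
      ).natAbs_add_le hK hi hj hij σ
  have e1 := key ∅ (by simp) 1
  have e2 := key ∅ (by simp) (-1)
  have i1 := key {i} (by simp) 1
  have i2 := key {i} (by simp) (-1)
  have j1 := key {j} (by simp) 1
  have j2 := key {j} (by simp) (-1)
  have b1 := key {i, j} (by simp) 1
  have b2 := key {i, j} (by simp) (-1)
  simp only [partialInversion_mulVec_inl, partialInversion_mulVec_inr, Finset.mem_singleton,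
    Finset.mem_insert, Finset.notMem_empty, hij, hij.symm, if_true, if_false, or_true,
    or_false] at e1 e2 i1 i2 j1 j2 b1 b2
  rcases hw.eq_zero_or hK hi with h | h <;> rcases hw.eq_zero_or hK hj with h' | h' <;>
    rw [h, h'] at e1 e2 i1 i2 j1 j2 b1 b2 <;> rw [h, h'] <;> omega

theorem exists_isReduced (K : Subgroup (symplecticGroup ι ℤ)) (s : Finset ι) (v : ι ⊕ ι → ℤ) :
    ∃ γ ∈ K ⊓ fixOutside s, IsReduced K s (γ.1 *ᵥ v) := by
  obtain ⟨γ, hγ, hmin⟩ := (measure fun γ : symplecticGroup ι ℤ => height (γ.1 *ᵥ v)).wf.has_min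
    (K ⊓ fixOutside s : Subgroup _) ⟨1, one_mem _⟩
  refine ⟨γ, hγ, fun δ hδ => ?_⟩
  rw [mulVec_mulVec, ← Submonoid.coe_mul]
  exact not_lt.1 (hmin _ (mul_mem hδ hγ))

theorem exists_mulVec_single_eq (hK : ContainsGenerators K) {s : Finset ι} {i k : ι} (hi : i ∈ s)
    (hk : k ∈ s) : ∃ γ ∈ K ⊓ fixOutside s,
      γ.1 *ᵥ Pi.single (Sum.inl i) 1 = Pi.single (Sum.inl k) 1 := by
  by_cases hik : i = k
  · subst hik
    exact ⟨1, one_mem _, one_mulVec _⟩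
  have hI : ∀ j ∈ s, partialInversion {j} ∈ K ⊓ fixOutside s := fun j hj =>
    ⟨hK.inversion_mem j, partialInversion_mem_fixOutside (by simpa using hj)⟩
  have hT : translation (crossMatrix i (Pi.single k 1)) (crossMatrix_isSymm _ _) ∈
      K ⊓ fixOutside s :=
    ⟨hK.translation_mem i k, translation_crossMatrix_mem_fixOutside hi
      fun l hl => Pi.single_eq_of_ne (ne_of_mem_of_not_mem hk hl).symm 1⟩
  refine ⟨_, mul_mem (pow_mem (hI k hk) 3) (mul_mem hT (mul_mem (hI k hk)
    (mul_mem (hI i hi) (mul_mem hT (hI i hi))))), ?_⟩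
  simp only [pow_succ, pow_zero, one_mul, Submonoid.coe_mul, ← mulVec_mulVec]
  have hcross : ∀ c : ι → ℤ, crossMatrix i (Pi.single k 1) *ᵥ c =
      fun l => if l = i then c k else if l = k then c i else 0 := by
    intro c
    ext l
    by_cases hl : l = i
    · subst hl
      simp [crossMatrix_mulVec_self, Pi.single_apply]
    · simp [crossMatrix_mulVec_ne hl, Pi.single_apply, hl]
  ext (l | l) <;>
  · by_cases hl : l = i
    · subst hl
      simp [-mulVec_mulVec, -mulVec_single, translation_mulVec_inl, translation_mulVec_inr,
        partialInversion_mulVec_inl, partialInversion_mulVec_inr, hcross, hik, Ne.symm hik]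
    · by_cases hlk : l = k
      · subst hlk
        simp [-mulVec_mulVec, -mulVec_single, translation_mulVec_inl, translation_mulVec_inr,
          partialInversion_mulVec_inl, partialInversion_mulVec_inr, hcross, hl, Ne.symm hl]
      · simp [-mulVec_mulVec, -mulVec_single, translation_mulVec_inl, translation_mulVec_inr,
          partialInversion_mulVec_inl, partialInversion_mulVec_inr, hcross, hl, hlk]

theorem IsReduced.exists_mulVec_eq_single (hK : ContainsGenerators K) {s : Finset ι}
    {w u : ι ⊕ ι → ℤ} (hw : IsReduced K s w)
    (hs : ∀ j ∉ s, w (Sum.inl j) = 0 ∧ w (Sum.inr j) = 0) (hu : pairing w u = 1) :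
    ∃ i ∈ s, ∃ γ ∈ K ⊓ fixOutside s, γ.1 *ᵥ w = Pi.single (Sum.inl i) 1 := by
  obtain ⟨i, hi⟩ : ∃ i, ¬(w (Sum.inl i) = 0 ∧ w (Sum.inr i) = 0) := by
    by_contra! h
    rw [pairing_eq_sum, Finset.sum_eq_zero] at hu
    · exact zero_ne_one hu
    · intro j _
      rw [(h j).1, (h j).2]
      simp
  have his : i ∈ s := by
    by_contra h
    exact hi (hs i h)
  have hoff : ∀ j, j ≠ i → w (Sum.inl j) = 0 ∧ w (Sum.inr j) = 0 := by
    intro j hj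
    by_cases hjs : j ∈ s
    · exact (hw.pair_eq_zero_or hK hjs his hj).resolve_right hi
    · exact hs j hjs
  rw [pairing_eq_sum, Finset.sum_eq_single i (fun j _ hj => by
    rw [(hoff j hj).1, (hoff j hj).2]; simp) (by simp)] at hu
  have hpow : ∀ r : ℕ, partialInversion {i} ^ r ∈ K ⊓ fixOutside s := fun r =>
    pow_mem (show partialInversion {i} ∈ K ⊓ fixOutside s from
      ⟨hK.inversion_mem i, partialInversion_mem_fixOutside (by simpa using his)⟩) r
  have hone : ∀ z t : ℤ, z * t = 1 → z = 1 ∨ z = -1 := fun z t h =>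
    Int.isUnit_iff.1 (IsUnit.of_mul_eq_one _ h)
  have key : ∃ r : ℕ, ((partialInversion {i} ^ r).1 *ᵥ w) (Sum.inl i) = 1 ∧
      ((partialInversion {i} ^ r).1 *ᵥ w) (Sum.inr i) = 0 := by
    rcases hw.eq_zero_or hK his with h | h
    · rw [h] at hu
      rcases hone (w (Sum.inr i)) (u (Sum.inl i)) (by linarith) with h' | h'
      · refine ⟨3, ?_⟩
        simp only [pow_succ, pow_zero, one_mul, Submonoid.coe_mul, ← mulVec_mulVec]
        simp [-mulVec_mulVec, h, h', partialInversion_mulVec_inl, partialInversion_mulVec_inr]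
      · refine ⟨1, ?_⟩
        simp [h, h', partialInversion_mulVec_inl, partialInversion_mulVec_inr]
    · rw [h] at hu
      rcases hone (w (Sum.inl i)) (-u (Sum.inr i)) (by linarith) with h' | h'
      · refine ⟨0, ?_⟩
        simp [h, h']
      · refine ⟨2, ?_⟩
        simp only [pow_succ, pow_zero, one_mul, Submonoid.coe_mul, ← mulVec_mulVec]
        simp [-mulVec_mulVec, h, h', partialInversion_mulVec_inl, partialInversion_mulVec_inr]
  obtain ⟨r, hr1, hr2⟩ := key
  refine ⟨i, his, _, hpow r, ?_⟩
  have hfix : partialInversion {i} ^ r ∈ fixOutside {i} :=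
    pow_mem (partialInversion_mem_fixOutside le_rfl) r
  have hzero := mulVec_apply_eq_zero hfix (v := w) fun j hj => hoff j (by simpa using hj)
  ext (j | j) <;> by_cases hj : j = i
  · subst hj; simpa using hr1
  · simpa [hj] using (hzero j (by simpa using hj)).1
  · subst hj; simpa using hr2
  · simpa using (hzero j (by simpa using hj)).2

theorem exists_mulVec_eq_single (hK : ContainsGenerators K) {s : Finset ι} {k : ι} (hk : k ∈ s)
    {v u : ι ⊕ ι → ℤ} (hs : ∀ j ∉ s, v (Sum.inl j) = 0 ∧ v (Sum.inr j) = 0)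
    (hu : pairing v u = 1) :
    ∃ γ ∈ K ⊓ fixOutside s, γ.1 *ᵥ v = Pi.single (Sum.inl k) 1 := by
  obtain ⟨γ₁, h₁, hred⟩ := exists_isReduced K s v
  obtain ⟨i, hi, γ₂, h₂, e₂⟩ := hred.exists_mulVec_eq_single hK
    (mulVec_apply_eq_zero h₁.2 hs) ((pairing_mulVec γ₁ v u).trans hu)
  obtain ⟨γ₃, h₃, e₃⟩ := exists_mulVec_single_eq hK hi hk
  refine ⟨γ₃ * (γ₂ * γ₁), mul_mem h₃ (mul_mem h₂ h₁), ?_⟩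
  rw [Submonoid.coe_mul, Submonoid.coe_mul, ← mulVec_mulVec, ← mulVec_mulVec, e₂, e₃]

theorem partialInversion_mulVec_single_inl {t : Finset ι} {k : ι} (hk : k ∉ t) :
    (partialInversion t).1 *ᵥ Pi.single (Sum.inl k) 1 = Pi.single (Sum.inl k) 1 :=
  (partialInversion_mem_fixOutside le_rfl k hk).1

theorem translation_mulVec_single_inl (S : Matrix ι ι ℤ) (hS : S.IsSymm) (k : ι) :
    (translation S hS).1 *ᵥ Pi.single (Sum.inl k) 1 = Pi.single (Sum.inl k) 1 := by
  ext (i | i)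
  · rw [translation_mulVec_inl]
    simp [mulVec, dotProduct]
  · rw [translation_mulVec_inr]

/-- A translation in `K` clearing the first half of the coordinates of `v`. -/
theorem exists_translation_inl_eq_zero (hK : ContainsGenerators K) {s : Finset ι} {k : ι}
    (hk : k ∈ s) {v : ι ⊕ ι → ℤ} (hs : ∀ j ∉ s, v (Sum.inl j) = 0) (hvk : v (Sum.inr k) = 1) :
    ∃ γ ∈ K ⊓ fixOutside s, γ.1 *ᵥ Pi.single (Sum.inl k) 1 = Pi.single (Sum.inl k) 1 ∧
      ∀ j, (γ.1 *ᵥ v) (Sum.inl j) = 0 ∧ (γ.1 *ᵥ v) (Sum.inr j) = v (Sum.inr j) := by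
  let z : ℤ := -v (Sum.inl k) + ∑ j ∈ Finset.univ.erase k, v (Sum.inl j) * v (Sum.inr j)
  let x : ι → ℤ := fun j => if j = k then z else -v (Sum.inl j)
  have hx : ∀ j ∉ s, x j = 0 := by
    intro j hj
    have hjk : j ≠ k := (ne_of_mem_of_not_mem hk hj).symm
    simp [x, hjk, hs j hj]
  refine ⟨_, ⟨hK.crossMatrix_mem k x, translation_crossMatrix_mem_fixOutside hk hx⟩,
    translation_mulVec_single_inl _ _ k, fun j => ⟨?_, translation_mulVec_inr _ _ _ _⟩⟩
  rw [translation_mulVec_inl]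
  by_cases hj : j = k
  · subst hj
    rw [crossMatrix_mulVec_self, ← Finset.add_sum_erase _ _ (Finset.mem_univ j)]
    have : ∑ l ∈ Finset.univ.erase j, x l * v (Sum.inr l) =
        ∑ l ∈ Finset.univ.erase j, -(v (Sum.inl l) * v (Sum.inr l)) :=
      Finset.sum_congr rfl fun l hl => by simp [x, Finset.ne_of_mem_erase hl]
    rw [this, Finset.sum_neg_distrib]
    simp [x, z, hvk]
    ring
  · rw [crossMatrix_mulVec_ne hj]
    simp [x, hj, hvk]

theorem exists_mulVec_inr_eq_single (hK : ContainsGenerators K) {s : Finset ι} {k : ι}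
    (hk : k ∈ s) {v : ι ⊕ ι → ℤ} (hs : ∀ j ∉ s, v (Sum.inl j) = 0 ∧ v (Sum.inr j) = 0)
    (hvk : v (Sum.inr k) = 1) :
    ∃ γ ∈ K ⊓ fixOutside s, γ.1 *ᵥ Pi.single (Sum.inl k) 1 = Pi.single (Sum.inl k) 1 ∧
      γ.1 *ᵥ v = Pi.single (Sum.inr k) 1 := by
  obtain ⟨γ₁, h₁, f₁, e₁⟩ := exists_translation_inl_eq_zero hK hk (fun j hj => (hs j hj).1) hvk
  set w := γ₁.1 *ᵥ v with hw
  set w' := (partialInversion (s.erase k)).1 *ᵥ w with hw'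
  have hw's : ∀ j ∉ s, w' (Sum.inl j) = 0 := by
    intro j hj
    have hj' : j ∉ s.erase k := fun h => hj (Finset.mem_of_mem_erase h)
    rw [hw', partialInversion_mulVec_inl, if_neg hj', (e₁ j).1]
  have hw'k : w' (Sum.inr k) = 1 := by
    rw [hw', partialInversion_mulVec_inr, if_neg (by simp), (e₁ k).2, hvk]
  obtain ⟨γ₂, h₂, f₂, e₂⟩ := exists_translation_inl_eq_zero hK hk hw's hw'k
  refine ⟨γ₂ * (partialInversion (s.erase k) * γ₁), mul_mem h₂ (mul_mem
    ⟨hK.partialInversion_mem _, partialInversion_mem_fixOutside (Finset.erase_subset k s)⟩ h₁),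
    ?_, ?_⟩
  · rw [Submonoid.coe_mul, Submonoid.coe_mul, ← mulVec_mulVec, ← mulVec_mulVec, f₁,
      partialInversion_mulVec_single_inl (by simp), f₂]
  · rw [Submonoid.coe_mul, Submonoid.coe_mul, ← mulVec_mulVec, ← mulVec_mulVec, ← hw, ← hw']
    ext (j | j)
    · simp [(e₂ j).1]
    · rw [(e₂ j).2]
      by_cases hj : j = k
      · subst hj
        simp [hw'k]
      · rw [hw', partialInversion_mulVec_inr]
        by_cases hjs : j ∈ s
        · simp [hj, hjs, (e₁ j).1]
        · simp [hj, hjs, (e₁ j).2, (hs j hjs).2]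

theorem pairing_single_inr_single_inl (k : ι) :
    pairing (Pi.single (Sum.inr k) 1 : ι ⊕ ι → ℤ) (Pi.single (Sum.inl k) 1) = 1 := by
  simp [pairing_single_inl]

theorem fixOutside_le (hK : ContainsGenerators K) (s : Finset ι) : fixOutside s ≤ K := by
  induction s using Finset.induction_on with
  | empty =>
    intro γ hγ
    have : γ = 1 := by
      apply Subtype.ext
      apply Matrix.ext_of_mulVec_single
      rintro (j | j)
      · exact (hγ j (by simp)).1.trans (one_mulVec _).symm
      · exact (hγ j (by simp)).2.trans (one_mulVec _).symm
    rw [this]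
    exact K.one_mem
  | insert k s hks ih =>
    intro γ hγ
    have hk : k ∈ insert k s := Finset.mem_insert_self k s
    have hsupp : ∀ p : ι ⊕ ι, (p = Sum.inl k ∨ p = Sum.inr k) → ∀ j ∉ insert k s,
        (Pi.single p 1 : ι ⊕ ι → ℤ) (Sum.inl j) = 0 ∧
        (Pi.single p 1 : ι ⊕ ι → ℤ) (Sum.inr j) = 0 := by
      rintro p hp j hj
      have hjk : j ≠ k := (ne_of_mem_of_not_mem hk hj).symm
      rcases hp with rfl | rfl <;> simp [hjk]
    obtain ⟨γ₁, h₁, e₁⟩ := exists_mulVec_eq_single hK hk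
      (v := γ.1 *ᵥ Pi.single (Sum.inl k) 1) (u := γ.1 *ᵥ -Pi.single (Sum.inr k) 1)
      (mulVec_apply_eq_zero hγ (hsupp _ (Or.inl rfl)))
      (by
        rw [pairing_mulVec]
        simp only [pairing, mulVec_neg, dotProduct_neg]
        change -pairing _ _ = 1
        simp [pairing_single_inr])
    rw [mulVec_mulVec, ← Submonoid.coe_mul] at e₁
    have hγ₁ : γ₁ * γ ∈ fixOutside (insert k s) := mul_mem h₁.2 hγ
    have hpair : ((γ₁ * γ).1 *ᵥ Pi.single (Sum.inr k) 1) (Sum.inr k) = 1 := by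
      have h := pairing_mulVec (γ₁ * γ) (Pi.single (Sum.inr k) 1) (Pi.single (Sum.inl k) 1)
      rwa [e₁, pairing_single_inl, pairing_single_inr_single_inl] at h
    obtain ⟨γ₂, h₂, f₂, e₂⟩ := exists_mulVec_inr_eq_single hK hk
      (mulVec_apply_eq_zero hγ₁ (hsupp _ (Or.inr rfl))) hpair
    rw [mulVec_mulVec, ← Submonoid.coe_mul] at e₂
    have hfix : γ₂ * (γ₁ * γ) ∈ fixOutside s := by
      intro j hj
      by_cases hjk : j = k
      · subst hjk
        refine ⟨?_, e₂⟩
        rw [Submonoid.coe_mul, ← mulVec_mulVec, e₁, f₂]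
      · exact mul_mem h₂.2 hγ₁ j (by simp [hj, hjk])
    have := ih hfix
    rwa [K.mul_mem_cancel_left h₂.1, K.mul_mem_cancel_left h₁.1] at this

/-- The integral symplectic group is generated by the elementary translations and the inversions
in one coordinate plane. -/
theorem mem_of_containsGenerators (hK : ContainsGenerators K) (γ : symplecticGroup ι ℤ) :
    γ ∈ K :=
  fixOutside_le hK Finset.univ fun j hj => absurd (Finset.mem_univ j) hj

end SymplecticGenerators

namespace ThetaTransformation

/-- Maps between `𝔽₂`-vector spaces that are affine: they preserve sums of three terms. -/
def IsAffineMap {V W : Type} [Add V] [Add W] (f : V → W) : Prop :=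
  ∀ x y z, f (x + y + z) = f x + f y + f z

theorem IsAffineMap.comp {U V W : Type} [Add U] [Add V] [Add W] {g : V → W} {f : U → V}
    (hg : IsAffineMap g) (hf : IsAffineMap f) : IsAffineMap fun x => g (f x) := by
  intro x y z
  simp only [hf x y z, hg (f x) (f y) (f z)]

/-- The sign character of `𝔽₂`. -/
def signChar (b : ZMod 2) : ℤ := 1 - 2 * b.val

theorem signChar_add (a b : ZMod 2) : signChar (a + b) = signChar a * signChar b := by
  revert a b; decide

theorem sixteen_dvd_sum_signChar {l : (Fin 4 → ZMod 2) → ZMod 2} (hl : IsAffineMap l) :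
    (16 : ℤ) ∣ ∑ x, signChar (l x) := by
  by_cases h : ∀ x, l x = l 0
  · simp [h]
  · push Not at h
    obtain ⟨y, hy⟩ := h
    have hshift : ∀ x, signChar (l (x + y)) = -signChar (l x) := by
      intro x
      have := hl x y 0
      rw [add_zero] at this
      rw [this, add_assoc, signChar_add]
      have : ∀ a b : ZMod 2, a ≠ b → signChar (a + b) = -1 := by decide
      rw [this _ _ hy]
      ring
    have hsum : ∑ x, signChar (l x) = -∑ x, signChar (l x) := by
      conv_lhs => rw [← Equiv.sum_comp (Equiv.addRight y)]
      simp only [Equiv.coe_addRight, hshift, Finset.sum_neg_distrib]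
    have : ∑ x, signChar (l x) = 0 := by omega
    simp [this]

theorem IsAffineMap.add {V : Type} [Add V] {f g : V → ZMod 2} (hf : IsAffineMap f)
    (hg : IsAffineMap g) : IsAffineMap fun x => f x + g x := by
  intro x y z
  simp only [hf x y z, hg x y z]
  ring

theorem eight_dvd_sum_val {l : (Fin 4 → ZMod 2) → ZMod 2} (hl : IsAffineMap l) :
    8 ∣ ∑ x, (l x).val := by
  have h := sixteen_dvd_sum_signChar hl
  have e : ∑ x, signChar (l x) = 16 - 2 * ∑ x, ((l x).val : ℤ) := by
    simp [signChar, Finset.sum_sub_distrib, Finset.mul_sum]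
  have : ((∑ x, (l x).val : ℕ) : ℤ) = ∑ x, ((l x).val : ℤ) := by push_cast; rfl
  omega

theorem four_dvd_sum_val_mul_val {l m : (Fin 4 → ZMod 2) → ZMod 2} (hl : IsAffineMap l)
    (hm : IsAffineMap m) : 4 ∣ ∑ x, (l x).val * (m x).val := by
  have h1 := sixteen_dvd_sum_signChar hl
  have h2 := sixteen_dvd_sum_signChar hm
  have h12 := sixteen_dvd_sum_signChar (hl.add hm)
  have e : ∑ x, 4 * (((l x).val : ℤ) * (m x).val) =
      ∑ x, (1 - signChar (l x) - signChar (m x) + signChar (l x + m x)) := by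
    refine Finset.sum_congr rfl fun x _ => ?_
    simp only [signChar_add]
    simp only [signChar]
    ring
  rw [← Finset.mul_sum] at e
  simp only [Finset.sum_add_distrib, Finset.sum_sub_distrib] at e
  have e1 : ∑ _x : Fin 4 → ZMod 2, (1 : ℤ) = 16 := by simp
  have : ((∑ x, (l x).val * (m x).val : ℕ) : ℤ) = ∑ x, ((l x).val : ℤ) * (m x).val := by
    push_cast; rfl
  omega

theorem two_dvd_sum_val_mul_val_mul_val {k l m : (Fin 4 → ZMod 2) → ZMod 2} (hk : IsAffineMap k)
    (hl : IsAffineMap l) (hm : IsAffineMap m) :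
    2 ∣ ∑ x, (k x).val * (l x).val * (m x).val := by
  have h1 := sixteen_dvd_sum_signChar hk
  have h2 := sixteen_dvd_sum_signChar hl
  have h3 := sixteen_dvd_sum_signChar hm
  have h12 := sixteen_dvd_sum_signChar (hk.add hl)
  have h13 := sixteen_dvd_sum_signChar (hk.add hm)
  have h23 := sixteen_dvd_sum_signChar (hl.add hm)
  have h123 := sixteen_dvd_sum_signChar ((hk.add hl).add hm)
  have e : ∑ x, 8 * (((k x).val : ℤ) * (l x).val * (m x).val) =
      ∑ x, (1 - signChar (k x) - signChar (l x) - signChar (m x) + signChar (k x + l x) +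
        signChar (k x + m x) + signChar (l x + m x) - signChar (k x + l x + m x)) := by
    refine Finset.sum_congr rfl fun x _ => ?_
    simp only [signChar_add]
    simp only [signChar]
    ring
  rw [← Finset.mul_sum] at e
  simp only [Finset.sum_add_distrib, Finset.sum_sub_distrib] at e
  have e1 : ∑ _x : Fin 4 → ZMod 2, (1 : ℤ) = 16 := by simp
  have : ((∑ x, (k x).val * (l x).val * (m x).val : ℕ) : ℤ) =
      ∑ x, ((k x).val : ℤ) * (l x).val * (m x).val := by
    push_cast; rfl
  omega

theorem prod_pow_eq_one {α : Type} [Fintype α] {u : ℂ} {N : ℕ} (hu : u ^ N = 1) {f : α → ℕ}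
    (hf : N ∣ ∑ x, f x) : ∏ x, u ^ f x = 1 := by
  rw [Finset.prod_pow_eq_pow_sum]
  obtain ⟨c, hc⟩ := hf
  rw [hc, pow_mul, hu, one_pow]

section Translation

variable {ι : Type} [Fintype ι]

theorem thetaConst_add_of_forall (S : Matrix ι ι ℂ) (ε δ δ' : ι → ZMod 2) (c : ℂ)
    (h : ∀ n : ι → ℤ, Complex.exp ((Real.pi : ℂ) * Complex.I *
      ((∑ i, ∑ j, ((n i : ℂ) + ((ε i).val : ℂ) / 2) * S i j * ((n j : ℂ) + ((ε j).val : ℂ) / 2)) +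
        ∑ i, ((n i : ℂ) + ((ε i).val : ℂ) / 2) * (((δ' i).val : ℂ) - ((δ i).val : ℂ)))) = c)
    (τ : Matrix ι ι ℂ) :
    thetaConst (ε, δ') (τ + S) = c * thetaConst (ε, δ) τ := by
  simp only [thetaConst, thetaChar, theta]
  rw [← tsum_mul_left]
  refine tsum_congr fun n => ?_
  rw [← h n, ← Complex.exp_add]
  congr 1
  rw [← mul_add]
  congr 1
  simp only [Matrix.add_apply, Pi.zero_apply, zero_add, mul_add, add_mul, mul_sub,
    Finset.sum_add_distrib, Finset.sum_sub_distrib, Finset.mul_sum]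
  have : ∀ d : ι → ZMod 2, ∀ i, 2 * ((n i : ℂ) * (((d i).val : ℂ) / 2)) = n i * ((d i).val : ℂ) :=
    fun d i => by ring
  have h2 : ∀ d : ι → ZMod 2, ∀ i, 2 * (((ε i).val : ℂ) / 2 * (((d i).val : ℂ) / 2)) =
      ((ε i).val : ℂ) / 2 * ((d i).val : ℂ) := fun d i => by ring
  simp only [this, h2]
  ring

open SymplecticGenerators

variable [DecidableEq ι]

/-- The action of the translation by `crossMatrix k (Pi.single j 1)` on characteristics. -/
def translateChar (k j : ι) (m : Char2 ι) : Char2 ι :=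
  if k = j then (m.1, m.2 + Pi.single k (m.1 k + 1))
  else (m.1, m.2 + Pi.single k (m.1 j) + Pi.single j (m.1 k))

theorem translateChar_isAffineMap (k j : ι) : IsAffineMap (translateChar (ι := ι) k j) := by
  intro x y z
  unfold translateChar
  have h2 : (1 : ZMod 2) = 1 + 1 + 1 := by decide
  split_ifs with h
  · refine Prod.ext rfl ?_
    simp only [Prod.fst_add, Prod.snd_add, Pi.add_apply]
    conv_lhs => rw [h2]
    rw [show x.1 k + y.1 k + z.1 k + (1 + 1 + 1) = (x.1 k + 1) + (y.1 k + 1) + (z.1 k + 1) by ring,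
      Pi.single_add, Pi.single_add]
    abel
  · refine Prod.ext rfl ?_
    simp only [Prod.fst_add, Prod.snd_add, Pi.add_apply, Pi.single_add]
    abel

theorem translateChar_involutive (k j : ι) (m : Char2 ι) :
    translateChar k j (translateChar k j m) = m := by
  have h2 : ∀ a : ι → ZMod 2, a + a = 0 := fun a => by
    ext i; exact CharTwo.add_self_eq_zero (a i)
  unfold translateChar
  split_ifs with h
  · refine Prod.ext rfl ?_
    simp only [add_assoc, h2, add_zero]
  · refine Prod.ext rfl ?_
    simp only
    rw [show m.2 + Pi.single k (m.1 j) + Pi.single j (m.1 k) + Pi.single k (m.1 j) +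
      Pi.single j (m.1 k) = m.2 + (Pi.single k (m.1 j) + Pi.single k (m.1 j)) +
        (Pi.single j (m.1 k) + Pi.single j (m.1 k)) by abel, h2, h2, add_zero, add_zero]

theorem exp_pi_mul_I_mul_eq (x y : ℂ) (m : ℤ) (h : x = y + 2 * m) :
    Complex.exp ((Real.pi : ℂ) * Complex.I * x) = Complex.exp ((Real.pi : ℂ) * Complex.I * y) := by
  rw [Complex.exp_eq_exp_iff_exists_int]
  exact ⟨m, by rw [h]; ring⟩

theorem thetaConst_translateChar_self (k : ι) (m : Char2 ι) (τ : Matrix ι ι ℂ) :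
    thetaConst (translateChar k k m) (τ + (crossMatrix k (Pi.single k 1)).map Int.cast) =
      Complex.exp ((Real.pi : ℂ) * Complex.I * (1 / 4)) ^ (m.1 k).val * thetaConst m τ := by
  obtain ⟨ε, δ⟩ := m
  simp only [translateChar, if_true]
  apply thetaConst_add_of_forall
  intro n
  have hS : ∀ i j, ((crossMatrix k (Pi.single k 1)).map Int.cast : Matrix ι ι ℂ) i j =
      if i = k then (if j = k then 1 else 0) else 0 := by
    intro i j
    by_cases hi : i = k <;> by_cases hj : j = k <;> simp [crossMatrix, hi, hj]
  have h1 : ∑ i, ∑ j, ((n i : ℂ) + ((ε i).val : ℂ) / 2) *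
      ((crossMatrix k (Pi.single k 1)).map Int.cast : Matrix ι ι ℂ) i j *
        ((n j : ℂ) + ((ε j).val : ℂ) / 2) = ((n k : ℂ) + ((ε k).val : ℂ) / 2) ^ 2 := by
    simp only [hS]
    rw [Finset.sum_eq_single k (by intro i _ hi; simp [hi]) (by simp),
      Finset.sum_eq_single k (by intro i _ hi; simp [hi]) (by simp)]
    simp
    ring
  have h2 : ∑ i, ((n i : ℂ) + ((ε i).val : ℂ) / 2) *
      ((((δ + Pi.single k (ε k + 1) : ι → ZMod 2) i).val : ℂ) - ((δ i).val : ℂ)) =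
      ((n k : ℂ) + ((ε k).val : ℂ) / 2) * (((δ k + (ε k + 1)).val : ℂ) - ((δ k).val : ℂ)) := by
    rw [Finset.sum_eq_single k (by intro i _ hi; simp [hi]) (by simp)]
    simp
  rw [h1, h2, ← Complex.exp_nat_mul]
  generalize ε k = e
  generalize δ k = d
  generalize n k = N
  obtain ⟨r, hr⟩ := Int.even_mul_succ_self N
  have hr' : (N : ℂ) * (N + 1) = r + r := by exact_mod_cast hr
  rw [show (e.val : ℂ) * ((Real.pi : ℂ) * Complex.I * (1 / 4)) =
    (Real.pi : ℂ) * Complex.I * ((e.val : ℂ) / 4) by ring]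
  have v0 : ((0 : ZMod 2).val : ℂ) = 0 := by simp
  have v1 : ((1 : ZMod 2).val : ℂ) = 1 := by simp [ZMod.val_one]
  have e11 : (1 + 1 : ZMod 2) = 0 := by decide
  have hz : ∀ a : ZMod 2, a = 0 ∨ a = 1 := by decide
  rcases hz e with rfl | rfl <;> rcases hz d with rfl | rfl <;>
    simp only [zero_add, add_zero, e11, v0, v1]
  · apply exp_pi_mul_I_mul_eq _ _ r
    linear_combination hr'
  · apply exp_pi_mul_I_mul_eq _ _ (r - N)
    push_cast
    linear_combination hr'
  · apply exp_pi_mul_I_mul_eq _ _ r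
    linear_combination hr'
  · apply exp_pi_mul_I_mul_eq _ _ r
    linear_combination hr'

theorem val_add_eq (a b : ZMod 2) : ((a + b).val : ℂ) = a.val + b.val - 2 * a.val * b.val := by
  have h : ∀ a b : ZMod 2, ((a + b).val : ℤ) = a.val + b.val - 2 * a.val * b.val := by decide
  exact_mod_cast h a b

theorem thetaConst_translateChar_of_ne {k j : ι} (hkj : k ≠ j) (m : Char2 ι) (τ : Matrix ι ι ℂ) :
    thetaConst (translateChar k j m) (τ + (crossMatrix k (Pi.single j 1)).map Int.cast) =
      Complex.exp ((Real.pi : ℂ) * Complex.I * (3 / 2)) ^ ((m.1 k).val * (m.1 j).val) *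
      Complex.exp ((Real.pi : ℂ) * Complex.I) ^ ((m.1 k).val * (m.1 j).val * (m.2 k).val) *
      Complex.exp ((Real.pi : ℂ) * Complex.I) ^ ((m.1 k).val * (m.1 j).val * (m.2 j).val) *
        thetaConst m τ := by
  obtain ⟨ε, δ⟩ := m
  simp only [translateChar, if_neg hkj]
  apply thetaConst_add_of_forall
  intro n
  have hS : ∀ a b, ((crossMatrix k (Pi.single j 1)).map Int.cast : Matrix ι ι ℂ) a b =
      (if a = k then (if b = j then 1 else 0) else 0) +
        if a = j then (if b = k then 1 else 0) else 0 := by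
    intro a b
    by_cases ha : a = k
    · subst ha
      by_cases hb : b = j <;> simp [crossMatrix, hb, hkj, Pi.single_apply]
    · by_cases hb : b = k <;> by_cases hc : a = j <;> simp [crossMatrix, ha, hb, hc, hkj.symm]
  have h1 : ∑ a, ∑ b, ((n a : ℂ) + ((ε a).val : ℂ) / 2) *
      ((crossMatrix k (Pi.single j 1)).map Int.cast : Matrix ι ι ℂ) a b *
        ((n b : ℂ) + ((ε b).val : ℂ) / 2) =
      2 * ((n k : ℂ) + ((ε k).val : ℂ) / 2) * ((n j : ℂ) + ((ε j).val : ℂ) / 2) := by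
    simp only [hS, mul_add, add_mul, mul_ite, ite_mul, mul_zero, zero_mul, mul_one,
      Finset.sum_add_distrib, Finset.sum_ite_eq', Finset.mem_univ, if_true,
      Finset.sum_ite_irrel, Finset.sum_const_zero]
    ring
  have h2 : ∑ a, ((n a : ℂ) + ((ε a).val : ℂ) / 2) *
      ((((δ + Pi.single k (ε j) + Pi.single j (ε k) : ι → ZMod 2) a).val : ℂ) - ((δ a).val : ℂ)) =
      ((n k : ℂ) + ((ε k).val : ℂ) / 2) * (((δ k + ε j).val : ℂ) - ((δ k).val : ℂ)) +
      ((n j : ℂ) + ((ε j).val : ℂ) / 2) * (((δ j + ε k).val : ℂ) - ((δ j).val : ℂ)) := by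
    rw [← Finset.sum_subset (Finset.subset_univ {k, j}), Finset.sum_pair hkj]
    · simp [hkj, hkj.symm]
    · intro a _ ha
      simp only [Finset.mem_insert, Finset.mem_singleton, not_or] at ha
      simp [ha.1, ha.2]
  rw [h1, h2, ← Complex.exp_nat_mul, ← Complex.exp_nat_mul, ← Complex.exp_nat_mul,
    ← Complex.exp_add, ← Complex.exp_add, val_add_eq, val_add_eq]
  rw [exp_pi_mul_I_mul_eq _ (3 / 2 * ((ε k).val * (ε j).val) + (ε k).val * (ε j).val * (δ k).val +
    (ε k).val * (ε j).val * (δ j).val) (n k * n j + n k * (ε j).val + n j * (ε k).val -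
    n k * (δ k).val * (ε j).val - n j * (δ j).val * (ε k).val -
    (ε k).val * (ε j).val * (δ k).val - (ε k).val * (ε j).val * (δ j).val)]
  · congr 1
    push_cast
    ring
  · push_cast
    ring

theorem exp_pi_mul_I_mul_pow_eq_one {x : ℂ} {N : ℕ} (m : ℤ) (h : N * x = 2 * m) :
    Complex.exp ((Real.pi : ℂ) * Complex.I * x) ^ N = 1 := by
  rw [← Complex.exp_nat_mul, Complex.exp_eq_one_iff]
  exact ⟨m, by linear_combination (Real.pi : ℂ) * Complex.I * h⟩

/-- Products of theta constants over affine families of characteristics are invariant under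
elementary translations. -/
theorem prod_thetaConst_translateChar (k j : ι) (τ : Matrix ι ι ℂ)
    {a : (Fin 4 → ZMod 2) → Char2 ι} (ha : IsAffineMap a) :
    ∏ x, thetaConst (translateChar k j (a x))
      (τ + (crossMatrix k (Pi.single j 1)).map Int.cast) = ∏ x, thetaConst (a x) τ := by
  have h1 : ∀ i, IsAffineMap fun x => (a x).1 i := fun i x y z => by simp [ha x y z]
  have h2 : ∀ i, IsAffineMap fun x => (a x).2 i := fun i x y z => by simp [ha x y z]
  by_cases hkj : k = j
  · subst hkj
    simp only [thetaConst_translateChar_self, Finset.prod_mul_distrib]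
    rw [prod_pow_eq_one (exp_pi_mul_I_mul_pow_eq_one 1 (by push_cast; norm_num))
      (eight_dvd_sum_val (h1 k)), one_mul]
  · simp only [thetaConst_translateChar_of_ne hkj, Finset.prod_mul_distrib]
    have hpi : Complex.exp ((Real.pi : ℂ) * Complex.I) ^ 2 = 1 := by simp
    rw [prod_pow_eq_one (exp_pi_mul_I_mul_pow_eq_one 3 (by push_cast; norm_num))
      (four_dvd_sum_val_mul_val (h1 k) (h1 j)),
      prod_pow_eq_one hpi (two_dvd_sum_val_mul_val_mul_val (h1 k) (h1 j) (h2 k)),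
      prod_pow_eq_one hpi (two_dvd_sum_val_mul_val_mul_val (h1 k) (h1 j) (h2 j)),
      one_mul, one_mul, one_mul]

end Translation

section Summability

variable {ι : Type} [Fintype ι]

/-- The quadratic form attached to a square matrix. -/
def quad {R : Type} [CommRing R] (τ : Matrix ι ι R) (v : ι → R) : R :=
  ∑ i, ∑ j, v i * τ i j * v j

theorem summable_prod_of_nonneg {f : ι → ℤ → ℝ} (h0 : ∀ i n, 0 ≤ f i n)
    (hf : ∀ i, Summable (f i)) : Summable fun n : ι → ℤ => ∏ i, f i (n i) := by
  classical
  refine summable_of_sum_le (c := ∏ i, ∑' n, f i n)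
    (fun n => Finset.prod_nonneg fun i _ => h0 i _) fun s => ?_
  calc ∑ n ∈ s, ∏ i, f i (n i)
      ≤ ∑ n ∈ Fintype.piFinset fun i => s.image fun n => n i, ∏ i, f i (n i) := by
        refine Finset.sum_le_sum_of_subset_of_nonneg ?_
          fun n _ _ => Finset.prod_nonneg fun i _ => h0 i _
        intro n hn
        rw [Fintype.mem_piFinset]
        exact fun i => Finset.mem_image_of_mem _ hn
    _ = ∏ i, ∑ n ∈ s.image fun n => n i, f i n := (Finset.prod_univ_sum _ _).symm
    _ ≤ ∏ i, ∑' n, f i n :=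
        Finset.prod_le_prod (fun i _ => Finset.sum_nonneg fun n _ => h0 i n)
          fun i _ => (hf i).sum_le_tsum _ fun n _ => h0 i n

theorem summable_exp_neg_sq {c : ℝ} (hc : 0 < c) (e : ℝ) :
    Summable fun n : ℤ => Real.exp (-(Real.pi * c * (n + e) ^ 2)) := by
  have h := ((summable_jacobiTheta₂_term_iff (Complex.I * (c * e : ℝ)) (Complex.I * (c : ℝ))).2
    (by simpa using hc)).norm.mul_left (Real.exp (-(Real.pi * c * e ^ 2)))
  refine h.congr fun n => ?_
  rw [norm_jacobiTheta₂_term, ← Real.exp_add]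
  congr 1
  simp
  ring

theorem exists_pos_mul_sum_sq_le {τ : Matrix ι ι ℂ} (hτ : τ ∈ Siegel ι) :
    ∃ c : ℝ, 0 < c ∧ ∀ v : ι → ℝ, c * ∑ i, v i ^ 2 ≤ ∑ i, ∑ j, v i * (τ i j).im * v j := by
  classical
  let K : Set (ι → ℝ) := {v | ∑ i, v i ^ 2 = 1}
  have hK : IsCompact K := by
    refine Metric.isCompact_of_isClosed_isBounded
      (isClosed_eq (by fun_prop) continuous_const) ?_
    refine (Metric.isBounded_closedBall (x := (0 : ι → ℝ)) (r := 1)).subset fun v hv => ?_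
    rw [mem_closedBall_zero_iff, pi_norm_le_iff_of_nonneg zero_le_one]
    intro i
    rw [Real.norm_eq_abs, ← sq_le_one_iff_abs_le_one]
    have hv' : ∑ i, v i ^ 2 = 1 := hv
    rw [← hv']
    exact Finset.single_le_sum (f := fun i => v i ^ 2) (fun i _ => sq_nonneg _)
      (Finset.mem_univ i)
  have hcont : Continuous fun v : ι → ℝ => ∑ i, ∑ j, v i * (τ i j).im * v j := by fun_prop
  obtain ⟨c, hc, hcK⟩ : ∃ c : ℝ, 0 < c ∧
      ∀ v ∈ K, c ≤ ∑ i, ∑ j, v i * (τ i j).im * v j := by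
    rcases K.eq_empty_or_nonempty with h | h
    · exact ⟨1, one_pos, by simp [h]⟩
    · obtain ⟨v, hv, hmin⟩ := hK.exists_isMinOn h hcont.continuousOn
      refine ⟨_, hτ.2 v ?_, fun u hu => hmin hu⟩
      rintro rfl
      have : ∑ i : ι, (0 : ι → ℝ) i ^ 2 = 1 := hv
      simp at this
  refine ⟨c, hc, fun v => ?_⟩
  by_cases hv : v = 0
  · simp [hv]
  have hpos : 0 < ∑ i, v i ^ 2 := by
    obtain ⟨i, hi⟩ := Function.ne_iff.1 hv
    exact Finset.sum_pos' (fun i _ => sq_nonneg _) ⟨i, Finset.mem_univ i, by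
      have : v i ≠ 0 := hi
      positivity⟩
  set s := ∑ i, v i ^ 2 with hs
  have hsq : Real.sqrt s ^ 2 = s := Real.sq_sqrt hpos.le
  have hsne : Real.sqrt s ≠ 0 := (Real.sqrt_pos.2 hpos).ne'
  have h := hcK (fun i => v i / Real.sqrt s) (by
    change ∑ i, (v i / Real.sqrt s) ^ 2 = 1
    simp only [div_pow, hsq, ← Finset.sum_div, ← hs]
    exact div_self hpos.ne')
  have e : ∑ i, ∑ j, v i / Real.sqrt s * (τ i j).im * (v j / Real.sqrt s) =
      (∑ i, ∑ j, v i * (τ i j).im * v j) / s := by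
    simp only [Finset.sum_div]
    refine Finset.sum_congr rfl fun i _ => Finset.sum_congr rfl fun j _ => ?_
    conv_rhs => rw [← hsq]
    field_simp
  rw [e, le_div_iff₀ hpos] at h
  exact h

/-- The summands of a theta constant. -/
def thetaSummand (ε δ : ι → ZMod 2) (τ : Matrix ι ι ℂ) (n : ι → ℤ) : ℂ :=
  Complex.exp ((Real.pi : ℂ) * Complex.I *
    (quad τ (fun i => (n i : ℂ) + ((ε i).val : ℂ) / 2) +
      ∑ i, ((n i : ℂ) + ((ε i).val : ℂ) / 2) * ((δ i).val : ℂ)))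

theorem thetaConst_eq_tsum (ε δ : ι → ZMod 2) (τ : Matrix ι ι ℂ) :
    thetaConst (ε, δ) τ = ∑' n, thetaSummand ε δ τ n := by
  simp only [thetaConst, thetaChar, theta, thetaSummand, quad]
  refine tsum_congr fun n => ?_
  congr 3
  rw [Finset.mul_sum]
  refine Finset.sum_congr rfl fun i _ => ?_
  simp only [Pi.zero_apply]
  ring

theorem quad_ofReal_im (τ : Matrix ι ι ℂ) (v : ι → ℝ) :
    (quad τ fun i => (v i : ℂ)).im = ∑ i, ∑ j, v i * (τ i j).im * v j := by
  simp [quad, Complex.im_sum]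

theorem summable_thetaSummand {τ : Matrix ι ι ℂ} (hτ : τ ∈ Siegel ι) (ε δ : ι → ZMod 2) :
    Summable (thetaSummand ε δ τ) := by
  obtain ⟨c, hc, h⟩ := exists_pos_mul_sum_sq_le hτ
  refine Summable.of_norm_bounded (summable_prod_of_nonneg
    (f := fun i n => Real.exp (-(Real.pi * c * (n + ((ε i).val : ℝ) / 2) ^ 2)))
    (fun i n => (Real.exp_pos _).le) fun i => summable_exp_neg_sq hc _) fun n => ?_
  have hv : (fun i => (n i : ℂ) + ((ε i).val : ℂ) / 2) =
      fun i => (((n i : ℝ) + ((ε i).val : ℝ) / 2 : ℝ) : ℂ) := by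
    funext i; push_cast; rfl
  have him : (∑ i, ((n i : ℂ) + ((ε i).val : ℂ) / 2) * ((δ i).val : ℂ)).im = 0 := by
    rw [Complex.im_sum]
    refine Finset.sum_eq_zero fun i _ => ?_
    rw [congrFun hv i, ← Complex.ofReal_natCast, ← Complex.ofReal_mul, Complex.ofReal_im]
  rw [thetaSummand, Complex.norm_exp, ← Real.exp_sum, Real.exp_le_exp, mul_assoc,
    Complex.re_ofReal_mul, Complex.I_mul_re, Complex.add_im, him, hv, quad_ofReal_im,
    Finset.sum_neg_distrib, ← Finset.mul_sum, mul_assoc, add_zero, mul_neg, neg_le_neg_iff]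
  exact mul_le_mul_of_nonneg_left (h _) Real.pi_pos.le

end Summability

section OneVariable

/-- The theta series in one variable with half-integral characteristics. -/
def thetaOne (e d : ZMod 2) (w T : ℂ) : ℂ :=
  ∑' t : ℤ, Complex.exp ((Real.pi : ℂ) * Complex.I *
    (((t : ℂ) + (e.val : ℂ) / 2) ^ 2 * T + 2 * ((t : ℂ) + (e.val : ℂ) / 2) * (w + (d.val : ℂ) / 2)))

theorem thetaOne_eq_jacobiTheta₂ (e d : ZMod 2) (w T : ℂ) :
    thetaOne e d w T = Complex.exp ((Real.pi : ℂ) * Complex.I *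
      ((e.val : ℂ) ^ 2 * T / 4 + e.val * (w + (d.val : ℂ) / 2))) *
        jacobiTheta₂ (w + (d.val : ℂ) / 2 + (e.val : ℂ) * T / 2) T := by
  rw [thetaOne, jacobiTheta₂, ← tsum_mul_left]
  refine tsum_congr fun t => ?_
  rw [jacobiTheta₂_term, ← Complex.exp_add]
  congr 1
  ring

theorem thetaOne_inversion (e d : ZMod 2) (w : ℂ) {T : ℂ} (hT : T ≠ 0) :
    thetaOne e d w T = 1 / (-Complex.I * T) ^ (1 / 2 : ℂ) *
      Complex.exp (-((Real.pi : ℂ) * Complex.I * (w ^ 2 / T))) *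
      Complex.exp ((Real.pi : ℂ) * Complex.I * (1 / 2)) ^ (e.val * d.val) *
        thetaOne d e (w / T) (-1 / T) := by
  rw [thetaOne_eq_jacobiTheta₂, thetaOne_eq_jacobiTheta₂, jacobiTheta₂_functional_equation,
    ← Complex.exp_nat_mul]
  have v0 : ((0 : ZMod 2).val : ℂ) = 0 := by simp
  have v1 : ((1 : ZMod 2).val : ℂ) = 1 := by simp [ZMod.val_one]
  have hz : ∀ a : ZMod 2, a = 0 ∨ a = 1 := by decide
  have hj : jacobiTheta₂ (w / T + (e.val : ℂ) / 2 + (d.val : ℂ) * (-1 / T) / 2) (-1 / T) =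
      Complex.exp ((Real.pi : ℂ) * Complex.I *
        (d.val * (1 / T - 2 * ((w + (d.val : ℂ) / 2 + (e.val : ℂ) * T / 2) / T)))) *
        jacobiTheta₂ ((w + (d.val : ℂ) / 2 + (e.val : ℂ) * T / 2) / T) (-1 / T) := by
    rcases hz d with rfl | rfl
    · rw [v0]
      simp only [zero_mul, mul_zero, zero_div, add_zero, Complex.exp_zero, one_mul]
      congr 1
      field_simp
    · rw [v1, show w / T + (e.val : ℂ) / 2 + 1 * (-1 / T) / 2 =
        (w + 1 / 2 + (e.val : ℂ) * T / 2) / T + -1 / T by field_simp; ring, jacobiTheta₂_add_left']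
      congr 2
      field_simp
      ring
  rw [hj]
  have key : Complex.exp ((Real.pi : ℂ) * Complex.I *
      ((e.val : ℂ) ^ 2 * T / 4 + e.val * (w + (d.val : ℂ) / 2))) *
      Complex.exp (-Real.pi * Complex.I * (w + (d.val : ℂ) / 2 + (e.val : ℂ) * T / 2) ^ 2 / T) =
      Complex.exp (-((Real.pi : ℂ) * Complex.I * (w ^ 2 / T))) *
      Complex.exp (((e.val * d.val : ℕ) : ℂ) * ((Real.pi : ℂ) * Complex.I * (1 / 2))) *
      (Complex.exp ((Real.pi : ℂ) * Complex.I *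
        ((d.val : ℂ) ^ 2 * (-1 / T) / 4 + d.val * (w / T + (e.val : ℂ) / 2))) *
      Complex.exp ((Real.pi : ℂ) * Complex.I *
        (d.val * (1 / T - 2 * ((w + (d.val : ℂ) / 2 + (e.val : ℂ) * T / 2) / T))))) := by
    simp only [← Complex.exp_add]
    congr 1
    push_cast
    rcases hz d with rfl | rfl <;> simp only [v0, v1] <;> field_simp <;> ring
  linear_combination (1 / (-Complex.I * T) ^ (1 / 2 : ℂ) *
    jacobiTheta₂ ((w + (d.val : ℂ) / 2 + (e.val : ℂ) * T / 2) / T) (-1 / T)) * key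

end OneVariable

section Inversion

variable {ι : Type} [Fintype ι] [DecidableEq ι]

theorem quad_add_single {R : Type} [CommRing R] {τ : Matrix ι ι R} (hτ : τ.IsSymm) (k : ι)
    (y : ι → R) (s : R) :
    quad τ (y + Pi.single k s) = quad τ y + 2 * s * ∑ j, τ k j * y j + s ^ 2 * τ k k := by
  have h1 : ∑ i, y i * τ i k = ∑ j, τ k j * y j :=
    Finset.sum_congr rfl fun i _ => by rw [hτ.apply, mul_comm]
  have hs : ∀ i, (Pi.single k s : ι → R) i = if i = k then s else 0 := fun i => by
    rw [Pi.single_apply]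
  simp only [quad, Pi.add_apply, hs, add_mul, mul_add, Finset.sum_add_distrib, ite_mul, mul_ite,
    zero_mul, mul_zero, Finset.sum_ite_eq', Finset.mem_univ, if_true, Finset.sum_ite_irrel,
    Finset.sum_const_zero]
  rw [← Finset.sum_mul, h1]
  simp only [mul_assoc, ← Finset.mul_sum]
  ring

/-- The image of `τ` under the inversion in the `k`-th coordinate. -/
def invertAt (k : ι) (τ : Matrix ι ι ℂ) : Matrix ι ι ℂ :=
  Matrix.of fun i j =>
    if i = k then (if j = k then -1 / τ k k else τ k j / τ k k)
    else if j = k then τ i k / τ k k else τ i j - τ i k * τ k j / τ k k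

theorem invertAt_isSymm (k : ι) {τ : Matrix ι ι ℂ} (hτ : τ.IsSymm) : (invertAt k τ).IsSymm := by
  ext i j
  by_cases hi : i = k <;> by_cases hj : j = k <;>
    simp [invertAt, hi, hj, hτ.apply i k, hτ.apply j k, hτ.apply i j, mul_comm]

theorem sum_invertAt_mul (k : ι) (τ : Matrix ι ι ℂ) {y : ι → ℂ} (hy : y k = 0) :
    ∑ j, invertAt k τ k j * y j = (∑ j, τ k j * y j) / τ k k := by
  rw [Finset.sum_div]
  refine Finset.sum_congr rfl fun j _ => ?_
  by_cases hj : j = k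
  · simp [hj, hy]
  · simp only [invertAt, Matrix.of_apply, if_true, if_neg hj]
    ring

theorem quad_invertAt (k : ι) {τ : Matrix ι ι ℂ} (hτ : τ.IsSymm) {y : ι → ℂ} (hy : y k = 0) :
    quad (invertAt k τ) y = quad τ y - (∑ j, τ k j * y j) ^ 2 / τ k k := by
  have h1 : ∑ i, y i * τ i k = ∑ j, τ k j * y j :=
    Finset.sum_congr rfl fun i _ => by rw [hτ.apply, mul_comm]
  have h : ∀ i j, y i * invertAt k τ i j * y j =
      y i * τ i j * y j - y i * τ i k * (τ k j * y j) / τ k k := by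
    intro i j
    by_cases hi : i = k
    · simp [hi, hy]
    · by_cases hj : j = k
      · simp [hj, hy]
      · simp only [invertAt, Matrix.of_apply, if_neg hi, if_neg hj]
        ring
  simp only [quad, h, Finset.sum_sub_distrib]
  congr 1
  simp only [← Finset.sum_div, ← Finset.mul_sum, ← Finset.sum_mul, h1]
  rw [sq]

theorem im_diag_pos {τ : Matrix ι ι ℂ} (hτ : τ ∈ Siegel ι) (k : ι) : 0 < (τ k k).im := by
  have h := hτ.2 (Pi.single k 1) (by simp)
  simpa [Pi.single_apply] using h

theorem diag_ne_zero {τ : Matrix ι ι ℂ} (hτ : τ ∈ Siegel ι) (k : ι) : τ k k ≠ 0 := by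
  intro h
  have := im_diag_pos hτ k
  simp [h] at this

theorem invertAt_mem_siegel {τ : Matrix ι ι ℂ} (hτ : τ ∈ Siegel ι) (k : ι) :
    invertAt k τ ∈ Siegel ι := by
  refine ⟨invertAt_isSymm k hτ.1, fun v hv => ?_⟩
  have hT := im_diag_pos hτ k
  have hT0 := diag_ne_zero hτ k
  set T := τ k k with hTdef
  set y : ι → ℝ := Function.update v k 0 with hy
  have hyk : (fun i => (y i : ℂ)) k = 0 := by simp [hy]
  set w := ∑ j, τ k j * (y j : ℂ) with hw
  have hvy : (fun i => (v i : ℂ)) = (fun i => (y i : ℂ)) + Pi.single k (v k : ℂ) := by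
    funext i
    by_cases hi : i = k
    · subst hi; simp [hy]
    · simp [hy, hi]
  -- the real numbers `a`, `b` with `w - v k = a + b * T`
  set b : ℝ := w.im / T.im with hb
  set a : ℝ := w.re - v k - b * T.re with ha
  have hu : w - v k = a + b * T := by
    apply Complex.ext
    · simp [ha]
    · simp [hb, hT.ne']
  rw [← quad_ofReal_im, hvy, quad_add_single (invertAt_isSymm k hτ.1), quad_invertAt k hτ.1 hyk,
    sum_invertAt_mul k τ hyk]
  have hkk : invertAt k τ k k = -1 / T := by simp [invertAt, hTdef]
  have hshift : (fun i => ((y + Pi.single k (-b) : ι → ℝ) i : ℂ)) =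
      (fun i => (y i : ℂ)) + Pi.single k ((-b : ℝ) : ℂ) := by
    funext i
    by_cases hi : i = k
    · subst hi; simp
    · simp [hi]
  have hq := quad_ofReal_im τ (y + Pi.single k (-b))
  rw [hshift, quad_add_single hτ.1, ← hTdef, ← hw] at hq
  have hw' : w = v k + a + b * T := by linear_combination hu
  have hform : quad τ (fun i => (y i : ℂ)) - w ^ 2 / T + 2 * (v k : ℂ) * (w / T) +
      (v k : ℂ) ^ 2 * invertAt k τ k k =
      quad τ (fun i => (y i : ℂ)) + 2 * ((-b : ℝ) : ℂ) * w + ((-b : ℝ) : ℂ) ^ 2 * T +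
        ((2 * b * v k : ℝ) : ℂ) - ((a ^ 2 : ℝ) : ℂ) * T⁻¹ := by
    rw [hkk, hw']
    push_cast
    field_simp
    ring
  rw [hform, Complex.sub_im, Complex.add_im, hq, Complex.ofReal_im, add_zero,
    Complex.im_ofReal_mul, Complex.inv_im, neg_div, mul_neg, sub_neg_eq_add]
  have hn : 0 < Complex.normSq T := Complex.normSq_pos.2 hT0
  by_cases hz : (y + Pi.single k (-b) : ι → ℝ) = 0
  · have hb0 : b = 0 := by simpa [hy] using congrFun hz k
    have hy0 : y = 0 := by simpa [hb0] using hz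
    have hw0 : w = 0 := by simp [hw, hy0]
    have hak : a = -v k := by simp [ha, hb0, hw0]
    have hvk : v k ≠ 0 := by
      intro h0
      apply hv
      rw [← hy0, hy, ← h0, Function.update_eq_self]
    rw [hz, hak, neg_sq]
    simp only [Pi.zero_apply, zero_mul, Finset.sum_const_zero, zero_add]
    positivity
  · exact add_pos_of_pos_of_nonneg (hτ.2 _ hz) (by positivity)

/-- The translate of an integral vector by half a characteristic, with the `k`-th coordinate
removed. -/
def halfShift (k : ι) (ε : ι → ZMod 2) (n : {j // j ≠ k} → ℤ) (i : ι) : ℂ :=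
  if h : i = k then 0 else (n ⟨i, h⟩ : ℂ) + ((ε i).val : ℂ) / 2

theorem thetaConst_eq_tsum_thetaOne {τ : Matrix ι ι ℂ} (hτ : τ ∈ Siegel ι) (k : ι)
    (ε δ : ι → ZMod 2) :
    thetaConst (ε, δ) τ = ∑' n : {j // j ≠ k} → ℤ, Complex.exp ((Real.pi : ℂ) * Complex.I *
      (quad τ (halfShift k ε n) + ∑ i, halfShift k ε n i * ((δ i).val : ℂ))) *
        thetaOne (ε k) (δ k) (∑ j, τ k j * halfShift k ε n j) (τ k k) := by
  rw [thetaConst_eq_tsum, ← (Equiv.funSplitAt k ℤ).symm.tsum_eq,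
    ← (Equiv.prodComm _ _).tsum_eq]
  have hs : Summable fun p : ({j // j ≠ k} → ℤ) × ℤ =>
      thetaSummand ε δ τ ((Equiv.funSplitAt k ℤ).symm (Equiv.prodComm _ _ p)) :=
    (Equiv.prodComm ({j // j ≠ k} → ℤ) ℤ).summable_iff.2
      ((Equiv.funSplitAt k ℤ).symm.summable_iff.2 (summable_thetaSummand hτ ε δ))
  rw [hs.tsum_prod]
  refine tsum_congr fun n => ?_
  rw [thetaOne, ← tsum_mul_left]
  refine tsum_congr fun t => ?_
  have hv : (fun i => (((Equiv.funSplitAt k ℤ).symm (t, n) i : ℤ) : ℂ) + ((ε i).val : ℂ) / 2) =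
      halfShift k ε n + Pi.single k ((t : ℂ) + ((ε k).val : ℂ) / 2) := by
    funext i
    by_cases hi : i = k
    · subst hi; simp [halfShift]
    · simp [halfShift, hi]
  have hd : ∑ i, (((Equiv.funSplitAt k ℤ).symm (t, n) i : ℤ) + ((ε i).val : ℂ) / 2) *
      ((δ i).val : ℂ) = ∑ i, halfShift k ε n i * ((δ i).val : ℂ) +
        ((t : ℂ) + ((ε k).val : ℂ) / 2) * ((δ k).val : ℂ) := by
    have : ∀ i, (((Equiv.funSplitAt k ℤ).symm (t, n) i : ℤ) + ((ε i).val : ℂ) / 2) =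
        halfShift k ε n i + (Pi.single k ((t : ℂ) + ((ε k).val : ℂ) / 2) : ι → ℂ) i :=
      fun i => congrFun hv i
    simp only [this, add_mul, Finset.sum_add_distrib]
    congr 1
    rw [Finset.sum_eq_single k (by intro i _ hi; simp [hi]) (by simp)]
    simp
    ring
  rw [Equiv.prodComm_apply, Prod.swap_prod_mk, thetaSummand, hv, hd, quad_add_single hτ.1,
    ← Complex.exp_add]
  congr 1
  ring

/-- The action of the inversion in the `k`-th coordinate on characteristics. -/
def swapChar (k : ι) (m : Char2 ι) : Char2 ι :=
  (Function.update m.1 k (m.2 k), Function.update m.2 k (m.1 k))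

theorem swapChar_isAffineMap (k : ι) : IsAffineMap (swapChar (ι := ι) k) := by
  intro x y z
  refine Prod.ext ?_ ?_ <;>
  · funext i
    by_cases hi : i = k
    · subst hi; simp [swapChar]
    · simp [swapChar, hi]

theorem thetaConst_inversion {τ : Matrix ι ι ℂ} (hτ : τ ∈ Siegel ι) (k : ι) (m : Char2 ι) :
    thetaConst m τ = 1 / (-Complex.I * τ k k) ^ (1 / 2 : ℂ) *
      Complex.exp ((Real.pi : ℂ) * Complex.I * (1 / 2)) ^ ((m.1 k).val * (m.2 k).val) *
        thetaConst (swapChar k m) (invertAt k τ) := by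
  obtain ⟨ε, δ⟩ := m
  rw [swapChar, thetaConst_eq_tsum_thetaOne hτ k,
    thetaConst_eq_tsum_thetaOne (invertAt_mem_siegel hτ k) k, ← tsum_mul_left]
  refine tsum_congr fun n => ?_
  have hy : halfShift k (Function.update ε k (δ k)) n = halfShift k ε n := by
    funext i
    by_cases hi : i = k <;> simp [halfShift, hi]
  have hk : halfShift k ε n k = 0 := by simp [halfShift]
  have hd : ∑ i, halfShift k ε n i * (((Function.update δ k (ε k) i).val : ℕ) : ℂ) =
      ∑ i, halfShift k ε n i * ((δ i).val : ℂ) := by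
    refine Finset.sum_congr rfl fun i _ => ?_
    by_cases hi : i = k
    · subst hi; simp [hk]
    · simp [hi]
  have hkk : invertAt k τ k k = -1 / τ k k := by simp [invertAt]
  simp only [hy, hd, Function.update_self, hkk, sum_invertAt_mul k τ hk, quad_invertAt k hτ.1 hk]
  rw [thetaOne_inversion _ _ _ (diag_ne_zero hτ k)]
  have hexp : Complex.exp ((Real.pi : ℂ) * Complex.I *
      (quad τ (halfShift k ε n) - (∑ j, τ k j * halfShift k ε n j) ^ 2 / τ k k +
        ∑ i, halfShift k ε n i * ((δ i).val : ℂ))) =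
      Complex.exp ((Real.pi : ℂ) * Complex.I *
        (quad τ (halfShift k ε n) + ∑ i, halfShift k ε n i * ((δ i).val : ℂ))) *
      Complex.exp (-((Real.pi : ℂ) * Complex.I *
        ((∑ j, τ k j * halfShift k ε n j) ^ 2 / τ k k))) := by
    rw [← Complex.exp_add]
    congr 1
    ring
  rw [hexp]
  ring

/-- Products of theta constants over affine families of characteristics transform with weight `8`
under the inversion in one coordinate. -/
theorem prod_thetaConst_swapChar {τ : Matrix ι ι ℂ} (hτ : τ ∈ Siegel ι) (k : ι)
    {a : (Fin 4 → ZMod 2) → Char2 ι} (ha : IsAffineMap a) :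
    ∏ x, thetaConst (swapChar k (a x)) (invertAt k τ) =
      τ k k ^ 8 * ∏ x, thetaConst (a x) τ := by
  have h1 : IsAffineMap fun x => (a x).1 k := fun x y z => by simp [ha x y z]
  have h2 : IsAffineMap fun x => (a x).2 k := fun x y z => by simp [ha x y z]
  have hT := diag_ne_zero hτ k
  simp only [thetaConst_inversion hτ k (a _), Finset.prod_mul_distrib]
  rw [prod_pow_eq_one (exp_pi_mul_I_mul_pow_eq_one 1 (by push_cast; norm_num))
    (four_dvd_sum_val_mul_val h1 h2), mul_one, ← mul_assoc]
  have hsq : ((-Complex.I * τ k k) ^ (1 / 2 : ℂ)) ^ 2 = -Complex.I * τ k k := by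
    rw [← Complex.cpow_nat_mul]
    norm_num
  have hc : ∏ _x : Fin 4 → ZMod 2, 1 / (-Complex.I * τ k k) ^ (1 / 2 : ℂ) = 1 / τ k k ^ 8 := by
    have hI : Complex.I ^ 8 = 1 := by
      rw [show 8 = 4 * 2 from rfl, pow_mul, Complex.I_pow_four, one_pow]
    have hcard : (Finset.univ : Finset (Fin 4 → ZMod 2)).card = 2 * 8 := by simp
    rw [Finset.prod_const, hcard, div_pow, one_pow, pow_mul, hsq, mul_pow, neg_pow, hI]
    norm_num
  rw [hc, mul_one_div_cancel (pow_ne_zero 8 hT), one_mul]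

end Inversion

open SymplecticGenerators Matrix

section Law

variable {ι : Type} [Fintype ι]

/-- The quadratic form on `𝔽₂^{2g}` attached to a characteristic. -/
def charForm (m : Char2 ι) (y : ι ⊕ ι → ZMod 2) : ZMod 2 :=
  ∑ i, (y (Sum.inl i) * y (Sum.inr i) + m.1 i * y (Sum.inr i) + m.2 i * y (Sum.inl i))

theorem quad_eq_sum_diag {S : Matrix ι ι (ZMod 2)} (hS : S.IsSymm) (x : ι → ZMod 2) :
    quad S x = ∑ i, S i i * x i := by
  classical
  have hoff : ∑ p ∈ Finset.univ.filter (fun p : ι × ι => p.1 ≠ p.2),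
      x p.1 * S p.1 p.2 * x p.2 = 0 := by
    refine Finset.sum_involution (fun p _ => p.swap) ?_ ?_ ?_ ?_
    · intro p _
      rw [Prod.fst_swap, Prod.snd_swap, hS.apply p.1 p.2,
        show x p.2 * S p.1 p.2 * x p.1 = x p.1 * S p.1 p.2 * x p.2 by ring]
      exact CharTwo.add_self_eq_zero _
    · intro p hp _ h
      rw [Finset.mem_filter] at hp
      exact hp.2 (congrArg Prod.snd h)
    · intro p hp
      rw [Finset.mem_filter] at hp ⊢
      exact ⟨Finset.mem_univ _, hp.2.symm⟩
    · intro p _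
      exact Prod.swap_swap p
  have hdiag : ∑ p ∈ Finset.univ.filter (fun p : ι × ι => p.1 = p.2),
      x p.1 * S p.1 p.2 * x p.2 = ∑ i, S i i * x i := by
    have hx : ∀ a b : ZMod 2, a * b * a = b * a := by decide
    rw [Finset.sum_filter, Fintype.sum_prod_type]
    simp only [Finset.sum_ite_eq, Finset.mem_univ, if_true, hx]
  rw [quad, ← Fintype.sum_prod_type', ← Finset.sum_filter_add_sum_filter_not Finset.univ
    (fun p : ι × ι => p.1 = p.2), hdiag, hoff, add_zero]

/-- The denominator `Cτ + D`. -/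
def denom (γ : Matrix (ι ⊕ ι) (ι ⊕ ι) ℤ) (τ : Matrix ι ι ℂ) : Matrix ι ι ℂ :=
  γ.toBlocks₂₁.map (Int.cast : ℤ → ℂ) * τ + γ.toBlocks₂₂.map (Int.cast : ℤ → ℂ)

/-- The numerator `Aτ + B`. -/
def numer (γ : Matrix (ι ⊕ ι) (ι ⊕ ι) ℤ) (τ : Matrix ι ι ℂ) : Matrix ι ι ℂ :=
  γ.toBlocks₁₁.map (Int.cast : ℤ → ℂ) * τ + γ.toBlocks₁₂.map (Int.cast : ℤ → ℂ)

theorem map_intCast_mul {R : Type} [Ring R] {l m n : Type} [Fintype m] (M : Matrix l m ℤ)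
    (N : Matrix m n ℤ) : (M * N).map (Int.cast : ℤ → R) =
      M.map (Int.cast : ℤ → R) * N.map (Int.cast : ℤ → R) :=
  Matrix.map_mul (f := Int.castRingHom R)

theorem map_intCast_add {R : Type} [Ring R] {m n : Type} (M N : Matrix m n ℤ) :
    (M + N).map (Int.cast : ℤ → R) =
      M.map (Int.cast : ℤ → R) + N.map (Int.cast : ℤ → R) := by
  ext i j; simp

theorem denom_mul (γ₁ γ₂ : Matrix (ι ⊕ ι) (ι ⊕ ι) ℤ) (τ : Matrix ι ι ℂ) :
    denom (γ₁ * γ₂) τ =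
      γ₁.toBlocks₂₁.map (Int.cast : ℤ → ℂ) * numer γ₂ τ + γ₁.toBlocks₂₂.map (Int.cast : ℤ → ℂ) * denom γ₂ τ := by
  conv_lhs => rw [← fromBlocks_toBlocks γ₁, ← fromBlocks_toBlocks γ₂, fromBlocks_multiply]
  simp only [denom, numer, toBlocks_fromBlocks₂₁, toBlocks_fromBlocks₂₂, map_intCast_add,
    map_intCast_mul, Matrix.mul_add, Matrix.add_mul, Matrix.mul_assoc]
  abel

theorem numer_mul (γ₁ γ₂ : Matrix (ι ⊕ ι) (ι ⊕ ι) ℤ) (τ : Matrix ι ι ℂ) :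
    numer (γ₁ * γ₂) τ =
      γ₁.toBlocks₁₁.map (Int.cast : ℤ → ℂ) * numer γ₂ τ + γ₁.toBlocks₁₂.map (Int.cast : ℤ → ℂ) * denom γ₂ τ := by
  conv_lhs => rw [← fromBlocks_toBlocks γ₁, ← fromBlocks_toBlocks γ₂, fromBlocks_multiply]
  simp only [denom, numer, toBlocks_fromBlocks₁₁, toBlocks_fromBlocks₁₂, map_intCast_add,
    map_intCast_mul, Matrix.mul_add, Matrix.add_mul, Matrix.mul_assoc]
  abel

variable [DecidableEq ι]

/-- The matrix `γ` acts on characteristics through `φ`, compatibly with the transformation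
behaviour of products of theta constants over affine families of characteristics. -/
structure IsThetaLift (γ : Matrix (ι ⊕ ι) (ι ⊕ ι) ℤ) (φ : Char2 ι → Char2 ι) : Prop where
  isAffineMap : IsAffineMap φ
  charForm_eq : ∀ m x, charForm m ((γᵀ.map (Int.cast : ℤ → ZMod 2)) *ᵥ x) = charForm (φ m) x
  transform : ∀ τ ∈ Siegel ι, ∃ τ' ∈ Siegel ι, (denom γ τ).det ≠ 0 ∧ numer γ τ = τ' * denom γ τ ∧
    ∀ a : (Fin 4 → ZMod 2) → Char2 ι, IsAffineMap a →
      ∏ x, thetaConst (φ (a x)) τ' = (denom γ τ).det ^ 8 * ∏ x, thetaConst (a x) τ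

theorem IsThetaLift.one : IsThetaLift (1 : Matrix (ι ⊕ ι) (ι ⊕ ι) ℤ) id where
  isAffineMap := fun _ _ _ => rfl
  charForm_eq := fun m x => by simp
  transform := fun τ hτ => by
    have hd : denom (1 : Matrix (ι ⊕ ι) (ι ⊕ ι) ℤ) τ = 1 := by
      rw [← fromBlocks_one]
      rw [denom, toBlocks_fromBlocks₂₁, toBlocks_fromBlocks₂₂]
      simp
    have hn : numer (1 : Matrix (ι ⊕ ι) (ι ⊕ ι) ℤ) τ = τ := by
      rw [← fromBlocks_one]
      rw [numer, toBlocks_fromBlocks₁₁, toBlocks_fromBlocks₁₂]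
      simp
    exact ⟨τ, hτ, by simp [hd], by simp [hd, hn], by simp [hd]⟩

theorem IsThetaLift.mul {γ₁ γ₂ : Matrix (ι ⊕ ι) (ι ⊕ ι) ℤ} {φ₁ φ₂ : Char2 ι → Char2 ι}
    (h₁ : IsThetaLift γ₁ φ₁) (h₂ : IsThetaLift γ₂ φ₂) :
    IsThetaLift (γ₁ * γ₂) (fun m => φ₁ (φ₂ m)) where
  isAffineMap := h₁.isAffineMap.comp h₂.isAffineMap
  charForm_eq := fun m x => by
    rw [transpose_mul, map_intCast_mul, ← mulVec_mulVec, h₂.charForm_eq, h₁.charForm_eq]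
  transform := fun τ hτ => by
    obtain ⟨τ₂, hτ₂, hd₂, hn₂, hp₂⟩ := h₂.transform τ hτ
    obtain ⟨τ₁, hτ₁, hd₁, hn₁, hp₁⟩ := h₁.transform τ₂ hτ₂
    have hd : denom (γ₁ * γ₂) τ = denom γ₁ τ₂ * denom γ₂ τ := by
      rw [denom_mul, hn₂, denom.eq_def γ₁, Matrix.add_mul, Matrix.mul_assoc]
    have hn : numer (γ₁ * γ₂) τ = numer γ₁ τ₂ * denom γ₂ τ := by
      rw [numer_mul, hn₂, numer.eq_def γ₁, Matrix.add_mul, Matrix.mul_assoc]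
    refine ⟨τ₁, hτ₁, ?_, ?_, fun a ha => ?_⟩
    · rw [hd, det_mul]
      exact mul_ne_zero hd₁ hd₂
    · rw [hn, hd, hn₁, Matrix.mul_assoc]
    · rw [hp₁ _ (h₂.isAffineMap.comp ha), hp₂ a ha, hd, det_mul]
      ring

theorem charForm_translation {S : Matrix ι ι ℤ} (hS : S.IsSymm) (m : Char2 ι)
    (x : ι ⊕ ι → ZMod 2) :
    charForm m (((translation S hS).1ᵀ.map Int.cast) *ᵥ x) =
      charForm (m.1, m.2 + S.map Int.cast *ᵥ m.1 + fun i => (S i i : ZMod 2)) x := by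
  set s : Matrix ι ι (ZMod 2) := S.map Int.cast with hs
  have hss : s.IsSymm := by
    ext i j
    simp [hs, hS.apply]
  have hl : ∀ i, (((translation S hS).1ᵀ.map Int.cast) *ᵥ x) (Sum.inl i) = x (Sum.inl i) := by
    intro i
    simp [translation, fromBlocks_transpose, fromBlocks_map, fromBlocks_mulVec]
  have hr : ∀ i, (((translation S hS).1ᵀ.map Int.cast) *ᵥ x) (Sum.inr i) =
      (s *ᵥ fun j => x (Sum.inl j)) i + x (Sum.inr i) := by
    intro i
    simp [translation, fromBlocks_transpose, fromBlocks_map, fromBlocks_mulVec, hS.eq, hs,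
      Function.comp_def]
  have hq := quad_eq_sum_diag hss fun j => x (Sum.inl j)
  have hd : ∑ i, m.1 i * (s *ᵥ fun j => x (Sum.inl j)) i = ∑ i, (s *ᵥ m.1) i * x (Sum.inl i) := by
    change m.1 ⬝ᵥ _ = _ ⬝ᵥ _
    rw [dotProduct_mulVec, ← mulVec_transpose, hss.eq]
  have hq' : ∑ i, x (Sum.inl i) * (s *ᵥ fun j => x (Sum.inl j)) i =
      ∑ i, (S i i : ZMod 2) * x (Sum.inl i) := by
    rw [show ∑ i, (S i i : ZMod 2) * x (Sum.inl i) = ∑ i, s i i * x (Sum.inl i) from rfl, ← hq,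
      quad]
    simp only [mulVec, dotProduct, Finset.mul_sum, mul_assoc]
  simp only [charForm, hl, hr, mul_add, add_mul, Pi.add_apply, Finset.sum_add_distrib, hd, hq']
  abel

theorem translateChar_eq (k j : ι) (m : Char2 ι) :
    translateChar k j m =
      (m.1, m.2 + (crossMatrix k (Pi.single j 1)).map (Int.cast : ℤ → ZMod 2) *ᵥ m.1 +
        fun i => (crossMatrix k (Pi.single j 1) i i : ZMod 2)) := by
  by_cases hkj : k = j
  · subst hkj
    simp only [translateChar, if_true]
    refine Prod.ext rfl (funext fun i => ?_)
    by_cases hi : i = k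
    · subst hi
      simp [mulVec, dotProduct, crossMatrix, Pi.single_apply, add_assoc]
    · simp [mulVec, dotProduct, crossMatrix, hi]
  · simp only [translateChar, if_neg hkj]
    refine Prod.ext rfl (funext fun i => ?_)
    by_cases hi : i = k
    · subst hi
      simp [mulVec, dotProduct, crossMatrix, Pi.single_apply, hkj]
    · by_cases hj : i = j
      · subst hj
        simp [mulVec, dotProduct, crossMatrix, hi]
      · simp [mulVec, dotProduct, crossMatrix, hi, hj]

theorem denom_translation {S : Matrix ι ι ℤ} (hS : S.IsSymm) (τ : Matrix ι ι ℂ) :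
    denom (translation S hS).1 τ = 1 := by
  rw [translation, denom, toBlocks_fromBlocks₂₁, toBlocks_fromBlocks₂₂]
  simp

theorem numer_translation {S : Matrix ι ι ℤ} (hS : S.IsSymm) (τ : Matrix ι ι ℂ) :
    numer (translation S hS).1 τ = τ + S.map Int.cast := by
  rw [translation, numer, toBlocks_fromBlocks₁₁, toBlocks_fromBlocks₁₂]
  simp

theorem add_map_intCast_mem_siegel {S : Matrix ι ι ℤ} (hS : S.IsSymm) {τ : Matrix ι ι ℂ}
    (hτ : τ ∈ Siegel ι) : τ + S.map Int.cast ∈ Siegel ι := by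
  refine ⟨hτ.1.add ?_, fun v hv => ?_⟩
  · ext i j
    simp [hS.apply]
  · simpa using hτ.2 v hv

theorem isThetaLift_translation (k j : ι) :
    IsThetaLift (translation (crossMatrix k (Pi.single j 1)) (crossMatrix_isSymm _ _)).1
      (translateChar k j) where
  isAffineMap := translateChar_isAffineMap k j
  charForm_eq := fun m x => by rw [charForm_translation, translateChar_eq]
  transform := fun τ hτ => by
    refine ⟨_, add_map_intCast_mem_siegel (crossMatrix_isSymm k (Pi.single j 1)) hτ, ?_⟩
    rw [denom_translation, numer_translation, det_one, Matrix.mul_one]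
    refine ⟨one_ne_zero, rfl, fun a ha => ?_⟩
    rw [prod_thetaConst_translateChar k j τ ha, one_pow, one_mul]

theorem isThetaLift_translation_neg (k j : ι) :
    IsThetaLift (translation (-crossMatrix k (Pi.single j 1)) (crossMatrix_isSymm _ _).neg).1
      (translateChar k j) where
  isAffineMap := translateChar_isAffineMap k j
  charForm_eq := fun m x => by
    have hneg : ∀ n : ℤ, ((-n : ℤ) : ZMod 2) = (n : ZMod 2) := fun n => by
      rw [Int.cast_neg, CharTwo.neg_eq]
    have hmap : (-crossMatrix k (Pi.single j 1)).map (Int.cast : ℤ → ZMod 2) =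
        (crossMatrix k (Pi.single j 1)).map (Int.cast : ℤ → ZMod 2) := by
      ext a b
      exact hneg _
    rw [charForm_translation, translateChar_eq, hmap]
    simp only [Matrix.neg_apply, hneg]
  transform := fun τ hτ => by
    refine ⟨_, add_map_intCast_mem_siegel (crossMatrix_isSymm k (Pi.single j 1)).neg hτ, ?_⟩
    rw [denom_translation, numer_translation, det_one, Matrix.mul_one]
    refine ⟨one_ne_zero, rfl, fun a ha => ?_⟩
    have h := prod_thetaConst_translateChar k j
      (τ + (-crossMatrix k (Pi.single j 1)).map (Int.cast : ℤ → ℂ))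
      ((translateChar_isAffineMap k j).comp ha)
    rw [add_assoc, ← map_intCast_add, neg_add_cancel] at h
    simp only [translateChar_involutive] at h
    rw [one_pow, one_mul, ← h]
    simp

theorem denom_partialInversion (k : ι) (τ : Matrix ι ι ℂ) :
    denom (partialInversion {k}).1 τ = updateRow 1 k (τ k) := by
  rw [partialInversion, denom, toBlocks_fromBlocks₂₁, toBlocks_fromBlocks₂₂]
  ext i j
  have hP : (coordProj ℤ {k}).map (Int.cast : ℤ → ℂ) =
      diagonal fun i => if i = k then (1 : ℂ) else 0 := by
    ext a b
    by_cases hab : a = b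
    · subst hab
      by_cases hak : a = k <;> simp [coordProj, hak]
    · simp [coordProj, hab]
  rw [hP, Matrix.add_apply, diagonal_mul]
  by_cases hi : i = k
  · subst hi
    by_cases hij : i = j
    · subst hij; simp [coordProj]
    · simp [coordProj, hij]
  · by_cases hij : i = j
    · subst hij; simp [coordProj, hi]
    · simp [coordProj, hi, hij]

theorem numer_partialInversion (k : ι) (τ : Matrix ι ι ℂ) :
    numer (partialInversion {k}).1 τ = updateRow τ k (Pi.single k (-1)) := by
  rw [partialInversion, numer, toBlocks_fromBlocks₁₁, toBlocks_fromBlocks₁₂]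
  ext i j
  have hP : (1 - coordProj ℤ {k}).map (Int.cast : ℤ → ℂ) =
      diagonal fun i => if i = k then (0 : ℂ) else 1 := by
    ext a b
    by_cases hab : a = b
    · subst hab
      by_cases hak : a = k <;> simp [coordProj, hak]
    · simp [coordProj, hab]
  rw [hP, Matrix.add_apply, diagonal_mul]
  by_cases hi : i = k
  · subst hi
    by_cases hij : i = j
    · subst hij; simp [coordProj]
    · simp [coordProj, hij, Ne.symm hij]
  · by_cases hij : i = j
    · subst hij; simp [coordProj, hi]
    · simp [coordProj, hi, hij]

theorem det_updateRow_one (k : ι) (v : ι → ℂ) :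
    (updateRow (1 : Matrix ι ι ℂ) k v).det = v k := by
  rw [← cramer_transpose_apply, transpose_one, cramer_one]
  rfl

theorem invertAt_mul_updateRow {τ : Matrix ι ι ℂ} (hτ : τ ∈ Siegel ι) (k : ι) :
    updateRow τ k (Pi.single k (-1)) = invertAt k τ * updateRow 1 k (τ k) := by
  have hT := diag_ne_zero hτ k
  ext i j
  have hrow : ∀ l, updateRow (1 : Matrix ι ι ℂ) k (τ k) l j =
      (if l = k then τ k j else 0) + if l = j then (if j = k then 0 else 1) else 0 := by
    intro l
    by_cases hl : l = k
    · subst hl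
      by_cases hlj : l = j <;> simp [hlj]
    · by_cases hlj : l = j
      · subst hlj; simp [hl]
      · simp [hl, hlj]
  rw [mul_apply]
  simp only [hrow, mul_add, mul_ite, mul_zero, mul_one, Finset.sum_add_distrib,
    Finset.sum_ite_eq', Finset.mem_univ, if_true]
  by_cases hi : i = k <;> by_cases hj : j = k <;> simp [invertAt, hi, hj] <;> field_simp <;> ring

theorem charForm_partialInversion (k : ι) (m : Char2 ι) (x : ι ⊕ ι → ZMod 2) :
    charForm m ((partialInversion {k}).1ᵀ.map (Int.cast : ℤ → ZMod 2) *ᵥ x) =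
      charForm (swapChar k m) x := by
  have hM : (partialInversion {k}).1ᵀ.map (Int.cast : ℤ → ZMod 2) =
      fromBlocks (diagonal fun i => if i = k then 0 else 1)
        (diagonal fun i => if i = k then 1 else 0) (diagonal fun i => if i = k then 1 else 0)
        (diagonal fun i => if i = k then 0 else 1) := by
    ext (i | i) (j | j) <;> by_cases hij : i = j <;> by_cases hi : i = k <;>
      by_cases hj : j = k <;>
      simp_all [partialInversion, fromBlocks_transpose, coordProj, diagonal_apply, one_apply,
        CharTwo.neg_eq, eq_comm]
  rw [hM]
  simp only [charForm, fromBlocks_mulVec, Sum.elim_inl, Sum.elim_inr, Pi.add_apply,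
    mulVec_diagonal]
  refine Finset.sum_congr rfl fun i _ => ?_
  by_cases hi : i = k
  · subst hi
    simp [swapChar]
    ring
  · simp [swapChar, hi]

theorem isThetaLift_partialInversion (k : ι) :
    IsThetaLift (partialInversion {k}).1 (swapChar k) where
  isAffineMap := swapChar_isAffineMap k
  charForm_eq := charForm_partialInversion k
  transform := fun τ hτ => by
    refine ⟨_, invertAt_mem_siegel hτ k, ?_⟩
    rw [denom_partialInversion, numer_partialInversion, det_updateRow_one]
    exact ⟨diag_ne_zero hτ k, invertAt_mul_updateRow hτ k,
      fun a ha => prod_thetaConst_swapChar hτ k ha⟩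

theorem exists_isThetaLift (γ : symplecticGroup ι ℤ) : ∃ φ, IsThetaLift γ.1 φ := by
  let K : Subgroup (symplecticGroup ι ℤ) :=
    { carrier := {γ | (∃ φ, IsThetaLift γ.1 φ) ∧ ∃ φ, IsThetaLift (γ⁻¹).1 φ}
      one_mem' := by
        refine ⟨⟨_, IsThetaLift.one⟩, id, ?_⟩
        rw [inv_one]
        exact IsThetaLift.one
      mul_mem' := by
        rintro a b ⟨⟨φ₁, h₁⟩, ψ₁, h₁'⟩ ⟨⟨φ₂, h₂⟩, ψ₂, h₂'⟩
        refine ⟨⟨_, h₁.mul h₂⟩, fun m => ψ₂ (ψ₁ m), ?_⟩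
        rw [_root_.mul_inv_rev]
        exact h₂'.mul h₁'
      inv_mem' := by
        rintro a ⟨h, h'⟩
        exact ⟨h', by rwa [inv_inv]⟩ }
  have hK : ContainsGenerators K :=
    { translation_mem := fun k j => by
        refine ⟨⟨_, isThetaLift_translation k j⟩, translateChar k j, ?_⟩
        rw [translation_inv]
        exact isThetaLift_translation_neg k j
      inversion_mem := fun k => by
        have h := isThetaLift_partialInversion k
        have hinv : (partialInversion {k})⁻¹ =
            partialInversion {k} * partialInversion {k} * partialInversion {k} := by
          rw [inv_eq_iff_mul_eq_one, ← partialInversion_pow_four {k}]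
          simp only [pow_succ, pow_zero, one_mul, _root_.mul_assoc]
        refine ⟨⟨_, h⟩, fun m => swapChar k (swapChar k (swapChar k m)), ?_⟩
        rw [hinv]
        exact (h.mul h).mul h }
  exact (mem_of_containsGenerators hK γ).1

end Law

section Subspaces

variable {ι : Type} [Fintype ι]

theorem charForm_injective {m m' : Char2 ι} (h : ∀ x, charForm m x = charForm m' x) : m = m' := by
  classical
  refine Prod.ext (funext fun i => ?_) (funext fun i => ?_)
  · simpa [charForm, Pi.single_apply] using h (Pi.single (Sum.inr i) 1)
  · simpa [charForm, Pi.single_apply] using h (Pi.single (Sum.inl i) 1)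

theorem exists_prod_eq_prod_pow {i : ℕ} (hi : i ≤ 4) {W : Finset (Char2 ι)}
    (hW : IsLinearSubspaceDim i W) :
    ∃ a : (Fin 4 → ZMod 2) → Char2 ι, IsAffineMap a ∧
      ∀ f : Char2 ι → ℂ, ∏ x, f (a x) = (∏ w ∈ W, f w) ^ 2 ^ (4 - i) := by
  classical
  obtain ⟨V, hV, hWV⟩ := hW
  have hrank : Module.finrank (ZMod 2) (Fin 4 → ZMod 2) =
      Module.finrank (ZMod 2) (V × (Fin (4 - i) → ZMod 2)) := by
    rw [Module.finrank_prod, hV, Module.finrank_fin_fun, Module.finrank_fin_fun]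
    omega
  let e := LinearEquiv.ofFinrankEq (R := ZMod 2) _ _ hrank
  refine ⟨fun x => ((e x).1 : Char2 ι), fun x y z => by simp, fun f => ?_⟩
  rw [← Equiv.prod_comp e.symm.toEquiv]
  simp only [LinearEquiv.coe_toEquiv, LinearEquiv.apply_symm_apply]
  rw [Fintype.prod_prod_type]
  simp only [Finset.prod_const, Finset.prod_pow]
  have hmem : ∀ w, w ∈ W ↔ w ∈ V := fun w => by
    rw [← Finset.mem_coe, hWV, SetLike.mem_coe]
  rw [Finset.prod_subtype W hmem]
  congr 1
  simp

theorem isLinearSubspaceDim_map {i : ℕ} {W : Finset (Char2 ι)} (hW : IsLinearSubspaceDim i W)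
    (e : Char2 ι ≃ₗ[ZMod 2] Char2 ι) :
    IsLinearSubspaceDim i (W.map e.toEquiv.toEmbedding) := by
  obtain ⟨V, hV, hWV⟩ := hW
  refine ⟨V.map e.toLinearMap, ?_, ?_⟩
  · rw [← hV]
    exact LinearEquiv.finrank_map_eq e V
  · rw [Finset.coe_map, hWV]
    rfl

theorem Pform_eq_of_prod {i : ℕ} (hi : i ≤ 4) (e : Char2 ι ≃ₗ[ZMod 2] Char2 ι)
    {τ τ' : Matrix ι ι ℂ} {c : ℂ}
    (h : ∀ a : (Fin 4 → ZMod 2) → Char2 ι, IsAffineMap a →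
      ∏ x, thetaConst (e (a x)) τ' = c * ∏ x, thetaConst (a x) τ) :
    Pform ι i (2 ^ (4 - i)) τ' = c * Pform ι i (2 ^ (4 - i)) τ := by
  unfold Pform
  rw [Finset.mul_sum]
  symm
  refine Finset.sum_equiv (Equiv.finsetCongr e.toEquiv) ?_ ?_
  · intro W
    simp only [Finset.mem_filter, Finset.mem_univ, true_and, Equiv.finsetCongr_apply]
    refine ⟨fun hW => isLinearSubspaceDim_map hW e, fun hW => ?_⟩
    have := isLinearSubspaceDim_map hW e.symm
    rw [Finset.map_map] at this
    convert this
    ext w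
    simp
  · intro W hW
    simp only [Finset.mem_filter, Finset.mem_univ, true_and] at hW
    obtain ⟨a, ha, hprod⟩ := exists_prod_eq_prod_pow hi hW
    rw [Equiv.finsetCongr_apply, Finset.prod_map]
    have := h a ha
    rw [hprod fun w => thetaConst (e w) τ', hprod fun w => thetaConst w τ] at this
    exact this.symm

theorem XiZero_eq_of_prod (hι : Fintype.card ι ≤ 4) (e : Char2 ι ≃ₗ[ZMod 2] Char2 ι)
    {τ τ' : Matrix ι ι ℂ} {c : ℂ}
    (h : ∀ a : (Fin 4 → ZMod 2) → Char2 ι, IsAffineMap a →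
      ∏ x, thetaConst (e (a x)) τ' = c * ∏ x, thetaConst (a x) τ) :
    XiZero ι τ' = c * XiZero ι τ := by
  unfold XiZero
  rw [mul_left_comm, Finset.mul_sum _ _ c]
  congr 1
  refine Finset.sum_congr rfl fun i hi => ?_
  rw [Finset.mem_range] at hi
  rw [Pform_eq_of_prod (by omega) e h]
  ring

end Subspaces

section GammaOneTwo

variable {ι : Type} [Fintype ι] [DecidableEq ι]

theorem dotProduct_mulVec_eq_zero {S : Matrix ι ι (ZMod 2)} (hS : S.IsSymm) (h0 : ∀ i, S i i = 0)
    (x : ι → ZMod 2) : x ⬝ᵥ S *ᵥ x = 0 := by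
  have h := quad_eq_sum_diag hS x
  simp only [h0, zero_mul, Finset.sum_const_zero] at h
  rw [← h]
  simp only [quad, dotProduct, mulVec, Finset.mul_sum, mul_assoc]

/-- The linear map on characteristics induced by an element of the theta group. -/
theorem IsThetaLift.exists_linearEquiv {γ : symplecticGroup ι ℤ} {φ : Char2 ι → Char2 ι}
    (h : IsThetaLift γ.1 φ)
    (h0 : ∀ x, charForm (0 : Char2 ι) (γ.1ᵀ.map (Int.cast : ℤ → ZMod 2) *ᵥ x) = charForm 0 x) :
    ∃ e : Char2 ι ≃ₗ[ZMod 2] Char2 ι, ⇑e = φ := by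
  have hφ0 : φ 0 = 0 := charForm_injective fun x => by rw [← h.charForm_eq, h0]
  have hadd : ∀ x y, φ (x + y) = φ x + φ y := fun x y => by
    simpa [hφ0] using h.isAffineMap x y 0
  have hinj : Function.Injective φ := by
    intro m m' hm
    refine charForm_injective fun x => ?_
    have hx : γ.1ᵀ.map (Int.cast : ℤ → ZMod 2) *ᵥ
        ((γ⁻¹).1ᵀ.map (Int.cast : ℤ → ZMod 2) *ᵥ x) = x := by
      rw [mulVec_mulVec, ← map_intCast_mul, ← transpose_mul, ← Submonoid.coe_mul,
        inv_mul_cancel]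
      simp
    rw [← hx, h.charForm_eq, h.charForm_eq, hm]
  let f : Char2 ι →ₗ[ZMod 2] Char2 ι :=
    AddMonoidHom.toZModLinearMap 2 ⟨⟨φ, hφ0⟩, hadd⟩
  have hf : ⇑f = φ := rfl
  exact ⟨LinearEquiv.ofBijective f (Finite.injective_iff_bijective.1 (hf ▸ hinj)), rfl⟩

end GammaOneTwo

theorem mem_symplecticGroup_of_isSymplectic {g : ℕ} {A B C D : Matrix (Fin g) (Fin g) ℤ}
    (h : IsSymplectic A B C D) : fromBlocks A B C D ∈ symplecticGroup (Fin g) ℤ := by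
  rw [SymplecticGroup.mem_iff]
  have hJ : symplJ g = -Matrix.J (Fin g) ℤ := by
    simp [symplJ, Matrix.J, fromBlocks_neg]
  rw [IsSymplectic, hJ, Matrix.mul_neg, Matrix.neg_mul, neg_inj] at h
  exact h

theorem charForm_zero_of_inGammaOneTwo {g : ℕ} {A B C D : Matrix (Fin g) (Fin g) ℤ}
    (h : InGammaOneTwo A B C D) (x : Fin g ⊕ Fin g → ZMod 2) :
    charForm (0 : Char2 (Fin g)) ((fromBlocks A B C D)ᵀ.map (Int.cast : ℤ → ZMod 2) *ᵥ x) =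
      charForm 0 x := by
  obtain ⟨hAB, hCD, hAD⟩ : A * Bᵀ = B * Aᵀ ∧ C * Dᵀ = D * Cᵀ ∧ A * Dᵀ - B * Cᵀ = 1 := by
    have h1 := h.1
    simp only [IsSymplectic, symplJ, fromBlocks_transpose, fromBlocks_multiply, Matrix.mul_zero,
      Matrix.mul_one, Matrix.mul_neg, zero_add, add_zero, Matrix.neg_mul, fromBlocks_inj] at h1
    obtain ⟨h11, h12, -, h22⟩ := h1
    refine ⟨?_, ?_, ?_⟩
    · rw [neg_add_eq_zero] at h11
      exact h11.symm
    · rw [neg_add_eq_zero] at h22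
      exact h22.symm
    · rw [← h12]
      abel
  set a := A.map (Int.cast : ℤ → ZMod 2) with ha
  set b := B.map (Int.cast : ℤ → ZMod 2) with hb
  set c := C.map (Int.cast : ℤ → ZMod 2) with hc
  set d := D.map (Int.cast : ℤ → ZMod 2) with hd
  have hmap : ∀ M N : Matrix (Fin g) (Fin g) ℤ, (M * Nᵀ).map (Int.cast : ℤ → ZMod 2) =
      M.map (Int.cast : ℤ → ZMod 2) * (N.map (Int.cast : ℤ → ZMod 2))ᵀ := fun M N => by
    rw [map_intCast_mul, transpose_map]
  have hzero : ∀ M N : Matrix (Fin g) (Fin g) ℤ, M * Nᵀ = N * Mᵀ →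
      (∀ i, (M * Nᵀ) i i % 2 = 0) → ∀ y : Fin g → ZMod 2,
      y ⬝ᵥ (M.map (Int.cast : ℤ → ZMod 2) * (N.map (Int.cast : ℤ → ZMod 2))ᵀ) *ᵥ y = 0 := by
    intro M N hMN hev y
    rw [← hmap]
    refine dotProduct_mulVec_eq_zero ?_ (fun i => ?_) y
    · rw [IsSymm, ← transpose_map, transpose_mul, transpose_transpose, hMN]
    · exact (ZMod.intCast_zmod_eq_zero_iff_dvd _ 2).2 (Int.dvd_of_emod_eq_zero (hev i))
  have had : a * dᵀ + b * cᵀ = 1 := by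
    rw [ha, hb, hc, hd, ← hmap, ← hmap, ← map_intCast_add]
    have : A * Dᵀ + B * Cᵀ = 1 + (B * Cᵀ + B * Cᵀ) := by
      rw [← hAD]
      abel
    rw [this]
    ext i j
    have h2 : ∀ z : ZMod 2, z + z = 0 := by decide
    by_cases hij : i = j
    · subst hij
      simp [h2]
    · simp [hij, h2]
  have hform : ∀ y : Fin g ⊕ Fin g → ZMod 2, charForm 0 y = (y ∘ Sum.inl) ⬝ᵥ (y ∘ Sum.inr) :=
    fun y => by simp [charForm, dotProduct]
  have hγ : (fromBlocks A B C D)ᵀ.map (Int.cast : ℤ → ZMod 2) = fromBlocks aᵀ cᵀ bᵀ dᵀ := by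
    rw [fromBlocks_transpose, fromBlocks_map]
    rfl
  rw [hform, hform, hγ, fromBlocks_mulVec]
  set u := x ∘ Sum.inl
  set v := x ∘ Sum.inr
  have hmove : ∀ (M N : Matrix (Fin g) (Fin g) (ZMod 2)) (y z : Fin g → ZMod 2),
      (Mᵀ *ᵥ y) ⬝ᵥ (Nᵀ *ᵥ z) = y ⬝ᵥ (M * Nᵀ) *ᵥ z := fun M N y z => by
    rw [mulVec_transpose, ← dotProduct_mulVec, mulVec_mulVec]
  change (aᵀ *ᵥ u + cᵀ *ᵥ v) ⬝ᵥ (bᵀ *ᵥ u + dᵀ *ᵥ v) = u ⬝ᵥ v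
  rw [add_dotProduct, dotProduct_add, dotProduct_add, dotProduct_comm (cᵀ *ᵥ v) (bᵀ *ᵥ u), hmove,
    hmove, hmove, hmove, hzero A B hAB h.2.1, hzero C D hCD h.2.2, zero_add, add_zero,
    ← dotProduct_add, ← add_mulVec, had, one_mulVec]

end ThetaTransformation

open ThetaTransformation

/-- For `g ≤ 4`, `Ξ^{(g)}[0]` is a modular form of weight 8 with respect to `Γ_g(1,2)`. -/
theorem XiZero_modular (g : ℕ) (hg1 : 1 ≤ g) (hg4 : g ≤ 4)
    (A B C D : Matrix (Fin g) (Fin g) ℤ) (hγ : InGammaOneTwo A B C D)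
    (τ : Matrix (Fin g) (Fin g) ℂ) (hτ : τ ∈ Siegel (Fin g)) :
    XiZero (Fin g) (symplAction A B C D τ) =
      (C.map (Int.cast : ℤ → ℂ) * τ + D.map (Int.cast : ℤ → ℂ)).det ^ 8 *
        XiZero (Fin g) τ := by
  obtain ⟨φ, hφ⟩ := exists_isThetaLift ⟨_, mem_symplecticGroup_of_isSymplectic hγ.1⟩
  obtain ⟨e, rfl⟩ := hφ.exists_linearEquiv (charForm_zero_of_inGammaOneTwo hγ)
  obtain ⟨τ', -, hdet, hnum, hprod⟩ := hφ.transform τ hτ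
  simp only [denom, numer, Matrix.toBlocks_fromBlocks₁₁, Matrix.toBlocks_fromBlocks₁₂,
    Matrix.toBlocks_fromBlocks₂₁, Matrix.toBlocks_fromBlocks₂₂] at hdet hnum hprod
  have hτ' : symplAction A B C D τ = τ' := by
    rw [symplAction, hnum, Matrix.mul_nonsing_inv_cancel_right _ _ (isUnit_iff_ne_zero.2 hdet)]
  rw [hτ']
  exact XiZero_eq_of_prod (by simpa using hg4) e hprod
end
end

section
/- For every integer g with 2 ≤ g ≤ 4, every k with 1 ≤ k ≤ g−1, and all τ₁ ∈ ℍ_k, τ₂ ∈ ℍ_{g−k}: Ξ^{(g)}[0](diag(τ₁,τ₂)) = Ξ^{(k)}[0](τ₁)·Ξ^{(g−k)}[0](τ₂), where diag(τ₁,τ₂) ∈ ℍ_g is the block-diagonal period matrix with blocks τ₁ and τ₂. -/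
open scoped BigOperators

noncomputable section

section SubspaceSums

open Module

variable {E E₁ E₂ : Type*} [AddCommGroup E] [Module (ZMod 2) E] [Finite E]
  [AddCommGroup E₁] [Module (ZMod 2) E₁] [AddCommGroup E₂] [Module (ZMod 2) E₂]

/-- The value `μ(0, V)` of the Möbius function of the lattice of subspaces over `𝔽₂`. -/
def subspaceMoebius (V : Submodule (ZMod 2) E) : ℂ :=
  (-1) ^ finrank (ZMod 2) V * 2 ^ (finrank (ZMod 2) V).choose 2

lemma natCard_eq_two_pow_finrank : Nat.card E = 2 ^ finrank (ZMod 2) E := by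
  have := Fintype.ofFinite E
  rw [Nat.card_eq_fintype_card, Module.card_eq_pow_finrank (K := ZMod 2), ZMod.card]

/-- The complements of a line in a space of dimension `n + 1` over `𝔽₂` number `2 ^ n`. -/
lemma natCard_isCompl_of_finrank_eq_one {p : Submodule (ZMod 2) E}
    (hp : finrank (ZMod 2) p = 1) {n : ℕ} (hn : finrank (ZMod 2) E = n + 1) :
    Nat.card {q // IsCompl p q} = 2 ^ n := by
  obtain ⟨q, hq⟩ := exists_isCompl p
  have e : {f : E →ₗ[ZMod 2] p // ∀ x : p, f x = x} ≃ (q →ₗ[ZMod 2] p) :=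
    { toFun := fun f => f.1 ∘ₗ q.subtype
      invFun := fun h => ⟨LinearMap.ofIsCompl hq LinearMap.id h, fun x => by simp⟩
      left_inv := fun f => Subtype.ext <|
        LinearMap.ofIsCompl_eq hq (fun u => by simp [f.2 u]) (fun u => by simp)
      right_inv := fun h => by ext; simp }
  have : Finite (q →ₗ[ZMod 2] p) := Finite.of_injective _ DFunLike.coe_injective
  have hq' := Submodule.finrank_add_eq_of_isCompl hq
  rw [Nat.card_congr (p.isComplEquivProj.trans e), natCard_eq_two_pow_finrank,
    finrank_linearMap, hp]
  congr 1
  omega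

lemma natCard_sup_span_singleton_eq {T : Submodule (ZMod 2) E} {w : E} (hw : w ≠ 0) (hT : w ∈ T)
    {n : ℕ} (hn : finrank (ZMod 2) T = n + 1) :
    Nat.card {V : Submodule (ZMod 2) E // V ⊔ Submodule.span (ZMod 2) {w} = T ∧ w ∉ V} =
      2 ^ n := by
  have hw' : (⟨w, hT⟩ : T) ≠ 0 := fun h => hw (congrArg Subtype.val h)
  rw [← natCard_isCompl_of_finrank_eq_one (finrank_span_singleton hw') hn]
  have hmap : (Submodule.span (ZMod 2) {(⟨w, hT⟩ : T)}).map T.subtype =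
      Submodule.span (ZMod 2) {w} := by
    rw [Submodule.map_span, Set.image_singleton]; rfl
  refine Nat.card_congr ?_
  have key : ∀ V : Set.Iic T, IsCompl (Submodule.span (ZMod 2) {(⟨w, hT⟩ : T)})
      (T.mapIic.symm V) ↔ (V : Submodule (ZMod 2) E) ⊔ Submodule.span (ZMod 2) {w} = T ∧
        w ∉ (V : Submodule (ZMod 2) E) := by
    intro V
    rw [T.mapIic.isCompl_iff, OrderIso.apply_symm_apply, Set.Iic.isCompl_iff,
      Submodule.coe_mapIic_apply, hmap, and_comm, sup_comm, disjoint_comm,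
      Submodule.disjoint_span_singleton' hw]
  exact (Equiv.subtypeSubtypeEquivSubtype (p := fun V => V ∈ Set.Iic T)
    fun h => le_sup_left.trans h.1.le).symm.trans
      (T.mapIic.symm.toEquiv.subtypeEquiv fun V => (key V).symm)

open scoped Classical in
/-- The defining property of the Möbius function of the lattice of subspaces. -/
lemma sum_subspaceMoebius_le [Fintype (Submodule (ZMod 2) E)] (W : Submodule (ZMod 2) E) :
    ∑ V with V ≤ W, subspaceMoebius V = if W = ⊥ then 1 else 0 := by
  split_ifs with hW
  · subst hW
    simp [Finset.filter_eq', subspaceMoebius]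
  obtain ⟨w, hwW, hw⟩ := Submodule.exists_mem_ne_zero_of_ne_bot hW
  rw [← Finset.sum_fiberwise_of_maps_to (t := Finset.univ)
    (g := fun V => V ⊔ Submodule.span (ZMod 2) {w}) (fun _ _ => Finset.mem_univ _)]
  refine Finset.sum_eq_zero fun T _ => ?_
  rw [Finset.filter_filter]
  by_cases hT : w ∈ T ∧ T ≤ W
  swap
  · refine Finset.sum_eq_zero fun V hV => absurd ?_ hT
    obtain ⟨hVW, rfl⟩ := (Finset.mem_filter.mp hV).2
    exact ⟨Submodule.mem_sup_right (Submodule.mem_span_singleton_self w),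
      sup_le hVW (by simpa using hwW)⟩
  obtain ⟨hwT, hTW⟩ := hT
  obtain ⟨n, hn⟩ : ∃ n, finrank (ZMod 2) T = n + 1 := by
    refine Nat.exists_eq_succ_of_ne_zero fun h => hw ?_
    rw [Submodule.finrank_eq_zero] at h
    simpa [h] using hwT
  rw [← Finset.sum_filter_add_sum_filter_not _ (fun V => w ∈ V), Finset.filter_filter,
    Finset.filter_filter]
  have h1 : (Finset.univ.filter fun V : Submodule (ZMod 2) E =>
      (V ≤ W ∧ V ⊔ Submodule.span (ZMod 2) {w} = T) ∧ w ∈ V) = {T} := by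
    ext V
    simp only [Finset.mem_filter, Finset.mem_univ, true_and, Finset.mem_singleton]
    constructor
    · rintro ⟨⟨_, rfl⟩, hV⟩
      simpa using hV
    · rintro rfl
      exact ⟨⟨hTW, by simpa using hwT⟩, hwT⟩
  have h2 : (Finset.univ.filter fun V : Submodule (ZMod 2) E =>
      (V ≤ W ∧ V ⊔ Submodule.span (ZMod 2) {w} = T) ∧ w ∉ V).card = 2 ^ n := by
    rw [← natCard_sup_span_singleton_eq hw hwT hn, Nat.card_eq_fintype_card,
      Fintype.card_subtype]
    congr 1
    ext V
    simp only [Finset.mem_filter, Finset.mem_univ, true_and]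
    exact ⟨fun h => ⟨h.1.2, h.2⟩, fun h => ⟨⟨(le_sup_left.trans h.1.le).trans hTW, h.1⟩, h.2⟩⟩
  rw [h1, Finset.sum_singleton, Finset.sum_congr rfl (g := fun _ => (-1 : ℂ) ^ n * 2 ^ n.choose 2),
    Finset.sum_const, h2, subspaceMoebius, hn, Nat.choose_succ_succ' n 1, Nat.choose_one_right,
    nsmul_eq_mul]
  · push_cast
    ring
  · intro V hV
    obtain ⟨⟨_, hV⟩, hwV⟩ := (Finset.mem_filter.mp hV).2
    have hdisj : V ⊓ Submodule.span (ZMod 2) {w} = ⊥ := by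
      rw [← disjoint_iff]
      exact (Submodule.disjoint_span_singleton' hw).mpr hwV
    have := Submodule.finrank_sup_add_finrank_inf_eq V (Submodule.span (ZMod 2) {w})
    rw [hdisj, hV, hn, finrank_span_singleton hw, finrank_bot] at this
    rw [subspaceMoebius, show finrank (ZMod 2) V = n by omega]

/-- A function on a finite poset is determined by its sums over lower sets `Iic x`. -/
lemma eq_of_sum_le_eq {P M : Type*} [PartialOrder P] [DecidableLE P] [Fintype P]
    [AddCommGroup M] {f h : P → M}
    (H : ∀ x, ∑ y with y ≤ x, f y = ∑ y with y ≤ x, h y) : f = h := by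
  classical
  funext x
  induction x using WellFoundedLT.induction with
  | ind x ih =>
    have hx := H x
    have hmem : x ∈ Finset.univ.filter (· ≤ x) := by simp
    rw [← Finset.add_sum_erase _ _ hmem, ← Finset.add_sum_erase _ h hmem,
      Finset.sum_congr rfl (g := h)] at hx
    · exact add_right_cancel hx
    · intro y hy
      obtain ⟨hne, hy⟩ := Finset.mem_erase.mp hy
      exact ih y (lt_of_le_of_ne (Finset.mem_filter.mp hy).2 hne)

open scoped Classical in
/-- In a product `E ≃ E₁ × E₂`, the Möbius weights of the subspaces with prescribed projections
add up to the product of the Möbius weights of the projections. -/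
lemma sum_subspaceMoebius_map_eq [Finite E₁] [Finite E₂] [Fintype (Submodule (ZMod 2) E)]
    {p₁ : E →ₗ[ZMod 2] E₁} {p₂ : E →ₗ[ZMod 2] E₂}
    (hp : Function.Bijective (p₁.prod p₂))
    (A : Submodule (ZMod 2) E₁) (B : Submodule (ZMod 2) E₂) :
    ∑ V with V.map p₁ = A ∧ V.map p₂ = B, subspaceMoebius V =
      subspaceMoebius A * subspaceMoebius B := by
  have := Fintype.ofFinite (Submodule (ZMod 2) E₁)
  have := Fintype.ofFinite (Submodule (ZMod 2) E₂)
  suffices h : (fun x : Submodule (ZMod 2) E₁ × Submodule (ZMod 2) E₂ =>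
      ∑ V with V.map p₁ = x.1 ∧ V.map p₂ = x.2, subspaceMoebius V) =
      fun x => subspaceMoebius x.1 * subspaceMoebius x.2 from congrFun h (A, B)
  refine eq_of_sum_le_eq fun ⟨A, B⟩ => ?_
  have hfilter : (Finset.univ.filter fun y : Submodule (ZMod 2) E₁ × Submodule (ZMod 2) E₂ =>
      y ≤ (A, B)) = (Finset.univ.filter (· ≤ A)) ×ˢ (Finset.univ.filter (· ≤ B)) := by
    ext; simp [Prod.le_def]
  have hright : ∑ y with y ≤ (A, B), subspaceMoebius y.1 * subspaceMoebius y.2 =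
      (if A = ⊥ then 1 else 0) * (if B = ⊥ then 1 else 0) := by
    rw [hfilter, ← sum_subspaceMoebius_le A, ← sum_subspaceMoebius_le B,
      Finset.sum_mul_sum, Finset.sum_product]
  have hbot : A.comap p₁ ⊓ B.comap p₂ = ⊥ ↔ A = ⊥ ∧ B = ⊥ := by
    simp only [Submodule.eq_bot_iff, Submodule.mem_inf, Submodule.mem_comap]
    constructor
    · refine fun h => ⟨fun a ha => ?_, fun b hb => ?_⟩
      · obtain ⟨x, hx⟩ := hp.2 (a, 0)
        obtain ⟨rfl, hx₂⟩ := Prod.ext_iff.mp hx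
        have hx₂ : p₂ x = 0 := hx₂
        simp [h x ⟨ha, by simp [hx₂]⟩]
      · obtain ⟨x, hx⟩ := hp.2 (0, b)
        obtain ⟨hx₁, rfl⟩ := Prod.ext_iff.mp hx
        have hx₁ : p₁ x = 0 := hx₁
        simp [h x ⟨by simp [hx₁], hb⟩]
    · rintro ⟨hA, hB⟩ x ⟨hxA, hxB⟩
      exact hp.1 (by simp [hA _ hxA, hB _ hxB])
  rw [hright, ite_zero_mul_ite_zero, mul_one, ← if_congr hbot rfl rfl, ← sum_subspaceMoebius_le,
    ← Finset.sum_fiberwise_of_maps_to (t := Finset.univ.filter (· ≤ (A, B)))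
      (g := fun V : Submodule (ZMod 2) E => (V.map p₁, V.map p₂))]
  · refine Finset.sum_congr rfl fun y hy => ?_
    have hy := Prod.le_def.mp (Finset.mem_filter.mp hy).2
    rw [Finset.filter_filter]
    refine Finset.sum_congr (Finset.filter_congr fun V _ => ?_) fun _ _ => rfl
    rw [le_inf_iff, ← Submodule.map_le_iff_le_comap, ← Submodule.map_le_iff_le_comap,
      Prod.ext_iff]
    exact ⟨fun h => ⟨⟨h.1.le.trans hy.1, h.2.le.trans hy.2⟩, h⟩, fun h => h.2⟩
  · intro V hV
    simpa [Prod.le_def, Submodule.map_le_iff_le_comap] using hV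

lemma prod_comp_eq_prod_map_pow (p : E →ₗ[ZMod 2] E₁) (V : Submodule (ZMod 2) E)
    [Fintype V] [Fintype (V.map p)] (f : E₁ → ℂ) :
    ∃ d, finrank (ZMod 2) (V.map p) + d = finrank (ZMod 2) V ∧
      ∏ v : V, f (p v) = (∏ u : V.map p, f u) ^ 2 ^ d := by
  classical
  let r : V →ₗ[ZMod 2] V.map p := p.submoduleMap V
  have hr : Function.Surjective r := p.submoduleMap_surjective V
  refine ⟨finrank (ZMod 2) (LinearMap.ker r), ?_, ?_⟩
  · rw [← LinearMap.finrank_range_add_finrank_ker r, LinearMap.range_eq_top.mpr hr, finrank_top]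
  · have hker : (Finset.univ.filter fun v => r v = 0).card =
        2 ^ finrank (ZMod 2) (LinearMap.ker r) := by
      rw [← natCard_eq_two_pow_finrank, Nat.card_eq_fintype_card, Fintype.card_subtype]
      simp only [LinearMap.mem_ker]
    have := Finset.prod_comp (s := Finset.univ) (fun u : V.map p => f u) r
    rw [Finset.image_univ_of_surjective hr] at this
    rw [← Finset.prod_pow]
    refine this.trans (Finset.prod_congr rfl fun u _ => ?_)
    rw [← hker, AddMonoidHom.card_fiber_eq_of_mem_range r (hr u) (hr 0)]

/-- The term `(∏ v ∈ V, f v) ^ 2 ^ (4 - dim V)` attached to a subspace `V`. -/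
def subspaceTerm (f : E → ℂ) (V : Submodule (ZMod 2) E) : ℂ :=
  (∏ v ∈ (V : Set E).toFinite.toFinset, f v) ^ 2 ^ (4 - finrank (ZMod 2) V)

lemma subspaceTerm_eq_zero {f : E → ℂ} {V : Submodule (ZMod 2) E} {v : E} (hv : v ∈ V)
    (hf : f v = 0) : subspaceTerm f V = 0 := by
  rw [subspaceTerm, Finset.prod_eq_zero (by simpa using hv) hf, zero_pow (by positivity)]

lemma subspaceTerm_mul (f h : E → ℂ) (V : Submodule (ZMod 2) E) :
    subspaceTerm (fun v => f v * h v) V = subspaceTerm f V * subspaceTerm h V := by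
  rw [subspaceTerm, Finset.prod_mul_distrib, mul_pow, subspaceTerm, subspaceTerm]

lemma subspaceTerm_comp [Finite E₁] (p : E →ₗ[ZMod 2] E₁) (f : E₁ → ℂ) {V : Submodule (ZMod 2) E}
    (hV : finrank (ZMod 2) V ≤ 4) :
    subspaceTerm (fun v => f (p v)) V = subspaceTerm f (V.map p) := by
  have := Fintype.ofFinite V
  have := Fintype.ofFinite (V.map p)
  obtain ⟨d, hd, h⟩ := prod_comp_eq_prod_map_pow p V f
  rw [subspaceTerm, subspaceTerm, Finset.prod_subtype (p := fun v => v ∈ V) _ (by simp),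
    Finset.prod_subtype (p := fun v => v ∈ V.map p) _ (by simp), h, ← pow_mul, ← pow_add]
  congr 2
  omega

lemma finrank_le_finrank_map_add_finrank_map {p₁ : E →ₗ[ZMod 2] E₁} {p₂ : E →ₗ[ZMod 2] E₂}
    (hp : Function.Injective (p₁.prod p₂)) (V : Submodule (ZMod 2) E) :
    finrank (ZMod 2) V ≤ finrank (ZMod 2) (V.map p₁) + finrank (ZMod 2) (V.map p₂) := by
  rw [← finrank_prod]
  refine LinearMap.finrank_le_finrank_of_injective
    (f := (p₁.submoduleMap V).prod (p₂.submoduleMap V)) fun x y h => ?_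
  obtain ⟨h₁, h₂⟩ := Prod.ext_iff.mp h
  exact Subtype.ext (hp (Prod.ext (congrArg Subtype.val h₁) (congrArg Subtype.val h₂)))

/-- Möbius-weighted sums over subspaces are multiplicative, for functions having a zero on every
subspace of large dimension. -/
theorem sum_subspaceMoebius_mul_subspaceTerm [Finite E₁] [Finite E₂]
    [Fintype (Submodule (ZMod 2) E)]
    [Fintype (Submodule (ZMod 2) E₁)] [Fintype (Submodule (ZMod 2) E₂)]
    {p₁ : E →ₗ[ZMod 2] E₁} {p₂ : E →ₗ[ZMod 2] E₂} (hp : Function.Bijective (p₁.prod p₂))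
    {f₁ : E₁ → ℂ} {f₂ : E₂ → ℂ} {k l : ℕ} (hkl : k + l ≤ 4)
    (h₁ : ∀ A : Submodule (ZMod 2) E₁, k < finrank (ZMod 2) A → ∃ v ∈ A, f₁ v = 0)
    (h₂ : ∀ B : Submodule (ZMod 2) E₂, l < finrank (ZMod 2) B → ∃ v ∈ B, f₂ v = 0) :
    ∑ V, subspaceMoebius V * subspaceTerm (fun v => f₁ (p₁ v) * f₂ (p₂ v)) V =
      (∑ A, subspaceMoebius A * subspaceTerm f₁ A) *
        ∑ B, subspaceMoebius B * subspaceTerm f₂ B := by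
  classical
  have hterm : ∀ V : Submodule (ZMod 2) E, subspaceTerm (fun v => f₁ (p₁ v) * f₂ (p₂ v)) V =
      subspaceTerm f₁ (V.map p₁) * subspaceTerm f₂ (V.map p₂) := by
    intro V
    by_cases hA : k < finrank (ZMod 2) (V.map p₁)
    · obtain ⟨_, ⟨v, hv, rfl⟩, hf⟩ := h₁ _ hA
      rw [subspaceTerm_eq_zero hv (by simp [hf]),
        subspaceTerm_eq_zero (Submodule.mem_map_of_mem hv) hf, zero_mul]
    by_cases hB : l < finrank (ZMod 2) (V.map p₂)
    · obtain ⟨_, ⟨v, hv, rfl⟩, hf⟩ := h₂ _ hB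
      rw [subspaceTerm_eq_zero hv (by simp [hf]),
        subspaceTerm_eq_zero (Submodule.mem_map_of_mem hv) hf, mul_zero]
    have hV := finrank_le_finrank_map_add_finrank_map hp.1 V
    rw [subspaceTerm_mul, subspaceTerm_comp p₁ f₁ (by omega), subspaceTerm_comp p₂ f₂ (by omega)]
  rw [Finset.sum_mul_sum, ← Finset.sum_product', Finset.univ_product_univ,
    ← Finset.sum_fiberwise_of_maps_to (t := Finset.univ)
      (g := fun V : Submodule (ZMod 2) E => (V.map p₁, V.map p₂)) (fun _ _ => Finset.mem_univ _)]
  refine Finset.sum_congr rfl fun ⟨A, B⟩ _ => ?_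
  rw [mul_mul_mul_comm, ← sum_subspaceMoebius_map_eq hp, Finset.sum_mul]
  simp only [Prod.mk.injEq]
  refine Finset.sum_congr (by congr) fun V hV => ?_
  obtain ⟨rfl, rfl⟩ := (Finset.mem_filter.mp hV).2
  rw [hterm]

end SubspaceSums

section ThetaConstants

variable {ι κ : Type} [Fintype ι] [Fintype κ]

/-- The parity form `∑ i, εᵢ δᵢ` of a characteristic, with values in `𝔽₂`. -/
def charParity (m : Char2 ι) : ZMod 2 := ∑ i, m.1 i * m.2 i

/-- Odd theta constants vanish. -/
lemma thetaConst_eq_zero_of_odd {m : Char2 ι} (hm : charParity m = 1) (τ : Matrix ι ι ℂ) :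
    thetaConst m τ = 0 := by
  let refl : (ι → ℤ) ≃ (ι → ℤ) :=
    (Equiv.neg _).trans (Equiv.subRight fun i => ((m.1 i).val : ℤ))
  suffices h : thetaConst m τ = -thetaConst m τ from self_eq_neg.mp h
  obtain ⟨c, hc⟩ : ∃ c : ℤ, ∑ i, ((m.1 i).val : ℤ) * ((m.2 i).val : ℤ) = 2 * c + 1 := by
    have : ((∑ i, ((m.1 i).val : ℤ) * ((m.2 i).val : ℤ) : ℤ) : ZMod 2) = 1 := by
      rw [← hm, charParity]
      push_cast
      simp
    exact (ZMod.intCast_eq_one_iff_odd).mp this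
  have hc' : ∑ i, ((m.1 i).val : ℂ) * ((m.2 i).val : ℂ) = 2 * c + 1 := by exact_mod_cast hc
  unfold thetaConst thetaChar theta
  rw [← tsum_neg, ← refl.tsum_eq]
  refine tsum_congr fun n => ?_
  have hquad : ∀ i, ((refl n i : ℤ) : ℂ) + ((m.1 i).val : ℂ) / 2 =
      -((n i : ℂ) + ((m.1 i).val : ℂ) / 2) := by
    intro i
    simp [refl]
    ring
  have hlin : (2 : ℂ) * ∑ i, -((n i : ℂ) + ((m.1 i).val : ℂ) / 2) *
      ((0 : ι → ℂ) i + ((m.2 i).val : ℂ) / 2) =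
      2 * ∑ i, ((n i : ℂ) + ((m.1 i).val : ℂ) / 2) * ((0 : ι → ℂ) i + ((m.2 i).val : ℂ) / 2)
        + (2 * (-(∑ i, n i * ((m.2 i).val : ℤ)) - c - 1 : ℤ) + 1) := by
    have : (2 : ℂ) * (-(∑ i, (n i : ℂ) * ((m.2 i).val : ℂ)) - c - 1) + 1 =
        -∑ i, (2 * ((n i : ℂ) * ((m.2 i).val : ℂ)) + ((m.1 i).val : ℂ) * ((m.2 i).val : ℂ)) := by
      rw [Finset.sum_add_distrib, hc', ← Finset.mul_sum]
      ring
    push_cast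
    rw [this, Finset.mul_sum, Finset.mul_sum, ← sub_eq_add_neg, ← Finset.sum_sub_distrib]
    refine Finset.sum_congr rfl fun i _ => ?_
    simp only [Pi.zero_apply]
    ring
  simp only [hquad, neg_mul, mul_neg, neg_neg] at hlin ⊢
  rw [hlin, ← add_assoc, mul_add, Complex.exp_add]
  have : ∀ N : ℤ, Complex.exp ((Real.pi : ℂ) * Complex.I * (2 * (N : ℂ) + 1)) = -1 := by
    intro N
    rw [show (Real.pi : ℂ) * Complex.I * (2 * (N : ℂ) + 1) =
      N * (2 * Real.pi * Complex.I) + Real.pi * Complex.I by ring, Complex.exp_add,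
      Complex.exp_int_mul_two_pi_mul_I, Complex.exp_pi_mul_I, one_mul]
  rw [this, mul_neg_one]

/-- The symplectic form polar to `charParity`. -/
def charPolar (ι : Type) [Fintype ι] : LinearMap.BilinForm (ZMod 2) (Char2 ι) :=
  LinearMap.mk₂ (ZMod 2) (fun m n => ∑ i, (m.1 i * n.2 i + n.1 i * m.2 i))
    (fun _ _ _ => by simp only [← Finset.sum_add_distrib]; congr; ext; simp; ring)
    (fun _ _ _ => by simp only [Finset.smul_sum]; congr; ext; simp; ring)
    (fun _ _ _ => by simp only [← Finset.sum_add_distrib]; congr; ext; simp; ring)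
    (fun _ _ _ => by simp only [Finset.smul_sum]; congr; ext; simp; ring)

lemma charParity_add (m n : Char2 ι) :
    charParity (m + n) = charParity m + charParity n + charPolar ι m n := by
  simp only [charParity, charPolar, LinearMap.mk₂_apply, ← Finset.sum_add_distrib]
  congr
  ext
  simp
  ring

lemma ker_charPolar : LinearMap.ker (charPolar ι) = ⊥ := by
  classical
  refine (Submodule.eq_bot_iff _).mpr fun m hm => ?_
  have h : ∀ n, charPolar ι m n = 0 := fun n => LinearMap.congr_fun hm n
  simp only [charPolar, LinearMap.mk₂_apply] at h
  ext i
  · simpa [Pi.single_apply] using h (0, Pi.single i 1)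
  · simpa [Pi.single_apply] using h (Pi.single i 1, 0)

/-- A subspace of dimension larger than `g` contains an odd characteristic. -/
lemma exists_mem_charParity_eq_one (V : Submodule (ZMod 2) (Char2 ι))
    (hV : Fintype.card ι < Module.finrank (ZMod 2) V) : ∃ v ∈ V, charParity v = 1 := by
  by_contra! h
  have h0 : ∀ v ∈ V, charParity v = 0 := fun v hv =>
    (Fin.exists_fin_two.mp ⟨charParity v, rfl⟩).elim id fun h1 => absurd h1 (h v hv)
  have hle : V ≤ (charPolar ι).orthogonal V := by
    intro v hv u hu
    have := charParity_add u v
    rw [h0 _ (V.add_mem hu hv), h0 u hu, h0 v hv, zero_add, zero_add] at this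
    exact this.symm
  have hdim := LinearMap.BilinForm.finrank_add_finrank_orthogonal' (B := charPolar ι) V
  rw [ker_charPolar, inf_bot_eq, finrank_bot, Module.finrank_prod,
    Module.finrank_fintype_fun_eq_card] at hdim
  have := Submodule.finrank_mono hle
  omega

/-- Fubini for `tsum` of a product of nowhere vanishing functions, without summability
assumptions. -/
lemma tsum_mul_tsum_of_ne_zero {α β : Type*} [Nonempty α] [Nonempty β] {f : α → ℂ} {h : β → ℂ}
    (hf : ∀ a, f a ≠ 0) (hh : ∀ b, h b ≠ 0) :
    ∑' x : α × β, f x.1 * h x.2 = (∑' a, f a) * ∑' b, h b := by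
  by_cases hfs : Summable f
  · by_cases hhs : Summable h
    · exact (tsum_mul_tsum_of_summable_norm hfs.norm hhs.norm).symm
    · rw [tsum_eq_zero_of_not_summable hhs, mul_zero, tsum_eq_zero_of_not_summable]
      intro hs
      obtain ⟨a⟩ := ‹Nonempty α›
      have hslice : Summable fun b => f a * h b :=
        hs.comp_injective (i := fun b => (a, b)) fun _ _ e => (Prod.ext_iff.mp e).2
      exact hhs ((summable_mul_left_iff (hf a)).mp hslice)
  · rw [tsum_eq_zero_of_not_summable hfs, zero_mul, tsum_eq_zero_of_not_summable]
    intro hs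
    obtain ⟨b⟩ := ‹Nonempty β›
    have hslice : Summable fun a => f a * h b :=
      hs.comp_injective (i := fun a => (a, b)) fun _ _ e => (Prod.ext_iff.mp e).1
    exact hfs ((summable_mul_right_iff (hh b)).mp hslice)

/-- Restriction of characteristics along a map of index types. -/
def charRestrict {ι κ : Type} (r : ι → κ) : Char2 κ →ₗ[ZMod 2] Char2 ι :=
  (LinearMap.funLeft (ZMod 2) (ZMod 2) r).prodMap (LinearMap.funLeft (ZMod 2) (ZMod 2) r)

lemma charRestrict_inl_prod_inr_bijective {ι κ : Type} :
    Function.Bijective ((charRestrict (Sum.inl : ι → ι ⊕ κ)).prod (charRestrict Sum.inr)) := by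
  constructor
  · rintro x y h
    simp only [charRestrict, LinearMap.prod_apply, Prod.ext_iff, funext_iff] at h
    ext i <;> rcases i with i | i
    exacts [h.1.1 i, h.2.1 i, h.1.2 i, h.2.2 i]
  · exact fun y => ⟨(Sum.elim y.1.1 y.2.1, Sum.elim y.1.2 y.2.2), rfl⟩

/-- Theta constants factorize on block-diagonal period matrices. -/
lemma thetaConst_fromBlocks (m : Char2 (ι ⊕ κ)) (τ₁ : Matrix ι ι ℂ) (τ₂ : Matrix κ κ ℂ) :
    thetaConst m (Matrix.fromBlocks τ₁ 0 0 τ₂) =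
      thetaConst (charRestrict Sum.inl m) τ₁ * thetaConst (charRestrict Sum.inr m) τ₂ := by
  unfold thetaConst thetaChar theta
  rw [← tsum_mul_tsum_of_ne_zero (fun _ => Complex.exp_ne_zero _) (fun _ => Complex.exp_ne_zero _),
    ← (Equiv.sumArrowEquivProdArrow ι κ ℤ).tsum_eq]
  refine tsum_congr fun n => ?_
  rw [← Complex.exp_add]
  congr 1
  simp [charRestrict, Fintype.sum_sum_type, LinearMap.funLeft_apply, Equiv.sumArrowEquivProdArrow]
  ring

lemma Pform_eq_sum_subspaceTerm (i : ℕ) (τ : Matrix ι ι ℂ)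
    [Fintype (Submodule (ZMod 2) (Char2 ι))] :
    Pform ι i (2 ^ (4 - i)) τ =
      ∑ V ∈ Finset.univ.filter
        fun V : Submodule (ZMod 2) (Char2 ι) => Module.finrank (ZMod 2) V = i,
        subspaceTerm (fun m => thetaConst m τ) V := by
  classical
  symm
  unfold Pform
  refine Finset.sum_bij (fun V _ => (V : Set (Char2 ι)).toFinite.toFinset) ?_ ?_ ?_ ?_
  · intro V hV
    exact Finset.mem_filter.mpr
      ⟨Finset.mem_univ _, V, (Finset.mem_filter.mp hV).2, Set.Finite.coe_toFinset _⟩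
  · intro V _ W _ h
    exact SetLike.coe_injective (Set.Finite.toFinset_inj.mp h)
  · intro W hW
    obtain ⟨V, hV, hWV⟩ := (Finset.mem_filter.mp hW).2
    exact ⟨V, by simpa using hV, Finset.coe_injective (by rw [Set.Finite.coe_toFinset, hWV])⟩
  · intro V hV
    rw [subspaceTerm, (Finset.mem_filter.mp hV).2]

lemma XiZero_eq_sum_subspaceMoebius (τ : Matrix ι ι ℂ)
    [Fintype (Submodule (ZMod 2) (Char2 ι))] :
    XiZero ι τ = (2 : ℂ)⁻¹ ^ Fintype.card ι * ∑ V : Submodule (ZMod 2) (Char2 ι),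
      subspaceMoebius V * subspaceTerm (fun m => thetaConst m τ) V := by
  unfold XiZero
  congr 1
  simp only [Pform_eq_sum_subspaceTerm, Finset.mul_sum, Finset.sum_filter, mul_ite, mul_zero]
  rw [Finset.sum_comm]
  refine Finset.sum_congr rfl fun V _ => ?_
  rw [Finset.sum_ite_eq]
  split_ifs with hV
  · rw [subspaceMoebius, Nat.choose_two_right]
  · obtain ⟨v, hv, hodd⟩ := exists_mem_charParity_eq_one V (by simpa using hV)
    rw [subspaceTerm_eq_zero hv (thetaConst_eq_zero_of_odd hodd τ), mul_zero]

end ThetaConstants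

/-- For `2 ≤ g ≤ 4`, `Ξ^{(g)}[0]` factorizes on block-diagonal period matrices. -/
theorem XiZero_factorization (g k : ℕ) (hg2 : 2 ≤ g) (hg4 : g ≤ 4)
    (hk : 1 ≤ k) (hk' : k ≤ g - 1)
    (τ₁ : Matrix (Fin k) (Fin k) ℂ) (hτ₁ : τ₁ ∈ Siegel (Fin k))
    (τ₂ : Matrix (Fin (g - k)) (Fin (g - k)) ℂ) (hτ₂ : τ₂ ∈ Siegel (Fin (g - k))) :
    XiZero (Fin k ⊕ Fin (g - k)) (Matrix.fromBlocks τ₁ 0 0 τ₂) =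
      XiZero (Fin k) τ₁ * XiZero (Fin (g - k)) τ₂ := by
  have := Fintype.ofFinite (Submodule (ZMod 2) (Char2 (Fin k ⊕ Fin (g - k))))
  have := Fintype.ofFinite (Submodule (ZMod 2) (Char2 (Fin k)))
  have := Fintype.ofFinite (Submodule (ZMod 2) (Char2 (Fin (g - k))))
  have vanish : ∀ (n : ℕ) (τ : Matrix (Fin n) (Fin n) ℂ)
      (A : Submodule (ZMod 2) (Char2 (Fin n))), n < Module.finrank (ZMod 2) A →
        ∃ v ∈ A, thetaConst v τ = 0 := fun n τ A hA =>
    have ⟨v, hv, hodd⟩ := exists_mem_charParity_eq_one A (by simpa using hA)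
    ⟨v, hv, thetaConst_eq_zero_of_odd hodd τ⟩
  simp only [XiZero_eq_sum_subspaceMoebius, thetaConst_fromBlocks, Fintype.card_sum]
  rw [sum_subspaceMoebius_mul_subspaceTerm charRestrict_inl_prod_inr_bijective
    (f₁ := fun m => thetaConst m τ₁) (f₂ := fun m => thetaConst m τ₂) (by omega)
    (vanish k τ₁) (vanish (g - k) τ₂), pow_add]
  ring
end
end

section
/- For every g ∈ {1, 2, 3} and every τ ∈ ℍ_g, the modular form F_g vanishes identically: 2^g·Σ_{m∈𝔽₂^{2g}} θ_m(τ)^{16} = (Σ_{m∈𝔽₂^{2g}} θ_m(τ)⁸)². -/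
open scoped BigOperators

noncomputable section

/-- The modular form `F_g(τ) = 2^g·Σ_m θ_m(τ)^{16} − (Σ_m θ_m(τ)^8)²`. -/
noncomputable def Fmod (ι : Type) [Fintype ι] [DecidableEq ι] (τ : Matrix ι ι ℂ) : ℂ :=
  2 ^ (Fintype.card ι) * ∑ m : Char2 ι, thetaConst m τ ^ 16 -
    (∑ m : Char2 ι, thetaConst m τ ^ 8) ^ 2

section Convergence

theorem summable_exp_neg_shift_sq {T : ℝ} (hT : 0 < T) (h : ℝ) :
    Summable fun n : ℤ => Real.exp (-Real.pi * (T * (n + h) ^ 2)) := by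
  refine Summable.of_nonneg_of_le (fun _ => (Real.exp_pos _).le) (fun n => ?_)
    (summable_pow_mul_jacobiTheta₂_term_bound (T * |h|) hT 0)
  rw [pow_zero, one_mul, Real.exp_le_exp]
  have hn : -(|h| * |(n : ℝ)|) ≤ n * h := by
    rw [mul_comm |h|, ← abs_mul]
    exact neg_abs_le _
  have : T * n ^ 2 - 2 * (T * |h|) * |(n : ℝ)| ≤ T * (n + h) ^ 2 := by
    nlinarith [mul_le_mul_of_nonneg_left hn hT.le, mul_nonneg hT.le (sq_nonneg h)]
  rw [Int.cast_abs]
  nlinarith [mul_le_mul_of_nonneg_left this Real.pi_pos.le]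

theorem summable_prod_pi {ι κ : Type*} [Fintype ι] {f : ι → κ → ℝ} (h0 : ∀ i n, 0 ≤ f i n)
    (hf : ∀ i, Summable (f i)) : Summable fun n : ι → κ => ∏ i, f i (n i) := by
  classical
  refine summable_of_sum_le (c := ∏ i, ∑' n, f i n)
    (fun n => Finset.prod_nonneg fun i _ => h0 i _) fun s => ?_
  calc ∑ n ∈ s, ∏ i, f i (n i)
      ≤ ∑ n ∈ Fintype.piFinset fun i => s.image fun n => n i, ∏ i, f i (n i) :=
        Finset.sum_le_sum_of_subset_of_nonneg
          (fun n hn => Fintype.mem_piFinset.2 fun i => Finset.mem_image_of_mem (fun n => n i) hn)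
          fun n _ _ => Finset.prod_nonneg fun i _ => h0 i _
    _ = ∏ i, ∑ k ∈ s.image fun n => n i, f i k := (Finset.prod_univ_sum _ _).symm
    _ ≤ ∏ i, ∑' n, f i n :=
        Finset.prod_le_prod (fun i _ => Finset.sum_nonneg fun k _ => h0 i k)
          fun i _ => (hf i).sum_le_tsum _ fun k _ => h0 i k

theorem exists_pos_mul_sum_sq_le {ι : Type*} [Fintype ι] (M : ι → ι → ℝ)
    (hM : ∀ v : ι → ℝ, v ≠ 0 → 0 < ∑ i, ∑ j, v i * M i j * v j) :
    ∃ m > 0, ∀ v : ι → ℝ, m * ∑ i, v i ^ 2 ≤ ∑ i, ∑ j, v i * M i j * v j := by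
  rcases isEmpty_or_nonempty ι with hι | ⟨⟨i₀⟩⟩
  · exact ⟨1, one_pos, fun v => by simp⟩
  classical
  set S : Set (EuclideanSpace ℝ ι) := Metric.sphere 0 1
  have hne : S.Nonempty := ⟨EuclideanSpace.single i₀ 1, by simp [S]⟩
  obtain ⟨x, hxS, hx⟩ := (isCompact_sphere (0 : EuclideanSpace ℝ ι) 1).exists_isMinOn hne
    (f := fun v => ∑ i, ∑ j, v i * M i j * v j) (by fun_prop)
  have hx0 : (x : ι → ℝ) ≠ 0 := by
    intro h
    have : x = 0 := by ext i; exact congrFun h i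
    simp [this] at hxS
  refine ⟨_, hM x hx0, fun v => ?_⟩
  rcases eq_or_ne v 0 with rfl | hv
  · simp
  set w : EuclideanSpace ℝ ι := WithLp.toLp 2 v
  have hw : w ≠ 0 := fun h => hv (by simpa [w] using congrArg WithLp.ofLp h)
  have hw' : 0 < ‖w‖ := norm_pos_iff.2 hw
  have hmem : (‖w‖⁻¹ • w) ∈ S := by simp [S, norm_smul, hw'.ne']
  have hmin := hx hmem
  simp only [Set.mem_ofPred_eq, PiLp.smul_apply, smul_eq_mul] at hmin
  have hsum : ∑ i, ∑ j, ‖w‖⁻¹ * w i * M i j * (‖w‖⁻¹ * w j) =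
      (‖w‖ ^ 2)⁻¹ * ∑ i, ∑ j, v i * M i j * v j := by
    simp only [Finset.mul_sum]
    refine Finset.sum_congr rfl fun i _ => Finset.sum_congr rfl fun j _ => ?_
    simp only [w, ← inv_pow]
    ring
  have hnorm : ∑ i, v i ^ 2 = ‖w‖ ^ 2 := by
    simp [EuclideanSpace.norm_sq_eq, w]
  rw [hsum] at hmin
  rw [hnorm]
  calc _ ≤ ((‖w‖ ^ 2)⁻¹ * ∑ i, ∑ j, v i * M i j * v j) * ‖w‖ ^ 2 := by gcongr
    _ = _ := by field_simp

variable {ι : Type} [Fintype ι]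

/-- The quadratic form of the matrix `τ`. -/
def quadForm (τ : Matrix ι ι ℂ) (x : ι → ℂ) : ℂ := ∑ i, ∑ j, x i * τ i j * x j

/-- The point `n + ε/2` of the shifted lattice. -/
def shifted (n : ι → ℤ) (ε : ι → ZMod 2) (i : ι) : ℂ := (n i : ℂ) + ((ε i).val : ℂ) / 2

theorem summable_norm_exp_quadForm {τ : Matrix ι ι ℂ} (hτ : τ ∈ Siegel ι) (ε : ι → ZMod 2)
    {t : ℝ} (ht : 0 < t) (l : ι → ℝ) :
    Summable fun n : ι → ℤ => ‖Complex.exp (Real.pi * Complex.I *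
      (t * quadForm τ (shifted n ε) + ∑ i, shifted n ε i * l i))‖ := by
  obtain ⟨m, hm, hq⟩ := exists_pos_mul_sum_sq_le (fun i j => (τ i j).im) hτ.2
  refine Summable.of_nonneg_of_le (fun _ => norm_nonneg _) (fun n => ?_)
    (summable_prod_pi (fun i (n : ℤ) => (Real.exp_pos _).le)
      fun i => summable_exp_neg_shift_sq (mul_pos ht hm) ((ε i).val / 2 : ℝ))
  have hshift : shifted n ε = fun i => (((n i : ℝ) + (ε i).val / 2 : ℝ) : ℂ) := by
    ext i; simp only [shifted]; push_cast; rfl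
  rw [← Real.exp_sum, Complex.norm_exp, Real.exp_le_exp, hshift]
  have him : (t * quadForm τ (fun i => (((n i : ℝ) + (ε i).val / 2 : ℝ) : ℂ)) +
      ∑ i, (((n i : ℝ) + (ε i).val / 2 : ℝ) : ℂ) * l i).im =
      t * ∑ i, ∑ j, ((n i : ℝ) + (ε i).val / 2) * (τ i j).im * ((n j : ℝ) + (ε j).val / 2) := by
    rw [Complex.add_im, Complex.im_ofReal_mul, quadForm, Complex.im_sum, Complex.im_sum]
    simp only [Complex.im_sum, ← Complex.ofReal_mul, Complex.ofReal_im, Finset.sum_const_zero,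
      add_zero, Complex.im_mul_ofReal, Complex.im_ofReal_mul]
  rw [mul_assoc, Complex.re_ofReal_mul, Complex.I_mul_re, him, ← Finset.mul_sum, ← Finset.mul_sum]
  have := mul_le_mul_of_nonneg_left (hq fun i => (n i : ℝ) + (ε i).val / 2) ht.le
  nlinarith [mul_le_mul_of_nonneg_left this Real.pi_pos.le]

end Convergence

section Duplication

variable {ι : Type}

/-- The change of variables `(σ, k, l) ↦ (X + Y - ε/2, X - Y - ε/2)` for
`X = k + (σ + ε)/2`, `Y = l + σ/2`. -/
def doubling (ε : ι → ZMod 2) (x : (ι → ZMod 2) × (ι → ℤ) × (ι → ℤ)) : (ι → ℤ) × (ι → ℤ) :=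
  (fun i => x.2.1 i + x.2.2 i + (x.1 i).val - (x.1 i).val * (ε i).val,
    fun i => x.2.1 i - x.2.2 i - (x.1 i).val * (ε i).val)

theorem doubling_bijective (ε : ι → ZMod 2) : Function.Bijective (doubling ε) := by
  constructor
  · rintro ⟨σ, k, l⟩ ⟨σ', k', l'⟩ h
    have h1 i := congrFun (congrArg Prod.fst h) i
    have h2 i := congrFun (congrArg Prod.snd h) i
    simp only [doubling] at h1 h2
    have hv i : (σ i).val = (σ' i).val := by
      have := ZMod.val_lt (σ i)
      have := ZMod.val_lt (σ' i)
      have := h1 i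
      have := h2 i
      lia
    have hσ : σ = σ' := funext fun i => ZMod.val_injective 2 (hv i)
    subst hσ
    have hl : l = l' := funext fun i => by have := h1 i; have := h2 i; lia
    have hk : k = k' := funext fun i => by have := h1 i; have := h2 i; lia
    rw [hk, hl]
  · rintro ⟨p, q⟩
    have hs i : ((((p i - q i : ℤ) : ZMod 2).val : ℕ) : ℤ) = (p i - q i) % 2 := by
      rw [ZMod.val_intCast]; rfl
    refine ⟨(fun i => ((p i - q i : ℤ) : ZMod 2),
      fun i => q i + (p i - q i) / 2 + (p i - q i) % 2 * (ε i).val,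
      fun i => (p i - q i) / 2), ?_⟩
    have hd i := Int.emod_add_mul_ediv (p i - q i) 2
    simp only [doubling, hs]
    refine Prod.ext (funext fun i => ?_) (funext fun i => ?_)
    · simp only; linarith [hd i]
    · simp only; ring

theorem val_add_two (a b : ZMod 2) : ((a + b).val : ℂ) = a.val + b.val - 2 * (a.val * b.val) := by
  fin_cases a <;> fin_cases b <;> norm_num [ZMod.val] <;> rfl

theorem shifted_doubling_fst (ε σ : ι → ZMod 2) (k l : ι → ℤ) :
    shifted (doubling ε (σ, k, l)).1 ε = shifted k (σ + ε) + shifted l σ := by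
  ext i
  simp only [shifted, doubling, Pi.add_apply, val_add_two]
  push_cast
  ring

theorem shifted_doubling_snd (ε σ : ι → ZMod 2) (k l : ι → ℤ) :
    shifted (doubling ε (σ, k, l)).2 ε = shifted k (σ + ε) - shifted l σ := by
  ext i
  simp only [shifted, doubling, Pi.add_apply, Pi.sub_apply, val_add_two]
  push_cast
  ring

variable [Fintype ι]

theorem quadForm_add_quadForm_sub (τ : Matrix ι ι ℂ) (x y : ι → ℂ) :
    quadForm τ (x + y) + quadForm τ (x - y) = 2 * quadForm τ x + 2 * quadForm τ y := by
  simp only [quadForm, Finset.mul_sum, ← Finset.sum_add_distrib, Pi.add_apply, Pi.sub_apply]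
  refine Finset.sum_congr rfl fun i _ => Finset.sum_congr rfl fun j _ => ?_
  ring

theorem quadForm_neg (τ : Matrix ι ι ℂ) (x : ι → ℂ) : quadForm τ (-x) = quadForm τ x := by
  simp [quadForm]

/-- The second order theta constant `θ[σ, c](2τ)`, with an integral lower characteristic `c`. -/
def secondTheta (τ : Matrix ι ι ℂ) (c : ι → ℤ) (σ : ι → ZMod 2) : ℂ :=
  ∑' n : ι → ℤ, Complex.exp (Real.pi * Complex.I *
    (2 * quadForm τ (shifted n σ) + ∑ i, shifted n σ i * c i))

/-- The sign `(-1)^{σ·δ}`. -/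
def charSign (σ δ : ι → ZMod 2) : ℂ := ∏ i, (-1) ^ ((σ i).val * (δ i).val)

theorem exp_two_pi_shifted (n : ι → ℤ) (σ δ : ι → ZMod 2) :
    Complex.exp (Real.pi * Complex.I * (2 * ∑ i, shifted n σ i * (δ i).val)) = charSign σ δ := by
  rw [charSign, Finset.mul_sum, Finset.mul_sum, Complex.exp_sum]
  refine Finset.prod_congr rfl fun i _ => ?_
  rw [← Complex.exp_pi_mul_I, ← Complex.exp_nat_mul,
    show (Real.pi : ℂ) * Complex.I * (2 * (shifted n σ i * (δ i).val)) =
      ((σ i).val * (δ i).val : ℕ) * (Real.pi * Complex.I) +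
        (n i * (δ i).val : ℤ) * (2 * Real.pi * Complex.I) by
      simp only [shifted]; push_cast; ring]
  exact (Complex.exp_periodic.int_mul _) _

/-- Negating the lower characteristic does not change the second order theta constants. -/
theorem secondTheta_neg (τ : Matrix ι ι ℂ) (c : ι → ℤ) (σ : ι → ZMod 2) :
    secondTheta τ (-c) σ = secondTheta τ c σ := by
  let e : (ι → ℤ) ≃ (ι → ℤ) :=
    (Equiv.neg _).trans (Equiv.subRight fun i => ((σ i).val : ℤ))
  rw [secondTheta, secondTheta, ← e.tsum_eq]
  refine tsum_congr fun n => ?_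
  have : shifted (e n) σ = -shifted n σ := by
    ext i
    simp only [shifted, e, Equiv.trans_apply, Equiv.neg_apply, Equiv.subRight_apply, Pi.sub_apply,
      Pi.neg_apply]
    push_cast
    ring
  simp [this, quadForm_neg]

/-- The odd second order theta constants vanish. -/
theorem secondTheta_eq_zero (τ : Matrix ι ι ℂ) (c σ : ι → ZMod 2) (h : charSign σ c = -1) :
    secondTheta τ (fun i => ((c i).val : ℤ)) σ = 0 := by
  have hneg := secondTheta_neg τ (fun i => ((c i).val : ℤ)) σ
  suffices hs : secondTheta τ (fun i => ((c i).val : ℤ)) σ =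
      -secondTheta τ (-fun i => ((c i).val : ℤ)) σ by
    rw [hneg] at hs
    exact self_eq_neg.1 hs
  rw [← neg_one_mul, secondTheta, secondTheta, ← tsum_mul_left]
  refine tsum_congr fun n => ?_
  rw [← h, ← exp_two_pi_shifted n, ← Complex.exp_add, ← mul_add]
  congr 2
  simp only [Pi.neg_apply, Int.cast_neg, mul_neg, Finset.sum_neg_distrib, Int.cast_natCast]
  ring

theorem theta_zero_eq (ε δ : ι → ZMod 2) (τ : Matrix ι ι ℂ) :
    theta ε δ τ 0 = ∑' n : ι → ℤ, Complex.exp (Real.pi * Complex.I *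
      (quadForm τ (shifted n ε) + ∑ i, shifted n ε i * (δ i).val)) := by
  refine tsum_congr fun n => ?_
  congr 2
  simp only [quadForm, shifted, Finset.mul_sum, Pi.zero_apply]
  congr 1
  exact Finset.sum_congr rfl fun i _ => by ring

/-- The duplication formula for a product of two theta constants with the same upper
characteristic. -/
theorem theta_mul_theta {τ : Matrix ι ι ℂ} (hτ : τ ∈ Siegel ι) [DecidableEq ι]
    (ε δ δ' : ι → ZMod 2) (c : ι → ℤ) (hc : ∀ i, ((δ' i).val : ℤ) = (δ i).val + c i) :
    theta ε δ τ 0 * theta ε δ' τ 0 =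
      ∑ σ, charSign (σ + ε) δ * (secondTheta τ c (σ + ε) * secondTheta τ c σ) := by
  have hs (δ : ι → ZMod 2) := by
    simpa only [Complex.ofReal_one, one_mul, Complex.ofReal_natCast] using
      summable_norm_exp_quadForm hτ ε one_pos fun i => ((δ i).val : ℝ)
  have hs2 (c : ι → ℤ) (σ : ι → ZMod 2) := by
    simpa only [Complex.ofReal_ofNat, Complex.ofReal_intCast] using
      summable_norm_exp_quadForm hτ σ two_pos fun i => (c i : ℝ)
  have hterm (σ : ι → ZMod 2) (k l : ι → ℤ) :
      Complex.exp (Real.pi * Complex.I * (quadForm τ (shifted (doubling ε (σ, k, l)).1 ε) +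
          ∑ i, shifted (doubling ε (σ, k, l)).1 ε i * (δ i).val)) *
        Complex.exp (Real.pi * Complex.I * (quadForm τ (shifted (doubling ε (σ, k, l)).2 ε) +
          ∑ i, shifted (doubling ε (σ, k, l)).2 ε i * (δ' i).val)) =
      charSign (σ + ε) δ * (Complex.exp (Real.pi * Complex.I *
          (2 * quadForm τ (shifted k (σ + ε)) + ∑ i, shifted k (σ + ε) i * c i)) *
        Complex.exp (Real.pi * Complex.I *
          (2 * quadForm τ (shifted l σ) + ∑ i, shifted l σ i * (-c) i))) := by
    rw [← exp_two_pi_shifted k, ← Complex.exp_add, ← Complex.exp_add, ← Complex.exp_add,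
      shifted_doubling_fst, shifted_doubling_snd]
    congr 1
    have hquad := quadForm_add_quadForm_sub τ (shifted k (σ + ε)) (shifted l σ)
    have hlin : ∑ i, (shifted k (σ + ε) + shifted l σ) i * ((δ i).val : ℂ) +
        ∑ i, (shifted k (σ + ε) - shifted l σ) i * ((δ' i).val : ℂ) =
        2 * ∑ i, shifted k (σ + ε) i * ((δ i).val : ℂ) + ∑ i, shifted k (σ + ε) i * c i +
        ∑ i, shifted l σ i * ((-c) i : ℤ) := by
      simp only [Finset.mul_sum, ← Finset.sum_add_distrib]
      refine Finset.sum_congr rfl fun i _ => ?_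
      have : ((δ' i).val : ℂ) = (δ i).val + c i := by exact_mod_cast hc i
      simp only [Pi.add_apply, Pi.sub_apply, Pi.neg_apply, this]
      push_cast
      ring
    linear_combination (Real.pi * Complex.I : ℂ) * (hquad + hlin)
  rw [theta_zero_eq, theta_zero_eq, tsum_mul_tsum_of_summable_norm (hs δ) (hs δ'),
    ← (Equiv.ofBijective _ (doubling_bijective ε)).tsum_eq]
  simp only [Equiv.ofBijective_apply]
  have hsum (σ : ι → ZMod 2) := (summable_mul_of_summable_norm (hs2 c (σ + ε)) (hs2 (-c) σ))
  rw [Summable.tsum_prod' ?_ ?_, tsum_fintype]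
  · refine Finset.sum_congr rfl fun σ _ => ?_
    rw [← secondTheta_neg τ c σ, secondTheta, secondTheta,
      tsum_mul_tsum_of_summable_norm (hs2 c (σ + ε)) (hs2 (-c) σ), ← tsum_mul_left]
    exact tsum_congr fun x => hterm σ x.1 x.2
  · exact (Equiv.ofBijective _ (doubling_bijective ε)).summable_iff.2
      (summable_mul_of_summable_norm (hs δ) (hs δ'))
  · intro σ
    exact ((hsum σ).mul_left (charSign (σ + ε) δ)).congr fun x => (hterm σ x.1 x.2).symm

end Duplication
/-- The sum of `k`-th powers of the four values of the characters of `𝔽₂²` on `(x, y, z, t)`. -/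
def charPowSum (k : ℕ) (x y z t : ℂ) : ℂ :=
  (x + y + z + t) ^ k + (x - y + z - t) ^ k + (x + y - z - t) ^ k + (x - y - z + t) ^ k

/-- The product of the four values of the characters of `𝔽₂²` on `(x, y, z, t)`. -/
def charProd (x y z t : ℂ) : ℂ :=
  (x + y + z + t) * (x - y + z - t) * (x + y - z - t) * (x - y - z + t)

/-- The sum of `k`-th powers of the eight squares of theta constants of genus three attached to a
splitting of the second order theta constants into two pairs of columns. -/
def pairPowSum (k : ℕ) (a b c d e f g h : ℂ) : ℂ :=
  (2 * ((a * b + e * f) + (c * d + g * h))) ^ k + (2 * ((a * b + e * f) - (c * d + g * h))) ^ k +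
  (2 * ((a * b - e * f) + (c * d - g * h))) ^ k + (2 * ((a * b - e * f) - (c * d - g * h))) ^ k +
  (2 * ((a * f + e * b) + (c * h + g * d))) ^ k + (2 * ((a * f + e * b) - (c * h + g * d))) ^ k +
  (2 * ((a * f - e * b) + (c * h - g * d))) ^ k + (2 * ((a * f - e * b) - (c * h - g * d))) ^ k

/-- The sum of `k`-th powers of the squares of the 36 even theta constants of genus three, in terms
of the second order theta constants. -/
def evenPowSum (k : ℕ) (a b c d e f g h : ℂ) : ℂ :=
  charPowSum k (a ^ 2 + e ^ 2) (b ^ 2 + f ^ 2) (c ^ 2 + g ^ 2) (d ^ 2 + h ^ 2) +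
  charPowSum k (a ^ 2 - e ^ 2) (b ^ 2 - f ^ 2) (c ^ 2 - g ^ 2) (d ^ 2 - h ^ 2) +
  charPowSum k (2 * a * e) (2 * b * f) (2 * c * g) (2 * d * h) +
  pairPowSum k a b c d e f g h + pairPowSum k a c b d e g f h + pairPowSum k a d b c e h f g

theorem charProd_eq (x y z t : ℂ) :
    charProd x y z t = (x ^ 2) ^ 2 + (y ^ 2) ^ 2 + (z ^ 2) ^ 2 + (t ^ 2) ^ 2
      - 2 * (x ^ 2 * y ^ 2 + x ^ 2 * z ^ 2 + x ^ 2 * t ^ 2 + y ^ 2 * z ^ 2 + y ^ 2 * t ^ 2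
        + z ^ 2 * t ^ 2) + 8 * (x * y * z * t) := by
  unfold charProd; ring

theorem charPowSum_four (x y z t : ℂ) :
    charPowSum 4 x y z t = 4 * ((x ^ 2) ^ 2 + (y ^ 2) ^ 2 + (z ^ 2) ^ 2 + (t ^ 2) ^ 2)
      + 24 * (x ^ 2 * y ^ 2 + x ^ 2 * z ^ 2 + x ^ 2 * t ^ 2 + y ^ 2 * z ^ 2 + y ^ 2 * t ^ 2
        + z ^ 2 * t ^ 2) + 96 * (x * y * z * t) := by
  unfold charPowSum; ring

/-- Half of the sum of the eighth powers of `s + t` and `s - t`, in terms of `x = s²`, `y = t²`. -/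
def evenOctic (x y : ℂ) : ℂ :=
  x ^ 4 + 28 * x ^ 3 * y + 70 * x ^ 2 * y ^ 2 + 28 * x * y ^ 3 + y ^ 4

theorem charPowSum_eight (x y z t : ℂ) :
    charPowSum 8 x y z t =
      4 * (evenOctic (x ^ 2) (y ^ 2) + evenOctic (z ^ 2) (t ^ 2))
      + 112 * ((x ^ 2 + y ^ 2) ^ 3 + 12 * x ^ 2 * y ^ 2 * (x ^ 2 + y ^ 2)) * (z ^ 2 + t ^ 2)
      + 112 * ((z ^ 2 + t ^ 2) ^ 3 + 12 * z ^ 2 * t ^ 2 * (z ^ 2 + t ^ 2)) * (x ^ 2 + y ^ 2)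
      + 280 * ((x ^ 2 + y ^ 2) ^ 2 + 4 * x ^ 2 * y ^ 2) * ((z ^ 2 + t ^ 2) ^ 2 + 4 * z ^ 2 * t ^ 2)
      + x * y * z * t * (4480 * (x ^ 2 + y ^ 2) * (z ^ 2 + t ^ 2)
        + 448 * (3 * (x ^ 2) ^ 2 + 10 * x ^ 2 * y ^ 2 + 3 * (y ^ 2) ^ 2)
        + 448 * (3 * (z ^ 2) ^ 2 + 10 * z ^ 2 * t ^ 2 + 3 * (t ^ 2) ^ 2)) := by
  unfold charPowSum evenOctic; ring

theorem evenOctic_signs (α β γ α' β' γ' : ℂ) :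
    evenOctic (α + β + γ) (α' + β' + γ') + evenOctic (α + β - γ) (α' + β' - γ') +
      evenOctic (α - β + γ) (α' - β' + γ') + evenOctic (α - β - γ) (α' - β' - γ') =
    4 * ((α ^ 2) ^ 2 + (β ^ 2) ^ 2 + (γ ^ 2) ^ 2
        + 6 * (α ^ 2 * β ^ 2 + β ^ 2 * γ ^ 2 + γ ^ 2 * α ^ 2)
      + 28 * (α * α' * (α ^ 2 + 3 * β ^ 2 + 3 * γ ^ 2) + β * β' * (β ^ 2 + 3 * α ^ 2 + 3 * γ ^ 2)
        + γ * γ' * (γ ^ 2 + 3 * α ^ 2 + 3 * β ^ 2))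
      + 70 * ((α ^ 2 + β ^ 2 + γ ^ 2) * (α' ^ 2 + β' ^ 2 + γ' ^ 2)
        + 4 * (α * α' * (β * β') + β * β' * (γ * γ') + γ * γ' * (α * α')))
      + 28 * (α * α' * (α' ^ 2 + 3 * β' ^ 2 + 3 * γ' ^ 2)
        + β * β' * (β' ^ 2 + 3 * α' ^ 2 + 3 * γ' ^ 2)
        + γ * γ' * (γ' ^ 2 + 3 * α' ^ 2 + 3 * β' ^ 2))
      + (α' ^ 2) ^ 2 + (β' ^ 2) ^ 2 + (γ' ^ 2) ^ 2
        + 6 * (α' ^ 2 * β' ^ 2 + β' ^ 2 * γ' ^ 2 + γ' ^ 2 * α' ^ 2)) := by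
  unfold evenOctic; ring

/-- The eighth powers in `pairPowSum` depend only on the squares and products of the columns'
invariants `u = a² + e²`, `v = a² - e²`, `w = 2ae`. -/
theorem pairPowSum_eight {a b c d e f g h p q r A B C A' B' C' : ℂ}
    (hp : p = (a ^ 2 + e ^ 2) * (b ^ 2 + f ^ 2) * ((c ^ 2 + g ^ 2) * (d ^ 2 + h ^ 2)))
    (hq : q = (a ^ 2 - e ^ 2) * (b ^ 2 - f ^ 2) * ((c ^ 2 - g ^ 2) * (d ^ 2 - h ^ 2)))
    (hr : r = 2 * a * e * (2 * b * f) * (2 * c * g * (2 * d * h)))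
    (hA : A = ((a ^ 2 + e ^ 2) * (b ^ 2 + f ^ 2)) ^ 2)
    (hB : B = ((a ^ 2 - e ^ 2) * (b ^ 2 - f ^ 2)) ^ 2)
    (hC : C = (2 * a * e * (2 * b * f)) ^ 2)
    (hA' : A' = ((c ^ 2 + g ^ 2) * (d ^ 2 + h ^ 2)) ^ 2)
    (hB' : B' = ((c ^ 2 - g ^ 2) * (d ^ 2 - h ^ 2)) ^ 2)
    (hC' : C' = (2 * c * g * (2 * d * h)) ^ 2) :
    pairPowSum 8 a b c d e f g h = 128 *
      (A ^ 2 + B ^ 2 + C ^ 2 + 6 * (A * B + B * C + C * A)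
      + 28 * (p * (A + 3 * B + 3 * C) + q * (B + 3 * A + 3 * C) + r * (C + 3 * A + 3 * B))
      + 70 * ((A + B + C) * (A' + B' + C') + 4 * (p * q + q * r + r * p))
      + 28 * (p * (A' + 3 * B' + 3 * C') + q * (B' + 3 * A' + 3 * C')
        + r * (C' + 3 * A' + 3 * B'))
      + A' ^ 2 + B' ^ 2 + C' ^ 2 + 6 * (A' * B' + B' * C' + C' * A')) := by
  have key (s t x y : ℂ) (hx : 2 * s ^ 2 = x) (hy : 2 * t ^ 2 = y) :
      (2 * (s + t)) ^ 8 + (2 * (s - t)) ^ 8 = 32 * evenOctic x y := by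
    subst hx hy
    unfold evenOctic; ring
  have signs := evenOctic_signs ((a ^ 2 + e ^ 2) * (b ^ 2 + f ^ 2))
    ((a ^ 2 - e ^ 2) * (b ^ 2 - f ^ 2)) (2 * a * e * (2 * b * f))
    ((c ^ 2 + g ^ 2) * (d ^ 2 + h ^ 2)) ((c ^ 2 - g ^ 2) * (d ^ 2 - h ^ 2))
    (2 * c * g * (2 * d * h))
  rw [← hp, ← hq, ← hr, ← hA, ← hB, ← hC, ← hA', ← hB', ← hC',
    ← mul_right_inj' (show (32 : ℂ) ≠ 0 by norm_num), mul_add, mul_add, mul_add,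
    ← key (a * b + e * f) (c * d + g * h) _ _ (by ring) (by ring),
    ← key (a * b - e * f) (c * d - g * h) _ _ (by ring) (by ring),
    ← key (a * f + e * b) (c * h + g * d) _ _ (by ring) (by ring),
    ← key (a * f - e * b) (c * h - g * d) _ _ (by ring) (by ring)] at signs
  rw [pairPowSum]
  simp only [← add_assoc] at signs ⊢
  rw [signs, ← mul_assoc]
  norm_num

theorem pairPowSum_four {a b c d e f g h p q r A B C A' B' C' : ℂ}
    (hp : p = (a ^ 2 + e ^ 2) * (b ^ 2 + f ^ 2) * ((c ^ 2 + g ^ 2) * (d ^ 2 + h ^ 2)))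
    (hq : q = (a ^ 2 - e ^ 2) * (b ^ 2 - f ^ 2) * ((c ^ 2 - g ^ 2) * (d ^ 2 - h ^ 2)))
    (hr : r = 2 * a * e * (2 * b * f) * (2 * c * g * (2 * d * h)))
    (hA : A = ((a ^ 2 + e ^ 2) * (b ^ 2 + f ^ 2)) ^ 2)
    (hB : B = ((a ^ 2 - e ^ 2) * (b ^ 2 - f ^ 2)) ^ 2)
    (hC : C = (2 * a * e * (2 * b * f)) ^ 2)
    (hA' : A' = ((c ^ 2 + g ^ 2) * (d ^ 2 + h ^ 2)) ^ 2)
    (hB' : B' = ((c ^ 2 - g ^ 2) * (d ^ 2 - h ^ 2)) ^ 2)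
    (hC' : C' = (2 * c * g * (2 * d * h)) ^ 2) :
    pairPowSum 4 a b c d e f g h =
      32 * (A + B + C + 6 * (p + q + r) + A' + B' + C') := by
  subst hp hq hr hA hB hC hA' hB' hC'
  unfold pairPowSum
  ring

theorem evenPowSum_relation (a b c d e f g h : ℂ) :
    8 * evenPowSum 8 a b c d e f g h - evenPowSum 4 a b c d e f g h ^ 2 =
      336 * (charProd (a ^ 2 + e ^ 2) (b ^ 2 + f ^ 2) (c ^ 2 + g ^ 2) (d ^ 2 + h ^ 2) ^ 2
        + charProd (a ^ 2 - e ^ 2) (b ^ 2 - f ^ 2) (c ^ 2 - g ^ 2) (d ^ 2 - h ^ 2) ^ 2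
        + charProd (2 * a * e) (2 * b * f) (2 * c * g) (2 * d * h) ^ 2
        - 2 * (charProd (a ^ 2 + e ^ 2) (b ^ 2 + f ^ 2) (c ^ 2 + g ^ 2) (d ^ 2 + h ^ 2)
            * charProd (a ^ 2 - e ^ 2) (b ^ 2 - f ^ 2) (c ^ 2 - g ^ 2) (d ^ 2 - h ^ 2)
          + charProd (a ^ 2 - e ^ 2) (b ^ 2 - f ^ 2) (c ^ 2 - g ^ 2) (d ^ 2 - h ^ 2)
            * charProd (2 * a * e) (2 * b * f) (2 * c * g) (2 * d * h)
          + charProd (2 * a * e) (2 * b * f) (2 * c * g) (2 * d * h)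
            * charProd (a ^ 2 + e ^ 2) (b ^ 2 + f ^ 2) (c ^ 2 + g ^ 2) (d ^ 2 + h ^ 2))) := by
  have hsq (x y : ℂ) : (x ^ 2 + y ^ 2) ^ 2 = (x ^ 2 - y ^ 2) ^ 2 + (2 * x * y) ^ 2 := by ring
  obtain ⟨p, hp⟩ : ∃ p, p = (a ^ 2 + e ^ 2) * (b ^ 2 + f ^ 2) * (c ^ 2 + g ^ 2) * (d ^ 2 + h ^ 2) :=
    ⟨_, rfl⟩
  obtain ⟨q, hq⟩ : ∃ q, q = (a ^ 2 - e ^ 2) * (b ^ 2 - f ^ 2) * (c ^ 2 - g ^ 2) * (d ^ 2 - h ^ 2) :=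
    ⟨_, rfl⟩
  obtain ⟨r, hr⟩ : ∃ r, r = 2 * a * e * (2 * b * f) * (2 * c * g) * (2 * d * h) := ⟨_, rfl⟩
  have hp2 : p ^ 2 = (a ^ 2 + e ^ 2) ^ 2 * (b ^ 2 + f ^ 2) ^ 2 * (c ^ 2 + g ^ 2) ^ 2
      * (d ^ 2 + h ^ 2) ^ 2 := by rw [hp]; simp only [mul_pow]
  have hq2 : q ^ 2 = (a ^ 2 - e ^ 2) ^ 2 * (b ^ 2 - f ^ 2) ^ 2 * (c ^ 2 - g ^ 2) ^ 2
      * (d ^ 2 - h ^ 2) ^ 2 := by rw [hq]; simp only [mul_pow]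
  have hr2 : r ^ 2 = (2 * a * e) ^ 2 * (2 * b * f) ^ 2 * (2 * c * g) ^ 2 * (2 * d * h) ^ 2 := by
    rw [hr, mul_pow, mul_pow, mul_pow]
  have h8b := pairPowSum_eight (p := p) (q := q) (r := r) (a := a) (b := b) (c := c) (d := d)
    (e := e) (f := f) (g := g) (h := h) (by rw [hp]; ring) (by rw [hq]; ring) (by rw [hr]; ring)
    (mul_pow _ _ _).symm (mul_pow _ _ _).symm (mul_pow _ _ _).symm
    (mul_pow _ _ _).symm (mul_pow _ _ _).symm (mul_pow _ _ _).symm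
  have h8c := pairPowSum_eight (p := p) (q := q) (r := r) (a := a) (b := c) (c := b) (d := d)
    (e := e) (f := g) (g := f) (h := h) (by rw [hp]; ring) (by rw [hq]; ring) (by rw [hr]; ring)
    (mul_pow _ _ _).symm (mul_pow _ _ _).symm (mul_pow _ _ _).symm
    (mul_pow _ _ _).symm (mul_pow _ _ _).symm (mul_pow _ _ _).symm
  have h8d := pairPowSum_eight (p := p) (q := q) (r := r) (a := a) (b := d) (c := b) (d := c)
    (e := e) (f := h) (g := f) (h := g) (by rw [hp]; ring) (by rw [hq]; ring) (by rw [hr]; ring)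
    (mul_pow _ _ _).symm (mul_pow _ _ _).symm (mul_pow _ _ _).symm
    (mul_pow _ _ _).symm (mul_pow _ _ _).symm (mul_pow _ _ _).symm
  have h4b := pairPowSum_four (p := p) (q := q) (r := r) (a := a) (b := b) (c := c) (d := d)
    (e := e) (f := f) (g := g) (h := h) (by rw [hp]; ring) (by rw [hq]; ring) (by rw [hr]; ring)
    (mul_pow _ _ _).symm (mul_pow _ _ _).symm (mul_pow _ _ _).symm
    (mul_pow _ _ _).symm (mul_pow _ _ _).symm (mul_pow _ _ _).symm
  have h4c := pairPowSum_four (p := p) (q := q) (r := r) (a := a) (b := c) (c := b) (d := d)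
    (e := e) (f := g) (g := f) (h := h) (by rw [hp]; ring) (by rw [hq]; ring) (by rw [hr]; ring)
    (mul_pow _ _ _).symm (mul_pow _ _ _).symm (mul_pow _ _ _).symm
    (mul_pow _ _ _).symm (mul_pow _ _ _).symm (mul_pow _ _ _).symm
  have h4d := pairPowSum_four (p := p) (q := q) (r := r) (a := a) (b := d) (c := b) (d := c)
    (e := e) (f := h) (g := f) (h := g) (by rw [hp]; ring) (by rw [hq]; ring) (by rw [hr]; ring)
    (mul_pow _ _ _).symm (mul_pow _ _ _).symm (mul_pow _ _ _).symm
    (mul_pow _ _ _).symm (mul_pow _ _ _).symm (mul_pow _ _ _).symm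
  simp only [evenPowSum, h8b, h8c, h8d, h4b, h4c, h4d, charPowSum_eight, charPowSum_four,
    charProd_eq, evenOctic, ← hp, ← hq, ← hr]
  clear h8b h8c h8d h4b h4c h4d hp hq hr
  rw [hsq a e, hsq b f, hsq c g, hsq d h] at hp2 ⊢
  generalize (a ^ 2 - e ^ 2) ^ 2 = va at *
  generalize (b ^ 2 - f ^ 2) ^ 2 = vb at *
  generalize (c ^ 2 - g ^ 2) ^ 2 = vc at *
  generalize (d ^ 2 - h ^ 2) ^ 2 = vd at *
  generalize (2 * a * e) ^ 2 = wa at *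
  generalize (2 * b * f) ^ 2 = wb at *
  generalize (2 * c * g) ^ 2 = wc at *
  generalize (2 * d * h) ^ 2 = wd at *
  linear_combination (-473088) * (hp2 + hq2 + hr2)

section LowGenus

theorem sum_zmod_two (F : ZMod 2 → ℂ) : ∑ x, F x = F 0 + F 1 := Fin.sum_univ_two F

theorem sum_fin_zero_fun (F : (Fin 0 → ZMod 2) → ℂ) : ∑ σ, F σ = F ![] := by
  rw [Fintype.sum_unique]
  exact congrArg F (Subsingleton.elim _ _)

theorem sum_fin_succ_fun {n : ℕ} (F : (Fin (n + 1) → ZMod 2) → ℂ) :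
    ∑ σ, F σ = ∑ σ : Fin n → ZMod 2, F (Matrix.vecCons 0 σ) +
      ∑ σ : Fin n → ZMod 2, F (Matrix.vecCons 1 σ) := by
  rw [← (Fin.consEquiv fun _ => ZMod 2).sum_comp, Fintype.sum_prod_type, sum_zmod_two]
  rfl

theorem charSign_nil : charSign (ι := Fin 0) ![] ![] = 1 := by simp [charSign]

theorem charSign_cons {n : ℕ} (x y : ZMod 2) (σ δ : Fin n → ZMod 2) :
    charSign (Matrix.vecCons x σ) (Matrix.vecCons y δ) =
      (-1) ^ (x.val * y.val) * charSign σ δ := by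
  simp [charSign, Fin.prod_univ_succ]

theorem val_one_zmod_two : (1 : ZMod 2).val = 1 := rfl

theorem one_add_one_zmod_two : (1 : ZMod 2) + 1 = 0 := rfl

/-- The quadratic form in the second order theta constants representing the square of the theta
constant with characteristic `[ε, δ]`. -/
def thetaSq {g : ℕ} (A : (Fin g → ZMod 2) → ℂ) (ε δ : Fin g → ZMod 2) : ℂ :=
  ∑ σ, charSign (σ + ε) δ * (A (σ + ε) * A σ)

theorem sum_thetaSq_pow_genus_three (A : (Fin 3 → ZMod 2) → ℂ) (k : ℕ) (hk : k ≠ 0) :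
    ∑ ε, ∑ δ, (thetaSq A ε δ ^ 2) ^ k = evenPowSum (2 * k)
      (A ![0, 0, 0]) (A ![0, 0, 1]) (A ![0, 1, 0]) (A ![0, 1, 1])
      (A ![1, 0, 0]) (A ![1, 0, 1]) (A ![1, 1, 0]) (A ![1, 1, 1]) := by
  simp only [thetaSq, sum_fin_succ_fun, sum_fin_zero_fun, charSign_cons, charSign_nil,
    Matrix.cons_add_cons, Matrix.empty_add_empty, one_add_one_zmod_two, add_zero, zero_add,
    ZMod.val_zero, val_one_zmod_two, mul_zero, mul_one, pow_zero, pow_one, one_mul,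
    neg_mul, neg_neg, evenPowSum, charPowSum, pairPowSum, pow_mul]
  generalize A ![0, 0, 0] = a
  generalize A ![0, 0, 1] = b
  generalize A ![0, 1, 0] = c
  generalize A ![0, 1, 1] = d
  generalize A ![1, 0, 0] = e
  generalize A ![1, 0, 1] = f
  generalize A ![1, 1, 0] = g
  generalize A ![1, 1, 1] = h
  have h0 : (0 : ℂ) ^ k = 0 := zero_pow hk
  ring_nf
  simp only [h0]
  ring

theorem fmod_identity_genus_one (A : (Fin 1 → ZMod 2) → ℂ) :
    2 ^ 1 * ∑ ε, ∑ δ, (thetaSq A ε δ ^ 2) ^ 4 = (∑ ε, ∑ δ, (thetaSq A ε δ ^ 2) ^ 2) ^ 2 := by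
  simp only [thetaSq, sum_fin_succ_fun, sum_fin_zero_fun, charSign_cons, charSign_nil,
    Matrix.cons_add_cons, Matrix.empty_add_empty, one_add_one_zmod_two, add_zero, zero_add,
    ZMod.val_zero, val_one_zmod_two, mul_zero, mul_one, pow_zero, pow_one, one_mul, neg_mul]
  ring

theorem fmod_identity_genus_two (A : (Fin 2 → ZMod 2) → ℂ) :
    2 ^ 2 * ∑ ε, ∑ δ, (thetaSq A ε δ ^ 2) ^ 4 = (∑ ε, ∑ δ, (thetaSq A ε δ ^ 2) ^ 2) ^ 2 := by
  simp only [thetaSq, sum_fin_succ_fun, sum_fin_zero_fun, charSign_cons, charSign_nil,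
    Matrix.cons_add_cons, Matrix.empty_add_empty, one_add_one_zmod_two, add_zero, zero_add,
    ZMod.val_zero, val_one_zmod_two, mul_zero, mul_one, pow_zero, pow_one, one_mul, neg_mul]
  ring

theorem theta_sq_eq_thetaSq {g : ℕ} {τ : Matrix (Fin g) (Fin g) ℂ} (hτ : τ ∈ Siegel (Fin g))
    (ε δ : Fin g → ZMod 2) : theta ε δ τ 0 ^ 2 = thetaSq (secondTheta τ 0) ε δ := by
  rw [sq]
  exact theta_mul_theta hτ ε δ δ 0 (by simp)

theorem sum_thetaConst_pow {g : ℕ} {τ : Matrix (Fin g) (Fin g) ℂ} (hτ : τ ∈ Siegel (Fin g))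
    (k : ℕ) : ∑ m : Char2 (Fin g), thetaConst m τ ^ (4 * k) =
      ∑ ε, ∑ δ, (thetaSq (secondTheta τ 0) ε δ ^ 2) ^ k := by
  rw [Fintype.sum_prod_type]
  refine Finset.sum_congr rfl fun ε _ => Finset.sum_congr rfl fun δ _ => ?_
  rw [← theta_sq_eq_thetaSq hτ, ← pow_mul, ← pow_mul, ← mul_assoc]
  rfl

/-- Riemann's quartic relation `r₁ = r₂ + r₃` between products of four theta constants in genus
three. -/
theorem riemann_relation_genus_three {τ : Matrix (Fin 3) (Fin 3) ℂ} (hτ : τ ∈ Siegel (Fin 3)) :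
    theta ![0, 0, 0] ![0, 0, 0] τ 0 * theta ![0, 0, 0] ![0, 0, 1] τ 0 *
      (theta ![0, 0, 0] ![0, 1, 0] τ 0 * theta ![0, 0, 0] ![0, 1, 1] τ 0) =
    theta ![0, 0, 0] ![1, 0, 0] τ 0 * theta ![0, 0, 0] ![1, 0, 1] τ 0 *
      (theta ![0, 0, 0] ![1, 1, 0] τ 0 * theta ![0, 0, 0] ![1, 1, 1] τ 0) +
    theta ![1, 0, 0] ![0, 0, 0] τ 0 * theta ![1, 0, 0] ![0, 0, 1] τ 0 *
      (theta ![1, 0, 0] ![0, 1, 0] τ 0 * theta ![1, 0, 0] ![0, 1, 1] τ 0) := by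
  obtain ⟨A, hA⟩ : ∃ A, A = secondTheta τ (fun i => ((![0, 0, 1] : Fin 3 → ZMod 2) i).val) :=
    ⟨_, rfl⟩
  have hzero (x y : ZMod 2) : A ![x, y, 1] = 0 := by
    rw [hA]
    exact secondTheta_eq_zero τ _ _ (by simp [charSign_cons, charSign_nil, val_one_zmod_two])
  have hmul (ε : Fin 3 → ZMod 2) (x y : ZMod 2) :
      theta ε ![x, y, 0] τ 0 * theta ε ![x, y, 1] τ 0 = thetaSq A ε ![x, y, 0] := by
    rw [hA]
    refine theta_mul_theta hτ ε _ _ _ fun i => ?_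
    fin_cases i <;> simp
  simp only [hmul]
  simp only [thetaSq, sum_fin_succ_fun, sum_fin_zero_fun, charSign_cons, charSign_nil,
    Matrix.cons_add_cons, Matrix.empty_add_empty, one_add_one_zmod_two, add_zero, zero_add,
    ZMod.val_zero, val_one_zmod_two, mul_zero, mul_one, pow_zero, pow_one, one_mul, neg_mul,
    hzero]
  ring

theorem fmod_identity_genus_three {τ : Matrix (Fin 3) (Fin 3) ℂ} (hτ : τ ∈ Siegel (Fin 3)) :
    2 ^ 3 * ∑ ε, ∑ δ, (thetaSq (secondTheta τ 0) ε δ ^ 2) ^ 4 =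
      (∑ ε, ∑ δ, (thetaSq (secondTheta τ 0) ε δ ^ 2) ^ 2) ^ 2 := by
  rw [sum_thetaSq_pow_genus_three _ 4 (by norm_num), sum_thetaSq_pow_genus_three _ 2 (by norm_num)]
  have hrel := riemann_relation_genus_three hτ
  have hsq := theta_sq_eq_thetaSq hτ
  have relation := evenPowSum_relation
    (secondTheta τ 0 ![0, 0, 0]) (secondTheta τ 0 ![0, 0, 1])
    (secondTheta τ 0 ![0, 1, 0]) (secondTheta τ 0 ![0, 1, 1])
    (secondTheta τ 0 ![1, 0, 0]) (secondTheta τ 0 ![1, 0, 1])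
    (secondTheta τ 0 ![1, 1, 0]) (secondTheta τ 0 ![1, 1, 1])
  generalize secondTheta τ 0 = A at hsq relation ⊢
  have hprod (ε : Fin 3 → ZMod 2) (x : ZMod 2) :
      (theta ε ![x, 0, 0] τ 0 * theta ε ![x, 0, 1] τ 0 *
        (theta ε ![x, 1, 0] τ 0 * theta ε ![x, 1, 1] τ 0)) ^ 2 =
      thetaSq A ε ![x, 0, 0] * thetaSq A ε ![x, 0, 1] *
        (thetaSq A ε ![x, 1, 0] * thetaSq A ε ![x, 1, 1]) := by
    simp only [mul_pow, hsq]
  have hp := hprod ![0, 0, 0] 0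
  have hq := hprod ![0, 0, 0] 1
  have hr := hprod ![1, 0, 0] 0
  rw [hrel] at hp
  generalize theta ![0, 0, 0] ![1, 0, 0] τ 0 * theta ![0, 0, 0] ![1, 0, 1] τ 0 *
      (theta ![0, 0, 0] ![1, 1, 0] τ 0 * theta ![0, 0, 0] ![1, 1, 1] τ 0) = r₂ at hp hq
  generalize theta ![1, 0, 0] ![0, 0, 0] τ 0 * theta ![1, 0, 0] ![0, 0, 1] τ 0 *
      (theta ![1, 0, 0] ![0, 1, 0] τ 0 * theta ![1, 0, 0] ![0, 1, 1] τ 0) = r₃ at hp hr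
  have hp' : charProd (A ![0, 0, 0] ^ 2 + A ![1, 0, 0] ^ 2) (A ![0, 0, 1] ^ 2 + A ![1, 0, 1] ^ 2)
      (A ![0, 1, 0] ^ 2 + A ![1, 1, 0] ^ 2) (A ![0, 1, 1] ^ 2 + A ![1, 1, 1] ^ 2) =
      (r₂ + r₃) ^ 2 := by
    rw [hp]
    simp only [thetaSq, sum_fin_succ_fun, sum_fin_zero_fun, charSign_cons, charSign_nil,
      Matrix.cons_add_cons, Matrix.empty_add_empty, add_zero,
      ZMod.val_zero, val_one_zmod_two, mul_zero, mul_one, pow_zero, pow_one, one_mul, neg_mul,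
      neg_neg, charProd]
    ring
  have hq' : charProd (A ![0, 0, 0] ^ 2 - A ![1, 0, 0] ^ 2) (A ![0, 0, 1] ^ 2 - A ![1, 0, 1] ^ 2)
      (A ![0, 1, 0] ^ 2 - A ![1, 1, 0] ^ 2) (A ![0, 1, 1] ^ 2 - A ![1, 1, 1] ^ 2) = r₂ ^ 2 := by
    rw [hq]
    simp only [thetaSq, sum_fin_succ_fun, sum_fin_zero_fun, charSign_cons, charSign_nil,
      Matrix.cons_add_cons, Matrix.empty_add_empty, add_zero,
      ZMod.val_zero, val_one_zmod_two, mul_zero, mul_one, pow_zero, pow_one, one_mul, neg_mul,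
      neg_neg, charProd]
    ring
  have hr' : charProd (2 * A ![0, 0, 0] * A ![1, 0, 0]) (2 * A ![0, 0, 1] * A ![1, 0, 1])
      (2 * A ![0, 1, 0] * A ![1, 1, 0]) (2 * A ![0, 1, 1] * A ![1, 1, 1]) = r₃ ^ 2 := by
    rw [hr]
    simp only [thetaSq, sum_fin_succ_fun, sum_fin_zero_fun, charSign_cons, charSign_nil,
      Matrix.cons_add_cons, Matrix.empty_add_empty, one_add_one_zmod_two, add_zero, zero_add,
      ZMod.val_zero, val_one_zmod_two, mul_zero, mul_one, pow_zero, pow_one, one_mul, neg_mul,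
      neg_neg, charProd]
    ring
  rw [hp', hq', hr'] at relation
  norm_num only
  linear_combination relation

end LowGenus

/-- For `g ≤ 3` the modular form `F_g` vanishes identically on `ℍ_g`. -/
theorem Fmod_vanishes_low_genus (g : ℕ) (hg : g ∈ ({1, 2, 3} : Set ℕ))
    (τ : Matrix (Fin g) (Fin g) ℂ) (hτ : τ ∈ Siegel (Fin g)) :
    (2 : ℂ) ^ g * ∑ m : Char2 (Fin g), thetaConst m τ ^ 16 =
      (∑ m : Char2 (Fin g), thetaConst m τ ^ 8) ^ 2 := by
  rw [sum_thetaConst_pow hτ 4, sum_thetaConst_pow hτ 2]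
  rcases hg with rfl | rfl | rfl
  · exact fmod_identity_genus_one _
  · exact fmod_identity_genus_two _
  · exact fmod_identity_genus_three hτ
end
end
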